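/- Let G be a finite EPPO-group with a nontrivial normal q-subgroup Q for an odd prime q. Then G is solvable. -/

import Mathlib

/-- A group is an EPPO-group if every element has prime power order. -/
def IsEPPOGroup (G : Type*) [Group G] : Prop :=
  ∀ g : G, ∃ (p n : ℕ), p.Prime ∧ orderOf g = p ^ n

section
set_option linter.unusedSectionVars false
set_option linter.unusedSimpArgs false
open scoped BigOperators ComplexConjugate MonoidAlgebra ComplexOrder Classical
open Module

namespace EPPOaux
universe u
variable {K : Type u} [Group K] [Fintype K]

/-- Hermitian product of functions on a finite group. -/
noncomputable def ip (f g : K → ℂ) : ℂ := (Nat.card K : ℂ)⁻¹ * ∑ x, f x * conj (g x)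

/-- Class functions. -/
def IsClassFn (f : K → ℂ) : Prop := ∀ x g : K, f (g * x * g⁻¹) = f x

theorem char_inv_eq_conj {V : Type*} [AddCommGroup V] [Module ℂ V] [FiniteDimensional ℂ V]
    (ρ : Representation ℂ K V) (g : K) : ρ.character g⁻¹ = conj (ρ.character g) := by
  let b := Module.finBasis ℂ V
  let A : K → Matrix _ _ ℂ := fun g => LinearMap.toMatrix b b (ρ g)
  have hAmul : ∀ x y, A (x * y) = A x * A y := by
    intro x y
    simp only [A, map_mul]
    exact LinearMap.toMatrix_mul b _ _
  have hA1 : A 1 = 1 := by simp only [A, map_one]; exact LinearMap.toMatrix_one b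
  let H := ∑ x, (A x).conjTranspose * A x
  have hH : H.PosDef := by
    have h1 : ((A 1).conjTranspose * A 1).PosDef := by
      rw [hA1]; simpa using Matrix.PosDef.one
    have : H = (A 1).conjTranspose * A 1 + ∑ x ∈ Finset.univ.erase 1, (A x).conjTranspose * A x := by
      exact (Finset.add_sum_erase Finset.univ (fun x => (A x).conjTranspose * A x)
        (Finset.mem_univ 1)).symm
    rw [this]
    refine h1.add_posSemidef ?_
    exact Matrix.posSemidef_sum _ (fun x _ => Matrix.posSemidef_conjTranspose_mul_self _)
  have hinv : (A g).conjTranspose * H * A g = H := by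
    simp only [H, Finset.mul_sum, Finset.sum_mul]
    rw [← Equiv.sum_comp (Equiv.mulRight g) (fun x => (A x).conjTranspose * A x)]
    refine Finset.sum_congr rfl fun x _ => ?_
    simp [hAmul, Matrix.conjTranspose_mul, Matrix.mul_assoc]
  have hu : IsUnit H.det := (Matrix.isUnit_iff_isUnit_det _).1 hH.isUnit
  have h2 : A g * A g⁻¹ = 1 := by rw [← hAmul]; simp [hA1]
  have h3 : H * A g⁻¹ = (A g).conjTranspose * H := by
    calc H * A g⁻¹ = ((A g).conjTranspose * H * A g) * A g⁻¹ := by rw [hinv]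
      _ = _ := by rw [Matrix.mul_assoc, h2, Matrix.mul_one]
  have h4 : A g⁻¹ = H⁻¹ * ((A g).conjTranspose * H) := by
    rw [← h3, ← Matrix.mul_assoc, Matrix.nonsing_inv_mul _ hu, Matrix.one_mul]
  have h5 : (A g⁻¹).trace = conj (A g).trace := by
    rw [h4, Matrix.trace_mul_comm, Matrix.mul_assoc, Matrix.mul_nonsing_inv _ hu, Matrix.mul_one,
      Matrix.trace_conjTranspose]; rfl
  simpa [Representation.character, LinearMap.trace_eq_matrix_trace ℂ b] using h5

/-- Characters. -/
def IsChr (φ : K → ℂ) : Prop := ∃ (V : Type u) (_ : AddCommGroup V) (_ : Module ℂ V)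
  (_ : FiniteDimensional ℂ V) (ρ : Representation ℂ K V), ρ.character = φ

/-- Irreducible characters. -/
def IsIrr (φ : K → ℂ) : Prop := ∃ (V : Type u) (_ : AddCommGroup V) (_ : Module ℂ V)
  (_ : FiniteDimensional ℂ V) (ρ : Representation ℂ K V), ρ.IsIrreducible ∧ ρ.character = φ

theorem IsIrr.isChr {φ : K → ℂ} (h : IsIrr φ) : IsChr φ := by
  obtain ⟨V, a, b, c, ρ, h, rfl⟩ := h
  exact ⟨V, a, b, c, ρ, rfl⟩

noncomputable instance : Invertible (Nat.card K : ℂ) :=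
  invertibleOfNonzero (by exact_mod_cast Nat.card_pos.ne')

theorem IsIrr.orth {φ ψ : K → ℂ} (h : IsIrr φ) (h' : IsIrr ψ) :
    ip φ ψ = if φ = ψ then 1 else 0 := by
  obtain ⟨V, _, _, _, ρ, h, rfl⟩ := h
  obtain ⟨W, _, _, _, σ, h', rfl⟩ := h'
  have := Representation.char_orthonormal ρ σ
  simp only [char_inv_eq_conj] at this
  unfold ip
  rw [this]
  by_cases hn : Nonempty (Representation.Equiv σ ρ)
  · rw [if_pos hn, if_pos (Representation.char_iso hn.some).symm]
  · rw [if_neg hn]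
    split_ifs with he
    · exfalso
      have h1 := Representation.char_orthonormal ρ ρ
      simp only [char_inv_eq_conj] at h1
      rw [he, if_pos ⟨Representation.Equiv.refl ρ⟩] at h1
      rw [he, if_neg hn] at this
      rw [h1] at this
      simp at this
    · simp

theorem IsChr.ip_nat {φ ψ : K → ℂ} (h : IsChr φ) (h' : IsChr ψ) : ∃ n : ℕ, ip φ ψ = n := by
  obtain ⟨V, _, _, _, ρ, rfl⟩ := h
  obtain ⟨W, _, _, _, σ, rfl⟩ := h'
  have := Representation.card_inv_mul_sum_char_mul_char_eq_finrank σ ρ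
  simp only [char_inv_eq_conj] at this
  exact ⟨_, this⟩

theorem IsChr.classFn {φ : K → ℂ} (h : IsChr φ) : IsClassFn φ := by
  obtain ⟨V, _, _, _, ρ, rfl⟩ := h
  intro x g
  exact Representation.char_conj ρ x g

theorem IsChr.inv {φ : K → ℂ} (h : IsChr φ) (x : K) : φ x⁻¹ = conj (φ x) := by
  obtain ⟨V, _, _, _, ρ, rfl⟩ := h
  exact char_inv_eq_conj ρ x

theorem IsChr.conj {φ : K → ℂ} (h : IsChr φ) : IsChr (fun x => conj (φ x)) := by
  obtain ⟨V, _, _, _, ρ, rfl⟩ := h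
  refine ⟨Module.Dual ℂ V, inferInstance, inferInstance, inferInstance, ρ.dual, ?_⟩
  funext x
  rw [Representation.char_dual, char_inv_eq_conj]

theorem isChr_one : IsChr (fun _ : K => (1 : ℂ)) := by
  refine ⟨ULift.{u} ℂ, inferInstance, inferInstance, inferInstance,
    Representation.trivial ℂ K (ULift.{u} ℂ), ?_⟩
  funext x
  have : (Representation.trivial ℂ K (ULift.{u} ℂ)) x = 1 := by ext; simp
  rw [Representation.character, this, LinearMap.trace_one]
  simp

theorem IsChr.restrict {φ : K → ℂ} (h : IsChr φ) (H : Subgroup K) (l : H →* ℂˣ) :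
    ∃ n : ℤ, ∑ x : H, φ x * conj ((l x : ℂˣ) : ℂ) = Nat.card H * n := by
  obtain ⟨V, _, _, _, ρ, rfl⟩ := h
  let σ : Representation ℂ H V :=
    { toFun := fun x => ((l x⁻¹ : ℂˣ) : ℂ) • ρ x
      map_one' := by simp
      map_mul' := by
        intro x y
        ext v
        simp [smul_smul, mul_comm] }
  have hs := Representation.card_inv_mul_sum_char_eq_finrank σ
  have hc : ∀ x : H, conj ((l x : ℂˣ) : ℂ) = ((l x⁻¹ : ℂˣ) : ℂ) := by
    intro x
    have : ‖((l x : ℂˣ) : ℂ)‖ = 1 := by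
      have hp : ((l x : ℂˣ) : ℂ) ^ (Fintype.card H) = 1 := by
        rw [← Units.val_pow_eq_pow_val, ← map_pow, pow_card_eq_one]; simp
      exact Complex.norm_eq_one_of_pow_eq_one hp Fintype.card_ne_zero
    rw [map_inv, Units.val_inv_eq_inv_val, Complex.inv_eq_conj this]
  have hne : (Nat.card H : ℂ) ≠ 0 := by exact_mod_cast Nat.card_pos.ne'
  refine ⟨(Module.finrank ℂ σ.invariants : ℤ), ?_⟩
  push_cast
  rw [← hs, ← mul_assoc, mul_inv_cancel₀ hne, one_mul]
  refine Finset.sum_congr rfl fun x _ => ?_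
  rw [hc]
  simp [Representation.character, σ, mul_comm]

theorem IsIrr.deg {φ : K → ℂ} (h : IsIrr φ) : ∃ n : ℕ, 1 ≤ n ∧ φ 1 = n := by
  obtain ⟨V, _, _, _, ρ, h, rfl⟩ := h
  refine ⟨Module.finrank ℂ V, ?_, by simp⟩
  by_contra hc
  have h0 : Module.finrank ℂ V = 0 := by omega
  have := Module.finrank_zero_iff.1 h0
  have h9 : (⊥ : Subrepresentation ρ) = ⊤ := by
    apply SetLike.ext
    intro x
    rw [Subsingleton.elim x 0]
    exact ⟨fun _ => Submodule.zero_mem (⊤ : Subrepresentation ρ).toSubmodule,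
      fun _ => Submodule.zero_mem (⊥ : Subrepresentation ρ).toSubmodule⟩
  exact bot_ne_top h9

instance : Finite {φ : K → ℂ // IsIrr φ} := by
  have hli : LinearIndependent ℂ (fun φ : {φ : K → ℂ // IsIrr φ} => φ.1) := by
    rw [linearIndependent_iff']
    intro s g hg i hi
    have h1 : ip (∑ j ∈ s, g j • j.1) i.1 = ∑ j ∈ s, g j * ip j.1 i.1 := by
      simp only [ip, Finset.sum_apply, Pi.smul_apply, smul_eq_mul, Finset.sum_mul, Finset.mul_sum]
      rw [Finset.sum_comm]
      refine Finset.sum_congr rfl fun _ _ => Finset.sum_congr rfl fun _ _ => by ring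
    rw [hg, Finset.sum_eq_single i] at h1
    · rw [IsIrr.orth i.2 i.2, if_pos rfl] at h1
      simpa [ip] using h1.symm
    · intro j _ hj
      rw [IsIrr.orth j.2 i.2, if_neg (fun h => hj (Subtype.ext h)), mul_zero]
    · exact fun h => absurd hi h
  exact hli.finite

end EPPOaux
end

section
set_option linter.unusedSectionVars false
set_option linter.unusedSimpArgs false
open scoped BigOperators ComplexConjugate MonoidAlgebra ComplexOrder Classical
open Module

namespace EPPOaux
universe u
variable {K : Type u} [Group K] [Fintype K]

theorem irr_op_zero {V : Type u} [AddCommGroup V] [Module ℂ V] [FiniteDimensional ℂ V]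
    (ρ : Representation ℂ K V) (hρ : ρ.IsIrreducible) (f : K → ℂ) (hf : IsClassFn f)
    (h0 : ip f ρ.character = 0) : ∑ x, conj (f x) • ρ x = 0 := by
  let T : V →ₗ[ℂ] V := ∑ x, conj (f x) • ρ x
  have hT : ∀ g v, T (ρ g v) = ρ g (T v) := by
    intro g v
    simp only [T, LinearMap.sum_apply, LinearMap.smul_apply, map_sum, map_smul]
    rw [← Equiv.sum_comp (MulAut.conj g).toEquiv]
    refine Finset.sum_congr rfl fun x _ => ?_
    simp only [MulEquiv.toEquiv_eq_coe, MulEquiv.coe_toEquiv, MulAut.conj_apply, hf x g]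
    rw [← Module.End.mul_apply, ← map_mul, ← Module.End.mul_apply, ← map_mul]
    simp
  let Φ := T.intertwiningMap_of_isIntertwiningMap ρ ρ hT
  obtain ⟨c, hc⟩ :=
    (Representation.IsIrreducible.algebraMap_intertwiningMap_bijective_of_isAlgClosed (ρ := ρ)).2 Φ
  have hTc : T = c • (1 : V →ₗ[ℂ] V) := by
    ext v
    have : Φ v = T v := rfl
    rw [← this, ← hc]
    rfl
  have htr : LinearMap.trace ℂ V T = c * Module.finrank ℂ V := by
    rw [hTc, map_smul, LinearMap.trace_one, smul_eq_mul]
  have htr0 : LinearMap.trace ℂ V T = 0 := by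
    have h1 : conj (ip f ρ.character) = 0 := by rw [h0, map_zero]
    simp only [ip, map_mul, map_inv₀, map_sum, Complex.conj_conj, map_natCast] at h1
    have hne : (Nat.card K : ℂ)⁻¹ ≠ 0 := inv_ne_zero (by exact_mod_cast Nat.card_pos.ne')
    have h2 := (mul_eq_zero.1 h1).resolve_left hne
    simp only [T, map_sum, map_smul, smul_eq_mul]
    exact h2
  obtain ⟨n, hn1, hn2⟩ := IsIrr.deg (φ := ρ.character) ⟨V, _, _, inferInstance, ρ, hρ, rfl⟩
  rw [Representation.char_one] at hn2
  rw [htr, hn2] at htr0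
  have : c = 0 := (mul_eq_zero.1 htr0).resolve_right (by exact_mod_cast (by omega : n ≠ 0))
  change T = 0
  rw [hTc, this, zero_smul]

theorem simple_sub (m : Submodule ℂ[K] ℂ[K]) (hm : IsSimpleModule ℂ[K] m) :
    ∃ ρ : Representation ℂ K m, ρ.IsIrreducible ∧
      ∀ x (v : m), ((ρ x v : m) : ℂ[K]) = MonoidAlgebra.of ℂ K x * v := by
  have hs : ∀ x (v : m), MonoidAlgebra.of ℂ K x * v ∈ m := fun x v => m.smul_mem _ v.2
  let ρ : Representation ℂ K m :=
    { toFun := fun x =>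
        { toFun := fun v => ⟨MonoidAlgebra.of ℂ K x * v, hs x v⟩
          map_add' := by intro v w; ext1; simp [mul_add]
          map_smul' := by
            intro c v
            ext1
            change MonoidAlgebra.of ℂ K x * (c • (v : ℂ[K])) = c • (MonoidAlgebra.of ℂ K x * v)
            rw [mul_smul_comm] }
      map_one' := by
        apply LinearMap.ext; intro v; apply Subtype.ext
        change MonoidAlgebra.of ℂ K 1 * (v : ℂ[K]) = v
        rw [map_one, one_mul]
      map_mul' := by
        intro x y
        apply LinearMap.ext; intro v; apply Subtype.ext
        change MonoidAlgebra.of ℂ K (x * y) * (v : ℂ[K]) =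
          MonoidAlgebra.of ℂ K x * (MonoidAlgebra.of ℂ K y * v)
        rw [map_mul, mul_assoc] }
  refine ⟨ρ, ?_, fun x v => rfl⟩
  have hnt : Nontrivial m := IsSimpleModule.nontrivial ℂ[K] m
  have key : ∀ W : Subrepresentation ρ, W = ⊥ ∨ W = ⊤ := by
    intro W
    let W' : Submodule ℂ[K] m :=
      { carrier := {v | v ∈ W.toSubmodule}
        add_mem' := fun ha hb => W.toSubmodule.add_mem ha hb
        zero_mem' := W.toSubmodule.zero_mem
        smul_mem' := by
          intro c v hv
          simp only [Set.mem_ofPred_eq] at *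
          induction c using MonoidAlgebra.induction_on with
          | of g => exact W.apply_mem_toSubmodule g hv
          | add a b ha hb => rw [add_smul]; exact W.toSubmodule.add_mem ha hb
          | smul r a ha => rw [smul_assoc]; exact W.toSubmodule.smul_mem r ha }
    rcases eq_bot_or_eq_top W' with h | h
    · left
      apply SetLike.ext
      intro v
      have : v ∈ W' ↔ v ∈ (⊥ : Submodule ℂ[K] m) := by rw [h]
      exact this.trans Iff.rfl
    · right
      apply SetLike.ext
      intro v
      have : v ∈ W' ↔ v ∈ (⊤ : Submodule ℂ[K] m) := by rw [h]
      exact this.trans Iff.rfl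
  have hnt2 : Nontrivial (Subrepresentation ρ) := by
    obtain ⟨v, hv⟩ := exists_ne (0 : m)
    refine ⟨⊥, ⊤, fun h => hv ?_⟩
    have : v ∈ (⊤ : Subrepresentation ρ) := Submodule.mem_top (x := v)
    rw [← h] at this
    exact this
  exact { eq_bot_or_eq_top := key }

theorem complete (f : K → ℂ) (hf : IsClassFn f) (h0 : ∀ φ, IsIrr φ → ip f φ = 0) : f = 0 := by
  let z : ℂ[K] := ∑ x, conj (f x) • MonoidAlgebra.of ℂ K x
  have hzg : ∀ g, z * MonoidAlgebra.of ℂ K g = MonoidAlgebra.of ℂ K g * z := by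
    intro g
    simp only [z, Finset.sum_mul, Finset.mul_sum]
    rw [← Equiv.sum_comp (MulAut.conj g).toEquiv]
    refine Finset.sum_congr rfl fun x _ => ?_
    simp only [MulEquiv.toEquiv_eq_coe, MulEquiv.coe_toEquiv, MulAut.conj_apply, hf x g,
      smul_mul_assoc, mul_smul_comm]
    rw [← map_mul, ← map_mul]
    simp
  have hz : ∀ a, z * a = a * z := by
    intro a
    induction a using MonoidAlgebra.induction_on with
    | of g => exact hzg g
    | add a b ha hb => rw [mul_add, add_mul, ha, hb]
    | smul r a ha => rw [mul_smul_comm, smul_mul_assoc, ha]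
  let N : Submodule ℂ[K] ℂ[K] :=
    { carrier := {v | z * v = 0}
      add_mem' := by
        intro a b ha hb
        simp only [Set.mem_ofPred_eq] at *
        rw [mul_add, ha, hb, add_zero]
      zero_mem' := by simp
      smul_mem' := by
        intro c x hx
        simp only [Set.mem_ofPred_eq, smul_eq_mul] at *
        rw [← mul_assoc, hz, mul_assoc, hx, mul_zero] }
  have hN : (⊤ : Submodule ℂ[K] ℂ[K]) ≤ N := by
    rw [← IsSemisimpleModule.sSup_simples_eq_top ℂ[K] ℂ[K]]
    refine sSup_le ?_
    intro m hm
    simp only [Set.mem_ofPred_eq] at hm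
    obtain ⟨ρ, hρ, hρm⟩ := simple_sub m hm
    have h1 := irr_op_zero ρ hρ f hf (h0 _ ⟨_, _, _, inferInstance, _, hρ, rfl⟩)
    intro v hv
    have h2 := congrArg Subtype.val (LinearMap.congr_fun h1 ⟨v, hv⟩)
    simp only [LinearMap.sum_apply, LinearMap.smul_apply, LinearMap.zero_apply,
      AddSubmonoidClass.coe_finsetSum] at h2
    change z * v = 0
    simp only [z, Finset.sum_mul]
    refine Eq.trans ?_ h2
    refine Finset.sum_congr rfl fun x _ => ?_
    rw [smul_mul_assoc, ← hρm x ⟨v, hv⟩]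
    rfl
  have hz0 : z = 0 := by
    have := hN (Submodule.mem_top (x := (1 : ℂ[K])))
    change z * 1 = 0 at this
    simpa using this
  funext x
  have h6 : z.coeff x = conj (f x) := by
    simp only [z, MonoidAlgebra.of_apply, MonoidAlgebra.coeff_sum]
    rw [Finsupp.finsetSum_apply, Finset.sum_eq_single x]
    · simp
    · intro b _ hb
      simp [Finsupp.single_apply, hb]
    · simp
  rw [hz0] at h6
  have := congrArg conj h6
  simpa using this.symm

end EPPOaux
end

section
set_option linter.unusedSectionVars false
set_option linter.unusedSimpArgs false
open scoped BigOperators ComplexConjugate MonoidAlgebra ComplexOrder Classical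
open Module

namespace EPPOaux
universe u
variable {K : Type u} [Group K] [Fintype K]

variable (K) in
/-- The set of irreducible characters. -/
abbrev Irr : Type u := {φ : K → ℂ // IsIrr φ}

noncomputable instance : Fintype (Irr K) := Fintype.ofFinite _

theorem ip_conj_symm (f g : K → ℂ) : conj (ip f g) = ip g f := by
  simp only [ip, map_mul, map_inv₀, map_sum, Complex.conj_conj, map_natCast]
  congr 1
  exact Finset.sum_congr rfl fun _ _ => mul_comm _ _

theorem ip_sub_left (f g h : K → ℂ) : ip (fun x => f x - g x) h = ip f h - ip g h := by
  simp only [ip, sub_mul, Finset.sum_sub_distrib, mul_sub]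

theorem ip_sub_right (f g h : K → ℂ) : ip h (fun x => f x - g x) = ip h f - ip h g := by
  simp only [ip, map_sub, mul_sub, Finset.sum_sub_distrib]

theorem ip_sum_left {ι : Type*} (s : Finset ι) (c : ι → ℂ) (φ : ι → K → ℂ) (h : K → ℂ) :
    ip (fun x => ∑ i ∈ s, c i * φ i x) h = ∑ i ∈ s, c i * ip (φ i) h := by
  simp only [ip, Finset.sum_mul, Finset.mul_sum]
  rw [Finset.sum_comm]
  refine Finset.sum_congr rfl fun _ _ => Finset.sum_congr rfl fun _ _ => by ring

theorem expand (f : K → ℂ) (hf : IsClassFn f) :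
    f = fun x => ∑ i : Irr K, ip f i.1 * i.1 x := by
  have h := complete (fun x => f x - ∑ i : Irr K, ip f i.1 * i.1 x) ?_ ?_
  · funext x
    exact sub_eq_zero.1 (congrFun h x)
  · intro x g
    simp only [hf x g]
    congr 1
    exact Finset.sum_congr rfl fun i _ => by rw [i.2.isChr.classFn x g]
  · intro φ hφ
    rw [ip_sub_left f, ip_sum_left, Finset.sum_eq_single ⟨φ, hφ⟩]
    · rw [hφ.orth hφ, if_pos rfl]; simp
    · intro j _ hj
      rw [j.2.orth hφ, if_neg (fun h => hj (Subtype.ext h)), mul_zero]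
    · simp

theorem parseval (f g : K → ℂ) (hf : IsClassFn f) :
    ∑ i : Irr K, ip f i.1 * conj (ip g i.1) = ip f g := by
  conv_rhs => rw [expand f hf]
  rw [ip_sum_left]
  exact Finset.sum_congr rfl fun i _ => by rw [ip_conj_symm]

theorem ip_self_eq_zero {f : K → ℂ} (h : ip f f = 0) : f = 0 := by
  have hne : (Nat.card K : ℂ)⁻¹ ≠ 0 := inv_ne_zero (by exact_mod_cast Nat.card_pos.ne')
  have h2 := (mul_eq_zero.1 h).resolve_left hne
  have h3 : ∑ x, ‖f x‖ ^ 2 = 0 := by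
    have : ((∑ x, ‖f x‖ ^ 2 : ℝ) : ℂ) = 0 := by
      rw [← h2]; push_cast
      exact Finset.sum_congr rfl fun x _ => by rw [Complex.mul_conj']
    exact_mod_cast this
  funext x
  have := (Finset.sum_eq_zero_iff_of_nonneg (fun x _ => by positivity)).1 h3 x (Finset.mem_univ _)
  simpa using this

theorem IsChr.irr_of_norm {φ : K → ℂ} (h : IsChr φ) (h1 : ip φ φ = 1) : IsIrr φ := by
  have hp := parseval φ φ h.classFn
  rw [h1] at hp
  choose n hn using fun i : Irr K => h.ip_nat i.2.isChr
  simp only [hn, map_natCast] at hp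
  have hp' : ∑ i, n i * n i = 1 := by exact_mod_cast hp
  obtain ⟨i, hi⟩ : ∃ i, n i ≠ 0 := by
    by_contra hc
    push Not at hc
    simp [hc] at hp'
  have hi1 : n i = 1 := by
    have : n i * n i ≤ 1 := by
      rw [← hp']
      exact Finset.single_le_sum (f := fun i => n i * n i) (fun _ _ => Nat.zero_le _)
        (Finset.mem_univ i)
    nlinarith [Nat.pos_of_ne_zero hi]
  have h2 : ip (fun x => φ x - i.1 x) (fun x => φ x - i.1 x) = 0 := by
    rw [ip_sub_left, ip_sub_right, ip_sub_right, h1, hn, i.2.orth i.2, if_pos rfl,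
      ← ip_conj_symm φ, hn, hi1]
    simp
  have h3 := ip_self_eq_zero h2
  have : φ = i.1 := by funext x; exact sub_eq_zero.1 (congrFun h3 x)
  rw [this]; exact i.2

/-- The complex conjugate of an irreducible character. -/
noncomputable def bar (i : Irr K) : Irr K :=
  ⟨fun x => conj (i.1 x), i.2.isChr.conj.irr_of_norm (by
    have h := i.2.orth i.2
    rw [if_pos rfl] at h
    have h' := congrArg conj h
    rw [map_one] at h'
    rw [← h']
    simp [ip])⟩

variable (K) in
/-- The principal character. -/
noncomputable def one : Irr K :=
  ⟨fun _ => 1, isChr_one.irr_of_norm (by simp [ip])⟩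

theorem bar_bar (i : Irr K) : bar (bar i) = i := by
  apply Subtype.ext; funext x; simp [bar]

theorem real_of_conj_inv (hodd : Odd (Nat.card K)) (x g : K) (h : g * x * g⁻¹ = x⁻¹) : x = 1 := by
  have ho : ∀ y : K, Odd (orderOf y) := fun y => hodd.of_dvd_nat (orderOf_dvd_natCard y)
  have h2 : Commute (g ^ 2) x := by
    have : g ^ 2 * x * (g ^ 2)⁻¹ = x := by
      have e1 : g ^ 2 * x * (g ^ 2)⁻¹ = g * (g * x * g⁻¹) * g⁻¹ := by rw [pow_two]; group
      have e2 : g * x⁻¹ * g⁻¹ = (g * x * g⁻¹)⁻¹ := by group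
      rw [e1, h, e2, h, inv_inv]
    rw [mul_inv_eq_iff_eq_mul] at this
    exact this
  have h3 : Commute g x := by
    obtain ⟨k, hk⟩ := ho g
    have : (g ^ 2) ^ (k + 1) = g := by
      rw [← pow_mul, show 2 * (k + 1) = orderOf g + 1 by omega, pow_succ, pow_orderOf_eq_one, one_mul]
    rw [← this]; exact h2.pow_left _
  have h4 : x * x = 1 := by
    rw [h3.eq, mul_inv_cancel_right] at h
    rw [← inv_mul_cancel x, ← h]
  have h5 : orderOf x ∣ 2 := orderOf_dvd_of_pow_eq_one (by rw [pow_two, h4])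
  have h6 := ho x
  have : orderOf x = 1 := by
    rcases (Nat.dvd_prime Nat.prime_two).1 h5 with h | h
    · exact h
    · rw [h] at h6; exact absurd h6 (by decide)
  exact orderOf_eq_one_iff.1 this

theorem ip_cl (x : K) (φ : K → ℂ) (hφ : IsClassFn φ) :
    ip (fun y => if IsConj x y then 1 else 0) φ =
      (Nat.card K : ℂ)⁻¹ * ((Finset.univ.filter (fun y => IsConj x y)).card * conj (φ x)) := by
  simp only [ip, ite_mul, one_mul, zero_mul]
  congr 1
  rw [← Finset.sum_filter, Finset.sum_congr rfl (g := fun _ => conj (φ x))]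
  · simp
  · intro y hy
    obtain ⟨g, hg⟩ := isConj_iff.1 (Finset.mem_filter.1 hy).2
    rw [← hg, hφ]

theorem cl_classFn (x : K) : IsClassFn (fun y => if IsConj x y then (1 : ℂ) else 0) := by
  intro y g
  have : IsConj x (g * y * g⁻¹) ↔ IsConj x y := by
    constructor
    · exact fun h => h.trans (isConj_iff.2 ⟨g⁻¹, by group⟩)
    · exact fun h => h.trans (isConj_iff.2 ⟨g, rfl⟩)
  simp only [this]

theorem column_orth (x y : K) (h : ¬ IsConj x y) :
    ∑ i : Irr K, i.1 x * conj (i.1 y) = 0 := by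
  have hp := parseval (K := K) (fun z => if IsConj y z then (1 : ℂ) else 0)
    (fun z => if IsConj x z then (1 : ℂ) else 0) (cl_classFn y)
  have h0 : ip (fun z => if IsConj y z then (1 : ℂ) else 0)
    (fun z => if IsConj x z then (1 : ℂ) else 0) = 0 := by
    simp only [ip]
    rw [Finset.sum_eq_zero, mul_zero]
    intro z _
    by_cases h1 : IsConj y z
    · have : ¬ IsConj x z := fun h2 => h (h2.trans h1.symm)
      rw [if_neg this]; simp
    · rw [if_neg h1]; simp
  rw [h0] at hp
  have hne : (Nat.card K : ℂ)⁻¹ ≠ 0 := inv_ne_zero (by exact_mod_cast Nat.card_pos.ne')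
  have hcl : ∀ z : K, ((Finset.univ.filter (fun y => IsConj z y)).card : ℂ) ≠ 0 := by
    intro z
    have : z ∈ Finset.univ.filter (fun y => IsConj z y) := by
      rw [Finset.mem_filter]; exact ⟨Finset.mem_univ _, IsConj.refl _⟩
    exact_mod_cast (Finset.card_pos.2 ⟨z, this⟩).ne'
  have he : ∑ i : Irr K, ip (fun z => if IsConj y z then (1 : ℂ) else 0) i.1 *
      conj (ip (fun z => if IsConj x z then (1 : ℂ) else 0) i.1) =
      ((Nat.card K : ℂ)⁻¹ * (Nat.card K : ℂ)⁻¹ * (Finset.univ.filter (fun z => IsConj y z)).card *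
      (Finset.univ.filter (fun z => IsConj x z)).card) * ∑ i : Irr K, i.1 x * conj (i.1 y) := by
    rw [Finset.mul_sum]
    refine Finset.sum_congr rfl fun i _ => ?_
    rw [ip_cl y i.1 i.2.isChr.classFn, ip_cl x i.1 i.2.isChr.classFn]
    simp only [map_mul, map_inv₀, Complex.conj_conj, map_natCast]
    ring
  rw [he] at hp
  exact (mul_eq_zero.1 hp).resolve_left
    (mul_ne_zero (mul_ne_zero (mul_ne_zero hne hne) (hcl y)) (hcl x))

theorem sum_deg_sq : ∑ i : Irr K, i.1 1 * conj (i.1 1) = Nat.card K := by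
  have hp := parseval (K := K) (fun z => if IsConj 1 z then (1 : ℂ) else 0)
    (fun z => if IsConj 1 z then (1 : ℂ) else 0) (cl_classFn 1)
  have hc : (Finset.univ.filter (fun z : K => IsConj 1 z)) = {1} := by
    ext z; simp [isConj_one_left, eq_comm]
  have hne : (Nat.card K : ℂ) ≠ 0 := by exact_mod_cast Nat.card_pos.ne'
  simp only [fun i : Irr K => ip_cl 1 i.1 i.2.isChr.classFn, hc] at hp
  have h0 : ip (fun z : K => if IsConj 1 z then (1 : ℂ) else 0)
    (fun z => if IsConj 1 z then (1 : ℂ) else 0) = (Nat.card K : ℂ)⁻¹ := by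
    simp [ip, isConj_one_left, ← Finset.sum_filter, hc]
  rw [h0] at hp
  have he : ∑ i : Irr K, i.1 1 * conj (i.1 1) = (Nat.card K : ℂ) * Nat.card K *
     ∑ i : Irr K, (Nat.card K : ℂ)⁻¹ * ((({1} : Finset K).card : ℂ) * conj (i.1 1)) *
      conj ((Nat.card K : ℂ)⁻¹ * ((({1} : Finset K).card : ℂ) * conj (i.1 1))) := by
    rw [Finset.mul_sum]
    refine Finset.sum_congr rfl fun i _ => ?_
    simp only [map_mul, map_inv₀, Complex.conj_conj, map_natCast, Finset.card_singleton, Nat.cast_one,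
      map_one]
    field_simp
  rw [he, hp]
  field_simp

theorem bar_eq_iff (hodd : Odd (Nat.card K)) (i : Irr K) : bar i = i ↔ i = one K := by
  have hcount : ∑ i : Irr K, ip i.1 (bar i).1 = 1 := by
    have hne : (Nat.card K : ℂ) ≠ 0 := by exact_mod_cast Nat.card_pos.ne'
    simp only [ip, ← Finset.mul_sum]
    rw [Finset.sum_comm, Finset.sum_eq_single 1]
    · have : ∀ i : Irr K, conj ((bar i).1 1) = conj (i.1 1) := by
        intro i
        obtain ⟨n, _, hn⟩ := i.2.deg
        simp [bar, hn]
      simp only [this, sum_deg_sq]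
      exact inv_mul_cancel₀ hne
    · intro x _ hx
      have h1 : ¬ IsConj x x⁻¹ := by
        intro h
        obtain ⟨g, hg⟩ := isConj_iff.1 h
        exact hx (real_of_conj_inv hodd x g hg)
      rw [← column_orth x x⁻¹ h1]
      refine Finset.sum_congr rfl fun i _ => ?_
      rw [i.2.isChr.inv]; rfl
    · simp
  have hval : ∀ i : Irr K, ip i.1 (bar i).1 = if bar i = i then 1 else 0 := by
    intro i
    rw [i.2.orth (bar i).2]
    by_cases h : bar i = i
    · rw [if_pos h, if_pos (by rw [h])]
    · rw [if_neg h, if_neg (fun h' => h (Subtype.ext h'.symm))]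
  simp only [hval] at hcount
  rw [Finset.sum_boole] at hcount
  have hc : (Finset.univ.filter (fun i : Irr K => bar i = i)).card = 1 := by exact_mod_cast hcount
  obtain ⟨a, ha⟩ := Finset.card_eq_one.1 hc
  have h1 : bar (one K) = one K := by apply Subtype.ext; funext x; simp [bar, one]
  have h2 : ∀ j : Irr K, bar j = j ↔ j = a := by
    intro j
    have : j ∈ Finset.univ.filter (fun i : Irr K => bar i = i) ↔ j ∈ ({a} : Finset (Irr K)) := by
      rw [ha]
    simpa using this
  have h3 := (h2 _).1 h1
  rw [h2, h3]

end EPPOaux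
end

section
set_option linter.unusedSectionVars false
set_option linter.unusedSimpArgs false
set_option linter.style.haveILetI false
open scoped BigOperators ComplexConjugate ComplexOrder Classical

namespace EPPOaux
universe u
variable {K : Type u} [Group K] [Fintype K]

/-- Normalizer of a subgroup. -/
abbrev Nm {K : Type*} [Group K] (H : Subgroup K) : Subgroup K := Subgroup.normalizer (H : Set K)

/-- Linear characters. -/
abbrev Lin {K : Type*} [Group K] (H : Subgroup K) := H →* ℂˣ

theorem lin_norm {H : Subgroup K} (l : Lin H) (x : H) : ‖((l x : ℂˣ) : ℂ)‖ = 1 := by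
  have hp : ((l x : ℂˣ) : ℂ) ^ (Fintype.card H) = 1 := by
    rw [← Units.val_pow_eq_pow_val, ← map_pow, pow_card_eq_one]; simp
  exact Complex.norm_eq_one_of_pow_eq_one hp Fintype.card_ne_zero

theorem lin_conj {H : Subgroup K} (l : Lin H) (x : H) :
    conj ((l x : ℂˣ) : ℂ) = ((l⁻¹ x : ℂˣ) : ℂ) := by
  rw [MonoidHom.inv_apply, Units.val_inv_eq_inv_val, Complex.inv_eq_conj (lin_norm l x)]

theorem lin_orth {H : Subgroup K} (l m : Lin H) :
    ∑ x : H, ((l x : ℂˣ) : ℂ) * conj ((m x : ℂˣ) : ℂ) = if l = m then (Nat.card H : ℂ) else 0 := by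
  have h := sum_hom_units ((Units.coeHom ℂ).comp (l * m⁻¹))
  have e : (Units.coeHom ℂ).comp (l * m⁻¹) = 1 ↔ l = m := by
    constructor
    · intro h
      rw [← mul_inv_eq_one]
      ext x
      exact DFunLike.congr_fun h x
    · rintro rfl
      ext x; simp
  simp only [e] at h
  rw [Nat.card_eq_fintype_card, ← Nat.cast_zero (R := ℂ), ← apply_ite Nat.cast, ← h]
  refine Finset.sum_congr rfl fun x _ => ?_
  rw [lin_conj]
  simp

noncomputable instance {H : Subgroup K} : Finite (Lin H) := by
  have h := linearIndependent_monoidHom H ℂ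
  have h2 : Function.Injective (fun l : Lin H => (Units.coeHom ℂ).comp l) := by
    intro a b hab
    ext x
    exact DFunLike.congr_fun hab x
  haveI : Finite (H →* ℂ) := h.finite
  exact Finite.of_injective _ h2

noncomputable instance {H : Subgroup K} : Fintype (Lin H) := Fintype.ofFinite _

noncomputable instance twAct {H : Subgroup K} : MulAction (Nm H) (Lin H) where
  smul g m := m.comp ((Subgroup.normalizerMonoidHom H g⁻¹ : H ≃* H) : H →* H)
  one_smul m := by
    change m.comp ((Subgroup.normalizerMonoidHom H 1⁻¹ : H ≃* H) : H →* H) = m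
    ext x; simp
  mul_smul g h m := by
    change m.comp ((Subgroup.normalizerMonoidHom H (g * h)⁻¹ : H ≃* H) : H →* H) =
      (m.comp ((Subgroup.normalizerMonoidHom H h⁻¹ : H ≃* H) : H →* H)).comp
        ((Subgroup.normalizerMonoidHom H g⁻¹ : H ≃* H) : H →* H)
    ext x; simp

theorem nm_conj_mem {H : Subgroup K} (g : Nm H) (x : H) : (g : K)⁻¹ * x * g ∈ H := by
  have := (Subgroup.mem_normalizer_iff''.1 g.2 x).1 x.2
  simpa using this

theorem nmh_apply {H : Subgroup K} (g : Nm H) (x : H) :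
    (Subgroup.normalizerMonoidHom H g⁻¹) x = ⟨(g : K)⁻¹ * x * g, nm_conj_mem g x⟩ := by
  ext
  change (g : K)⁻¹ * x * (g : K)⁻¹⁻¹ = _
  rw [inv_inv]

theorem tw_apply {H : Subgroup K} (g : Nm H) (m : Lin H) (x : H) :
    (g • m) x = m ⟨(g : K)⁻¹ * x * g, nm_conj_mem g x⟩ := by
  change m (Subgroup.normalizerMonoidHom H g⁻¹ x) = _
  rw [nmh_apply]

/-- Extension by zero. -/
noncomputable def ex {H : Subgroup K} (l : Lin H) (x : K) : ℂ :=
  if h : x ∈ H then ((l ⟨x, h⟩ : ℂˣ) : ℂ) else 0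

/-- The function `1 - l` extended by zero. -/
noncomputable def th {H : Subgroup K} (l : Lin H) (x : K) : ℂ := ex (1 : Lin H) x - ex l x

theorem th_one {H : Subgroup K} (l : Lin H) : th l 1 = 0 := by
  have : (⟨1, H.one_mem⟩ : H) = 1 := rfl
  simp [th, ex, this]

theorem th_of_not_mem {H : Subgroup K} (l : Lin H) {x : K} (h : x ∉ H) : th l x = 0 := by
  simp [th, ex, h]

/-- Induction. -/
noncomputable def ind (H : Subgroup K) (t : K → ℂ) (x : K) : ℂ :=
  (Nat.card H : ℂ)⁻¹ * ∑ g, t (g⁻¹ * x * g)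

theorem ind_classFn (H : Subgroup K) (t : K → ℂ) : IsClassFn (ind H t) := by
  intro x k
  simp only [ind]
  congr 1
  rw [← Equiv.sum_comp (Equiv.mulLeft k)]
  refine Finset.sum_congr rfl fun g _ => ?_
  congr 1
  simp only [Equiv.coe_mulLeft]
  group

theorem ip_ind (H : Subgroup K) (t : K → ℂ) (f : K → ℂ) (hf : IsClassFn f) :
    ip (ind H t) f = (Nat.card H : ℂ)⁻¹ * ∑ x, t x * conj (f x) := by
  have hne : (Nat.card K : ℂ) ≠ 0 := by exact_mod_cast Nat.card_pos.ne'
  have h1 : ∀ g : K, ∑ x, t (g⁻¹ * x * g) * conj (f x) = ∑ x, t x * conj (f x) := by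
    intro g
    rw [← Equiv.sum_comp (MulAut.conj g).toEquiv]
    refine Finset.sum_congr rfl fun x _ => ?_
    simp only [MulEquiv.toEquiv_eq_coe, MulEquiv.coe_toEquiv, MulAut.conj_apply, hf x g]
    congr 2
    group
  simp only [ip, ind, mul_assoc]
  simp only [← Finset.mul_sum, Finset.sum_mul]
  rw [Finset.sum_comm]
  simp only [mul_assoc] at h1
  simp only [h1, Finset.sum_const, Finset.card_univ, nsmul_eq_mul]
  rw [Nat.card_eq_fintype_card] at *
  field_simp

theorem sum_ex {H : Subgroup K} (l : Lin H) (f : K → ℂ) :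
    ∑ x, ex l x * f x = ∑ x : H, ((l x : ℂˣ) : ℂ) * f x := by
  have : ∀ x, ex l x * f x = if h : x ∈ H then ((l ⟨x, h⟩ : ℂˣ) : ℂ) * f x else 0 := by
    intro x
    unfold ex
    split_ifs <;> simp
  simp only [this]
  rw [← Finset.sum_subset (Finset.subset_univ (Finset.univ.filter (fun x => x ∈ H)))]
  · symm
    refine Finset.sum_bij (fun x _ => x.1) ?_ ?_ ?_ ?_
    · intro a _; simp
    · intro a _ b _ h; exact Subtype.ext h
    · intro b hb
      exact ⟨⟨b, (Finset.mem_filter.1 hb).2⟩, Finset.mem_univ _, rfl⟩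
    · intro a _; simp
  · intro x _ hx
    have : x ∉ H := by simpa using hx
    simp [this]

/-- Multiplicity of a linear character in an irreducible character. -/
noncomputable def mult {H : Subgroup K} (l : Lin H) (i : Irr K) : ℤ :=
  (i.2.isChr.restrict H l).choose

theorem mult_spec {H : Subgroup K} (l : Lin H) (i : Irr K) :
    ∑ x : H, i.1 x * conj ((l x : ℂˣ) : ℂ) = Nat.card H * mult l i :=
  (i.2.isChr.restrict H l).choose_spec

/-- Coefficients of the induced generalized character. -/
noncomputable def co {H : Subgroup K} (l : Lin H) (i : Irr K) : ℤ := mult (1 : Lin H) i - mult l i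

theorem sum_ex_conj {H : Subgroup K} (l : Lin H) (i : Irr K) :
    ∑ x, ex l x * conj (i.1 x) = Nat.card H * mult l i := by
  rw [sum_ex]
  have := congrArg conj (mult_spec l i)
  simp only [map_sum, map_mul, Complex.conj_conj, map_natCast, map_intCast] at this
  rw [← this]
  exact Finset.sum_congr rfl fun x _ => mul_comm _ _

theorem ip_ind_irr {H : Subgroup K} (l : Lin H) (i : Irr K) :
    ip (ind H (th l)) i.1 = co l i := by
  have hne : (Nat.card H : ℂ) ≠ 0 := by exact_mod_cast Nat.card_pos.ne'
  rw [ip_ind _ _ _ i.2.isChr.classFn]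
  simp only [th, sub_mul, Finset.sum_sub_distrib, sum_ex_conj, co]
  push_cast
  field_simp

theorem parseval_co {H H' : Subgroup K} (l : Lin H) (m : Lin H') :
    ((∑ i : Irr K, co l i * co m i : ℤ) : ℂ) = ip (ind H (th l)) (ind H' (th m)) := by
  rw [← parseval _ _ (ind_classFn _ _)]
  push_cast
  refine Finset.sum_congr rfl fun i _ => ?_
  rw [ip_ind_irr, ip_ind_irr]
  simp

theorem co_one {H : Subgroup K} (l : Lin H) (hl : l ≠ 1) : co l (one K) = 1 := by
  have h1 := mult_spec l (one K)
  have h2 := mult_spec (1 : Lin H) (one K)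
  have hne : (Nat.card H : ℂ) ≠ 0 := by exact_mod_cast Nat.card_pos.ne'
  have e1 := lin_orth (1 : Lin H) l
  have e2 := lin_orth (1 : Lin H) 1
  rw [if_neg (Ne.symm hl)] at e1
  rw [if_pos rfl] at e2
  simp only [one, MonoidHom.one_apply, Units.val_one] at h1 h2 e1 e2
  rw [h1] at e1
  rw [h2] at e2
  have f1 : mult l (one K) = 0 := by
    exact_mod_cast (mul_eq_zero.1 e1).resolve_left hne
  have f2 : mult (1 : Lin H) (one K) = 1 := by
    have : (Nat.card H : ℂ) * (mult (1 : Lin H) (one K) : ℂ) = Nat.card H * 1 := by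
      rw [mul_one]; exact e2
    exact_mod_cast mul_left_cancel₀ hne this
  rw [co, f1, f2]; rfl

theorem mult_bar {H : Subgroup K} (l : Lin H) (i : Irr K) : mult l⁻¹ (bar i) = mult l i := by
  have hne : (Nat.card H : ℂ) ≠ 0 := by exact_mod_cast Nat.card_pos.ne'
  have h1 := mult_spec l⁻¹ (bar i)
  have h2 := congrArg conj (mult_spec l i)
  simp only [map_sum, map_mul, Complex.conj_conj, map_natCast, map_intCast] at h2
  have h3 : (Nat.card H : ℂ) * (mult l⁻¹ (bar i) : ℂ) = Nat.card H * mult l i := by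
    rw [← h1, ← h2]
    refine Finset.sum_congr rfl fun x _ => ?_
    rw [lin_conj, MonoidHom.inv_apply, MonoidHom.inv_apply, inv_inv]; rfl
  exact_mod_cast mul_left_cancel₀ hne h3

theorem co_bar {H : Subgroup K} (l : Lin H) (i : Irr K) : co l⁻¹ (bar i) = co l i := by
  have e : (1 : Lin H)⁻¹ = 1 := by ext; simp
  have h := mult_bar (1 : Lin H) i
  rw [e] at h
  rw [co, co, mult_bar, h]

theorem mult_tw {H : Subgroup K} (g : Nm H) (l : Lin H) (i : Irr K) :
    mult (g • l) i = mult l i := by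
  have hne : (Nat.card H : ℂ) ≠ 0 := by exact_mod_cast Nat.card_pos.ne'
  have h1 := mult_spec (g • l) i
  have h2 := mult_spec l i
  have h3 : (Nat.card H : ℂ) * (mult (g • l) i : ℂ) = Nat.card H * mult l i := by
    rw [← h1, ← h2]
    refine Fintype.sum_equiv (Subgroup.normalizerMonoidHom H g⁻¹).toEquiv _ _ fun x => ?_
    rw [tw_apply]
    simp only [MulEquiv.toEquiv_eq_coe, MulEquiv.coe_toEquiv, nmh_apply]
    congr 1
    rw [← i.2.isChr.classFn x (g : K)⁻¹, inv_inv]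
  exact_mod_cast mul_left_cancel₀ hne h3

end EPPOaux
end

section
set_option linter.unusedSectionVars false
set_option linter.unusedSimpArgs false
set_option linter.style.haveILetI false
open scoped BigOperators ComplexConjugate ComplexOrder Classical

namespace EPPOaux
universe u
variable {K : Type u} [Group K] [Fintype K]

/-- Trivial intersection subgroup containing its centralizers. -/
def TI {K : Type*} [Group K] (H : Subgroup K) : Prop :=
  (∀ h ∈ H, h ≠ 1 → ∀ x, h * x = x * h → x ∈ H) ∧
  (∀ g h, h ∈ H → h ≠ 1 → g⁻¹ * h * g ∈ H → g ∈ Nm H)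

theorem th_tw {H : Subgroup K} (g : Nm H) (m : Lin H) (x : K) :
    th m ((g : K)⁻¹ * x * g) = th (g • m) x := by
  by_cases hx : x ∈ H
  · have h2 := nm_conj_mem g ⟨x, hx⟩
    simp only [th, ex, hx, h2, dif_pos, tw_apply]
    simp
  · have h2 : (g : K)⁻¹ * x * g ∉ H := by
      intro h
      apply hx
      have := nm_conj_mem (H := H) g⁻¹ ⟨_, h⟩
      simpa [mul_assoc] using this
    rw [th_of_not_mem _ hx, th_of_not_mem _ h2]

theorem sum_th_th {H : Subgroup K} (l m : Lin H) (hl : l ≠ 1) (hm : m ≠ 1) :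
    ∑ x, th l x * conj (th m x) = Nat.card H * (1 + if m = l then 1 else 0) := by
  have h1 : ∀ a b : Lin H, ∑ x, ex a x * conj (ex b x) = if a = b then (Nat.card H : ℂ) else 0 := by
    intro a b
    rw [sum_ex, ← lin_orth]
    refine Finset.sum_congr rfl fun x _ => ?_
    simp [ex]
  simp only [th, map_sub, mul_sub, sub_mul, Finset.sum_sub_distrib, h1]
  rw [if_pos trivial, if_neg hl, if_neg (Ne.symm hm)]
  by_cases h : m = l
  · rw [if_pos h, if_pos h.symm]; ring
  · rw [if_neg h, if_neg (Ne.symm h)]; ring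

theorem tw_one {H : Subgroup K} (g : Nm H) : g • (1 : Lin H) = 1 := by
  ext x; rw [tw_apply]; simp

theorem tw_ne_one {H : Subgroup K} (g : Nm H) {m : Lin H} (hm : m ≠ 1) : g • m ≠ 1 := by
  intro h
  apply hm
  have := congrArg (fun y => g⁻¹ • y) h
  simpa [tw_one] using this

theorem tw_inv {H : Subgroup K} (g : Nm H) (m : Lin H) : g • m⁻¹ = (g • m)⁻¹ := by
  ext x; rw [tw_apply, MonoidHom.inv_apply, MonoidHom.inv_apply, tw_apply]

theorem ip_TI {H : Subgroup K} (hH : TI H) (l m : Lin H) (hl : l ≠ 1) (hm : m ≠ 1) :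
    ip (ind H (th l)) (ind H (th m)) * Nat.card H =
      Nat.card (Nm H) + (Finset.univ.filter (fun g : Nm H => g • m = l)).card := by
  have hne : (Nat.card H : ℂ) ≠ 0 := by exact_mod_cast Nat.card_pos.ne'
  rw [ip_ind _ _ _ (ind_classFn _ _)]
  have h1 : ∀ x, th l x * conj (ind H (th m) x) =
      (Nat.card H : ℂ)⁻¹ * ∑ g : Nm H, th l x * conj (th (g • m) x) := by
    intro x
    by_cases hx : x ∈ H
    · by_cases hx1 : x = 1
      · subst hx1; simp [th_one]
      · have h2 : ∑ g : K, th m (g⁻¹ * x * g) = ∑ g : Nm H, th m ((g : K)⁻¹ * x * g) := by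
          rw [← Finset.sum_subset (Finset.subset_univ (Finset.univ.filter (fun g => g ∈ Nm H)))]
          · symm
            refine Finset.sum_bij (fun x _ => x.1) ?_ ?_ ?_ ?_
            · intro a _
              rw [Finset.mem_filter]; exact ⟨Finset.mem_univ _, a.2⟩
            · intro a _ b _ h; exact Subtype.ext h
            · intro b hb
              exact ⟨⟨b, (Finset.mem_filter.1 hb).2⟩, Finset.mem_univ _, rfl⟩
            · intro a _; rfl
          · intro g _ hg
            apply th_of_not_mem
            intro h
            apply hg
            rw [Finset.mem_filter]
            exact ⟨Finset.mem_univ _, hH.2 g x hx hx1 h⟩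
        simp only [ind, h2, th_tw, map_mul, map_sum, map_inv₀, map_natCast, Finset.mul_sum]
        refine Finset.sum_congr rfl fun _ _ => by ring
    · simp [th_of_not_mem _ hx]
  simp only [h1]
  rw [← Finset.mul_sum, Finset.sum_comm]
  simp only [sum_th_th l _ hl (tw_ne_one _ hm), ← Finset.mul_sum, Finset.sum_add_distrib]
  rw [Finset.sum_boole]
  simp only [Finset.sum_const, Finset.card_univ, nsmul_eq_mul, mul_one, Nat.card_eq_fintype_card]
  rw [Nat.card_eq_fintype_card] at hne
  field_simp

theorem free_act {H : Subgroup K} (hH : TI H) (m : Lin H) (hm : m ≠ 1) (g : Nm H)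
    (h : g • m = m) : (g : K) ∈ H := by
  by_contra hg
  apply hm
  have hmem : ∀ x : H, (x : K)⁻¹ * ((g : K)⁻¹ * x * g) ∈ H := fun x =>
    H.mul_mem (H.inv_mem x.2) (nm_conj_mem g x)
  let F : H → H := fun x => ⟨_, hmem x⟩
  have hinj : Function.Injective F := by
    intro a b hab
    have h1 : (a : K)⁻¹ * ((g : K)⁻¹ * a * g) = (b : K)⁻¹ * ((g : K)⁻¹ * b * g) :=
      congrArg Subtype.val hab
    by_contra hne
    apply hg
    refine hH.1 ((b : K) * (a : K)⁻¹) (H.mul_mem b.2 (H.inv_mem a.2)) ?_ g ?_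
    · intro h2
      exact hne (Subtype.ext (mul_inv_eq_one.1 h2).symm)
    · have h3 : (g : K) * (b * ((a : K)⁻¹ * ((g : K)⁻¹ * a * g))) = b * g := by
        rw [h1]; group
      have h4 : (g : K) * (b * ((a : K)⁻¹ * ((g : K)⁻¹ * a * g))) * ((g : K)⁻¹ * (a : K)⁻¹ * g)
        = g * (b * (a : K)⁻¹) := by group
      rw [← h4, h3]; group
  have hsurj := Finite.surjective_of_injective hinj
  apply MonoidHom.ext
  intro y
  obtain ⟨x, rfl⟩ := hsurj y
  have h5 : F x = x⁻¹ * ⟨(g : K)⁻¹ * x * g, nm_conj_mem g x⟩ := rfl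
  rw [h5, map_mul, map_inv, ← tw_apply, h]
  simp

theorem le_nm (H : Subgroup K) : H ≤ Nm H := Subgroup.le_normalizer

theorem tw_of_mem {H : Subgroup K} (g : Nm H) (hg : (g : K) ∈ H) (m : Lin H) : g • m = m := by
  apply MonoidHom.ext; intro x
  rw [tw_apply]
  have : (⟨(g : K)⁻¹ * x * g, nm_conj_mem g x⟩ : H) = ⟨g, hg⟩⁻¹ * x * ⟨g, hg⟩ := rfl
  rw [this, map_mul, map_mul, map_inv]
  simp [mul_comm]

theorem card_tw {H : Subgroup K} (hH : TI H) (l m : Lin H) (hm : m ≠ 1) :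
    (Finset.univ.filter (fun g : Nm H => g • m = l)).card =
      if l ∈ MulAction.orbit (Nm H) m then Nat.card H else 0 := by
  split_ifs with h
  · obtain ⟨g0, hg0⟩ := h
    rw [Nat.card_eq_fintype_card, ← Finset.card_univ]
    symm
    refine Finset.card_bij (fun x _ => g0 * ⟨x.1, le_nm H x.2⟩) ?_ ?_ ?_
    · intro x _
      rw [Finset.mem_filter]
      refine ⟨Finset.mem_univ _, ?_⟩
      rw [mul_smul, tw_of_mem (⟨x.1, le_nm H x.2⟩ : Nm H) x.2]; exact hg0
    · intro a _ b _ hab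
      have := mul_left_cancel hab
      exact Subtype.ext (by simpa using this)
    · intro g hg
      have hg' := (Finset.mem_filter.1 hg).2
      have : ((g0⁻¹ * g : Nm H) : K) ∈ H := by
        apply free_act hH m hm
        rw [mul_smul, hg', ← hg0]; simp
      exact ⟨⟨_, this⟩, Finset.mem_univ _, by ext; simp⟩
  · rw [Finset.card_eq_zero, Finset.filter_eq_empty_iff]
    intro g _ hg
    exact h ⟨g, hg⟩

theorem card_orb {H : Subgroup K} (hH : TI H) {L : ℕ} (hL : Nat.card (Nm H) = L * Nat.card H)
    (m : Lin H) (hm : m ≠ 1) :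
    (Finset.univ.filter (fun l : Lin H => l ∈ MulAction.orbit (Nm H) m)).card = L := by
  have h1 := Finset.card_eq_sum_card_fiberwise (s := (Finset.univ : Finset (Nm H)))
    (t := (Finset.univ : Finset (Lin H))) (f := fun g : Nm H => g • m) (fun _ _ => Finset.mem_coe.2 (Finset.mem_univ _))
  simp only [card_tw hH _ m hm] at h1
  rw [← Finset.sum_filter, Finset.sum_const, smul_eq_mul, Finset.card_univ,
    ← Nat.card_eq_fintype_card, hL] at h1
  exact (Nat.eq_of_mul_eq_mul_right Nat.card_pos h1).symm

theorem sum_co_same {H : Subgroup K} (hH : TI H) {L : ℕ} (hL : Nat.card (Nm H) = L * Nat.card H)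
    (l m : Lin H) (hl : l ≠ 1) (hm : m ≠ 1) :
    ∑ i : Irr K, co l i * co m i = L + if l ∈ MulAction.orbit (Nm H) m then 1 else 0 := by
  have h1 := ip_TI hH l m hl hm
  rw [← parseval_co, card_tw hH l m hm, hL] at h1
  have h2 : (∑ i : Irr K, co l i * co m i) * (Nat.card H : ℤ) =
      L * Nat.card H + (if l ∈ MulAction.orbit (Nm H) m then Nat.card H else 0 : ℕ) := by
    exact_mod_cast h1
  have hne : (Nat.card H : ℤ) ≠ 0 := by exact_mod_cast Nat.card_pos.ne'
  apply mul_right_cancel₀ hne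
  rw [h2]
  split_ifs <;> push_cast <;> ring

theorem sum_co_diff {H H' : Subgroup K}
    (hd : ∀ x ∈ H, x ≠ 1 → ∀ g, g⁻¹ * x * g ∉ H') (l : Lin H) (m : Lin H') :
    ∑ i : Irr K, co l i * co m i = 0 := by
  have h1 := parseval_co l m
  have h0 : ∑ x, th l x * conj (ind H' (th m) x) = 0 := by
    refine Finset.sum_eq_zero fun x _ => ?_
    by_cases hx : x ∈ H
    · by_cases hx1 : x = 1
      · subst hx1; simp [th_one]
      · have : ind H' (th m) x = 0 := by
          rw [ind, Finset.sum_eq_zero, mul_zero]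
          intro g _
          exact th_of_not_mem _ (hd x hx hx1 g)
        simp [this]
    · simp [th_of_not_mem _ hx]
  rw [ip_ind _ _ _ (ind_classFn _ _), h0, mul_zero] at h1
  exact_mod_cast h1

theorem inv_ne_one' {H : Subgroup K} {m : Lin H} (hm : m ≠ 1) : m⁻¹ ≠ 1 := by
  intro h
  apply hm
  ext x
  have := DFunLike.congr_fun h x
  rw [MonoidHom.inv_apply, MonoidHom.one_apply, inv_eq_one] at this
  rw [this]; rfl

theorem inv_inv' {H : Subgroup K} (m : Lin H) : m⁻¹⁻¹ = m := by
  ext x; simp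

theorem inv_not_orbit (hodd : Odd (Nat.card K)) {H : Subgroup K} (hH : TI H) (m : Lin H)
    (hm : m ≠ 1) : m⁻¹ ∉ MulAction.orbit (Nm H) m := by
  rintro ⟨g, hg⟩
  have hg : g • m = m⁻¹ := hg
  have h2 : (g ^ 2) • m = m := by
    rw [pow_two, mul_smul, hg, tw_inv, hg, inv_inv']
  have h3 := free_act hH m hm _ h2
  have h4 : (g : K) ∈ H := by
    obtain ⟨k, hk⟩ : Odd (orderOf (g : K)) := hodd.of_dvd_nat (orderOf_dvd_natCard _)
    have : ((g : K) ^ 2) ^ (k + 1) = g := by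
      rw [← pow_mul, show 2 * (k + 1) = orderOf (g : K) + 1 by omega, pow_succ, pow_orderOf_eq_one,
        one_mul]
    rw [← this]
    exact H.pow_mem (by simpa using h3) _
  rw [tw_of_mem g h4] at hg
  apply hm
  apply MonoidHom.ext
  intro x
  have h5 : m x = (m x)⁻¹ := DFunLike.congr_fun hg x
  have h6 : (m x) ^ 2 = 1 := by
    rw [pow_two]; nth_rewrite 2 [h5]; simp
  have h7 : (m x) ^ (Nat.card H) = 1 := by
    rw [← map_pow, pow_card_eq_one', map_one]
  have h8 : Odd (Nat.card H) := hodd.of_dvd_nat (Subgroup.card_subgroup_dvd_card H)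
  obtain ⟨k, hk⟩ := h8
  rw [hk, pow_succ, pow_mul, h6, one_pow, one_mul] at h7
  simpa using h7

end EPPOaux
end

section
set_option linter.unusedSectionVars false
set_option linter.unusedSimpArgs false
set_option linter.style.haveILetI false
open scoped BigOperators ComplexConjugate ComplexOrder Classical

namespace EPPOaux
universe u
variable {K : Type u} [Group K] [Fintype K]

theorem two_term (d : Irr K → ℤ) (hd : ∀ i, d (bar i) = - d i) (hs : ∑ i, d i * d i = 2) :
    ∃ i, bar i ≠ i ∧ ∀ j, d j = (if j = i then 1 else 0) - (if j = bar i then 1 else 0) := by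
  have h0 : ∃ i, d i ≠ 0 := by
    by_contra h
    push Not at h
    simp [h] at hs
  have h1 : ∃ i, 0 < d i := by
    obtain ⟨i, hi⟩ := h0
    rcases lt_or_gt_of_ne hi with h | h
    · exact ⟨bar i, by rw [hd]; omega⟩
    · exact ⟨i, h⟩
  obtain ⟨i, hi⟩ := h1
  have hb : bar i ≠ i := by
    intro h
    have := hd i
    rw [h] at this; omega
  have key : ∀ j, j ≠ i → j ≠ bar i → d j = 0 ∧ d i = 1 := by
    intro j h1 h2
    have h3 : ∑ k ∈ ({i, bar i, j} : Finset (Irr K)), d k * d k ≤ 2 := by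
      rw [← hs]
      exact Finset.sum_le_sum_of_subset_of_nonneg (Finset.subset_univ _)
        (fun k _ _ => mul_self_nonneg _)
    rw [Finset.sum_insert (by simp [hb.symm, h1.symm]), Finset.sum_insert (by simp [h2.symm]),
      Finset.sum_singleton, hd] at h3
    have h4 : d i = 1 := by nlinarith [mul_self_nonneg (d j)]
    refine ⟨?_, h4⟩
    rw [h4] at h3
    have : d j * d j = 0 := by nlinarith [mul_self_nonneg (d j)]
    simpa using this
  have hi1 : d i = 1 := by
    have h3 : ∑ k ∈ ({i, bar i} : Finset (Irr K)), d k * d k ≤ 2 := by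
      rw [← hs]
      exact Finset.sum_le_sum_of_subset_of_nonneg (Finset.subset_univ _)
        (fun k _ _ => mul_self_nonneg _)
    rw [Finset.sum_insert (by simp [hb.symm]), Finset.sum_singleton, hd] at h3
    nlinarith
  refine ⟨i, hb, fun j => ?_⟩
  by_cases hj : j = i
  · subst hj
    rw [if_pos rfl, if_neg hb.symm, hi1]; rfl
  · by_cases hj2 : j = bar i
    · subst hj2
      rw [if_neg hj, if_pos rfl, hd, hi1]; rfl
    · rw [if_neg hj, if_neg hj2, (key j hj hj2).1]; rfl

/-- difference -/
noncomputable def D {H : Subgroup K} (l : Lin H) (i : Irr K) : ℤ := co l i - co l⁻¹ i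

theorem co_bar' {H : Subgroup K} (l : Lin H) (i : Irr K) : co l (bar i) = co l⁻¹ i := by
  have := co_bar l⁻¹ i
  rwa [inv_inv'] at this

theorem D_bar {H : Subgroup K} (l : Lin H) (i : Irr K) : D l (bar i) = - D l i := by
  rw [D, D, co_bar, co_bar']; ring

theorem D_inv {H : Subgroup K} (l : Lin H) (i : Irr K) : D l⁻¹ i = - D l i := by
  rw [D, D, inv_inv']; ring

/-- The exceptional character. -/
noncomputable def X {H : Subgroup K} (l : Lin H) : Irr K :=
  if h : ∃ i, bar i ≠ i ∧ ∀ j, D l j = (if j = i then 1 else 0) - (if j = bar i then 1 else 0)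
  then h.choose else one K

section
variable (hodd : Odd (Nat.card K)) {H : Subgroup K} (hH : TI H) {L : ℕ}
  (hL : Nat.card (Nm H) = L * Nat.card H)
include hodd hH hL

theorem sum_D_D (l m : Lin H) (hl : l ≠ 1) (hm : m ≠ 1) :
    ∑ i, D l i * D m i = (if l ∈ MulAction.orbit (Nm H) m then 1 else 0)
      - (if l ∈ MulAction.orbit (Nm H) m⁻¹ then 1 else 0)
      - (if l⁻¹ ∈ MulAction.orbit (Nm H) m then 1 else 0)
      + (if l⁻¹ ∈ MulAction.orbit (Nm H) m⁻¹ then 1 else 0) := by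
  have e : ∀ i : Irr K, D l i * D m i = co l i * co m i - co l i * co m⁻¹ i - co l⁻¹ i * co m i
      + co l⁻¹ i * co m⁻¹ i := fun i => by rw [D, D]; ring
  simp only [e, Finset.sum_add_distrib, Finset.sum_sub_distrib]
  rw [sum_co_same hH hL _ _ hl hm, sum_co_same hH hL _ _ hl (inv_ne_one' hm),
    sum_co_same hH hL _ _ (inv_ne_one' hl) hm,
    sum_co_same hH hL _ _ (inv_ne_one' hl) (inv_ne_one' hm)]
  ring

theorem X_spec (l : Lin H) (hl : l ≠ 1) : bar (X l) ≠ X l ∧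
    ∀ j, D l j = (if j = X l then 1 else 0) - (if j = bar (X l) then 1 else 0) := by
  have h : ∃ i, bar i ≠ i ∧ ∀ j, D l j = (if j = i then 1 else 0) - (if j = bar i then 1 else 0) := by
    apply two_term (D l) (D_bar l)
    rw [sum_D_D hodd hH hL l l hl hl, if_pos (MulAction.mem_orbit_self _),
      if_pos (MulAction.mem_orbit_self _), if_neg, if_neg]
    · rfl
    · exact inv_not_orbit hodd hH l hl
    · have := inv_not_orbit hodd hH l⁻¹ (inv_ne_one' hl)
      rwa [inv_inv'] at this
  rw [X, dif_pos h]
  exact h.choose_spec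

theorem X_iff (l : Lin H) (hl : l ≠ 1) (i : Irr K) : D l i = 1 ↔ i = X l := by
  obtain ⟨h1, h2⟩ := X_spec hodd hH hL l hl
  rw [h2]
  constructor
  · intro h
    by_contra hne
    rw [if_neg hne] at h
    split_ifs at h <;> omega
  · rintro rfl
    rw [if_pos rfl, if_neg h1.symm]; rfl

theorem X_inv (l : Lin H) (hl : l ≠ 1) : X l⁻¹ = bar (X l) := by
  symm
  rw [← X_iff hodd hH hL _ (inv_ne_one' hl), D_inv, D_bar, neg_neg, X_iff hodd hH hL _ hl]

theorem X_ne_one (l : Lin H) (hl : l ≠ 1) : X l ≠ one K := by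
  intro h
  have := (X_spec hodd hH hL l hl).1
  rw [h] at this
  exact this ((bar_eq_iff hodd _).2 rfl)

theorem sum_D_X {H' : Subgroup K} (l : Lin H) (hl : l ≠ 1) (m : Lin H') :
    ∑ i, D m i * D l i = 2 * D m (X l) := by
  obtain ⟨h1, h2⟩ := X_spec hodd hH hL l hl
  simp only [h2, mul_sub, mul_ite, mul_one, mul_zero, Finset.sum_sub_distrib,
    Finset.sum_ite_eq', Finset.mem_univ, if_true, D_bar]
  ring

theorem X_eq_iff (l m : Lin H) (hl : l ≠ 1) (hm : m ≠ 1) :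
    X l = X m ↔ l ∈ MulAction.orbit (Nm H) m := by
  constructor
  · intro h
    have h1 := sum_D_X hodd hH hL m hm l
    rw [sum_D_D hodd hH hL _ _ hl hm, ← h, (X_iff hodd hH hL l hl _).2 rfl] at h1
    by_contra hc
    rw [if_neg hc] at h1
    split_ifs at h1 <;> omega
  · rintro ⟨g, hg⟩
    have hg : g • m = l := hg
    symm
    rw [← X_iff hodd hH hL _ hl, ← (X_iff hodd hH hL m hm _).2 rfl, D, D, ← hg, ← tw_inv,
      co, co, co, co, mult_tw, mult_tw]

end

/-- The set of exceptional characters. -/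
noncomputable def FX (H : Subgroup K) : Finset (Irr K) :=
  (Finset.univ.filter (fun l : Lin H => l ≠ 1)).image X

theorem mem_FX {H : Subgroup K} {i : Irr K} : i ∈ FX H ↔ ∃ l : Lin H, l ≠ 1 ∧ X l = i := by
  simp [FX]

theorem card_FX (hodd : Odd (Nat.card K)) {H : Subgroup K} (hH : TI H) {L : ℕ}
    (hL : Nat.card (Nm H) = L * Nat.card H) : (FX H).card * L + 1 = Nat.card (Lin H) := by
  have h1 := Finset.card_eq_sum_card_image (X (H := H)) (Finset.univ.filter (fun l : Lin H => l ≠ 1))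
  have h2 : ∀ b ∈ FX H, ({a ∈ Finset.univ.filter (fun l : Lin H => l ≠ 1) | X a = b}).card = L := by
    intro b hb
    obtain ⟨m, hm, rfl⟩ := mem_FX.1 hb
    rw [← card_orb hH hL m hm]
    congr 1
    ext l
    simp only [Finset.mem_filter, Finset.mem_univ, true_and]
    constructor
    · rintro ⟨h1, h2⟩
      exact (X_eq_iff hodd hH hL l m h1 hm).1 h2
    · intro h
      have : l ≠ 1 := by
        obtain ⟨g, rfl⟩ := h
        exact tw_ne_one g hm
      exact ⟨this, (X_eq_iff hodd hH hL l m this hm).2 h⟩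
  rw [← FX, Finset.sum_congr rfl h2, Finset.sum_const, smul_eq_mul] at h1
  rw [← h1, Finset.filter_ne', Finset.card_erase_of_mem (Finset.mem_univ _), Finset.card_univ,
    ← Nat.card_eq_fintype_card]
  have : 0 < Nat.card (Lin H) := Nat.card_pos
  omega

theorem X_ne_diff (hodd : Odd (Nat.card K)) {H : Subgroup K} (hH : TI H) {L : ℕ}
    (hL : Nat.card (Nm H) = L * Nat.card H) {H' : Subgroup K} (hH' : TI H') {L' : ℕ}
    (hL' : Nat.card (Nm H') = L' * Nat.card H')
    (hd : ∀ x ∈ H, x ≠ 1 → ∀ g, g⁻¹ * x * g ∉ H') (l : Lin H) (m : Lin H') (hl : l ≠ 1)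
    (hm : m ≠ 1) : X l ≠ X m := by
  intro h
  have h1 := sum_D_X hodd hH' hL' m hm l
  rw [← h, (X_iff hodd hH hL l hl _).2 rfl] at h1
  have e : ∀ i : Irr K, D l i * D m i = co l i * co m i - co l i * co m⁻¹ i - co l⁻¹ i * co m i
      + co l⁻¹ i * co m⁻¹ i := fun i => by rw [D, D]; ring
  simp only [e, Finset.sum_add_distrib, Finset.sum_sub_distrib, sum_co_diff hd] at h1
  omega

theorem sum_bar_mod (hodd : Odd (Nat.card K)) (f : Irr K → ℤ) (hf : ∀ i, f (bar i) = f i) :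
    Even (∑ i, f i - f (one K)) := by
  rw [← Finset.sum_erase_add _ _ (Finset.mem_univ (one K)), add_sub_cancel_right]
  rw [← ZMod.intCast_eq_zero_iff_even]
  push_cast
  refine Finset.sum_involution (fun i _ => bar i) ?_ ?_ ?_ ?_
  · intro i _
    rw [hf]; exact CharTwo.add_self_eq_zero _
  · intro i hi _ h
    exact (Finset.mem_erase.1 hi).1 ((bar_eq_iff hodd i).1 h)
  · intro i hi
    refine Finset.mem_erase.2 ⟨fun h => (Finset.mem_erase.1 hi).1 ?_, Finset.mem_univ _⟩
    rw [← bar_bar i, h, (bar_eq_iff hodd _).2 rfl]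
  · intro i _; exact bar_bar i

theorem parity (hodd : Odd (Nat.card K)) {H : Subgroup K} (hH : TI H) {L : ℕ}
    (hL : Nat.card (Nm H) = L * Nat.card H) {H' : Subgroup K} (hH' : TI H') {L' : ℕ}
    (hL' : Nat.card (Nm H') = L' * Nat.card H')
    (hd : ∀ x ∈ H, x ≠ 1 → ∀ g, g⁻¹ * x * g ∉ H') (l : Lin H) (m : Lin H') (hl : l ≠ 1)
    (hm : m ≠ 1) : Odd (co m (X l) + co l (X m)) := by
  have hs : ∀ {H : Subgroup K} (hH : TI H) {L : ℕ}
    (hL : Nat.card (Nm H) = L * Nat.card H) (l : Lin H) (hl : l ≠ 1) (i : Irr K),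
      co l (bar i) - (if bar i = X l then 1 else 0) = co l i - (if i = X l then 1 else 0) := by
    intro H hH L hL l hl i
    have h1 := (X_spec hodd hH hL l hl).2 i
    rw [D] at h1
    rw [co_bar']
    have : (bar i = X l) = (i = bar (X l)) := by
      apply propext; constructor
      · intro h; rw [← h, bar_bar]
      · intro h; rw [h, bar_bar]
    simp only [this]
    omega
  have h1 := sum_bar_mod hodd (fun i => (co l i - (if i = X l then 1 else 0)) *
    (co m i - (if i = X m then 1 else 0))) (fun i => by rw [hs hH hL l hl, hs hH' hL' m hm])
  have h2 := sum_co_diff hd l m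
  have hne := X_ne_diff hodd hH hL hH' hL' hd l m hl hm
  have e : ∀ i : Irr K, (co l i - (if i = X l then 1 else 0)) * (co m i - (if i = X m then 1 else 0))
      = co l i * co m i - (if i = X l then co m i else 0) - (if i = X m then co l i else 0) := by
    intro i
    by_cases h3 : i = X l
    · have : i ≠ X m := by rw [h3]; exact hne
      simp [h3, this, hne]; ring
    · simp [h3]; split_ifs <;> ring
  simp only [e, Finset.sum_sub_distrib, h2, Finset.sum_ite_eq', Finset.mem_univ, if_true,
    co_one l hl, co_one m hm, if_neg (X_ne_one hodd hH hL l hl).symm,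
    if_neg (X_ne_one hodd hH' hL' m hm).symm] at h1
  obtain ⟨k, hk⟩ := h1
  exact ⟨-k-1, by linarith⟩

end EPPOaux
end

section
set_option linter.unusedSectionVars false
set_option linter.unusedSimpArgs false
set_option linter.style.haveILetI false
open scoped BigOperators ComplexConjugate ComplexOrder Classical

namespace EPPOaux
universe u
variable {K : Type u} [Group K] [Fintype K]

/-- energy on nonidentity elements -/
noncomputable def En (H : Subgroup K) (i : Irr K) : ℝ :=
  ∑ x ∈ (Finset.univ : Finset H).erase 1, Complex.normSq (i.1 x)

theorem En_nonneg (H : Subgroup K) (i : Irr K) : 0 ≤ En H i :=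
  Finset.sum_nonneg fun _ _ => Complex.normSq_nonneg _

theorem bessel0 {H : Subgroup K} (i : Irr K) (c : Lin H → ℝ) (hc : ∑ l, c l = 0) :
    2 * (Nat.card H * ∑ l, c l * mult l i) - Nat.card H * ∑ l, c l ^ 2 ≤ En H i := by
  set u : H → ℂ := fun x => ∑ l, (c l : ℂ) * ((l x : ℂˣ) : ℂ) with hu
  have hu1 : u 1 = 0 := by
    simp only [hu, map_one, Units.val_one, mul_one]
    exact_mod_cast hc
  have h1 : ∑ x : H, i.1 x * conj (u x) = ((Nat.card H * ∑ l, c l * mult l i : ℝ) : ℂ) := by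
    simp only [hu, map_sum, map_mul, Complex.conj_ofReal, Finset.mul_sum]
    rw [Finset.sum_comm]
    push_cast
    refine Finset.sum_congr rfl fun l _ => ?_
    have := mult_spec l i
    have e : ∀ x : H, i.1 x * ((c l : ℂ) * conj ((l x : ℂˣ) : ℂ)) =
      c l * (i.1 x * conj ((l x : ℂˣ) : ℂ)) := fun x => by ring
    simp only [e]
    rw [← Finset.mul_sum, this]; ring
  have h2 : ∑ x : H, u x * conj (u x) = ((Nat.card H * ∑ l, c l ^ 2 : ℝ) : ℂ) := by
    simp only [hu, map_sum, map_mul, Complex.conj_ofReal, Finset.mul_sum, Finset.sum_mul]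
    rw [Finset.sum_comm]
    push_cast
    refine Finset.sum_congr rfl fun l _ => ?_
    rw [Finset.sum_comm]
    have e : ∀ (x : H) (m : Lin H), (c m : ℂ) * ((m x : ℂˣ) : ℂ) * ((c l : ℂ) * conj ((l x : ℂˣ) : ℂ)) =
      c m * c l * (((m x : ℂˣ) : ℂ) * conj ((l x : ℂˣ) : ℂ)) := fun x m => by ring
    simp only [e]
    simp only [← Finset.mul_sum, lin_orth]
    simp
    ring
  have h3 : 0 ≤ ∑ x ∈ (Finset.univ : Finset H).erase 1, Complex.normSq (i.1 x - u x) :=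
    Finset.sum_nonneg fun _ _ => Complex.normSq_nonneg _
  simp only [Complex.normSq_sub, Finset.sum_sub_distrib, Finset.sum_add_distrib] at h3
  rw [← En] at h3
  have h4 : ∑ x ∈ (Finset.univ : Finset H).erase 1, Complex.normSq (u x) =
      Nat.card H * ∑ l, c l ^ 2 := by
    rw [Finset.sum_erase _ (by rw [hu1]; simp)]
    have := congrArg Complex.re h2
    rw [Complex.ofReal_re] at this
    rw [← this, Complex.re_sum]
    refine Finset.sum_congr rfl fun x _ => ?_
    rw [Complex.mul_conj, Complex.ofReal_re]
  have h5 : ∑ x ∈ (Finset.univ : Finset H).erase 1, 2 * (i.1 x * conj (u x)).re =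
      2 * (Nat.card H * ∑ l, c l * mult l i) := by
    rw [Finset.sum_erase _ (by rw [hu1]; simp), ← Finset.mul_sum, ← Complex.re_sum, h1,
      Complex.ofReal_re]
  rw [h4, h5] at h3
  linarith

theorem bessel {H : Subgroup K} (i : Irr K) (A : Finset (Lin H)) (v : ℤ)
    (h1 : ∀ l ∈ A, v ≤ mult l i) (h2 : ∀ l, l ∉ A → mult l i + 1 ≤ v) :
    (Nat.card H : ℝ) * (A.card * (Nat.card (Lin H) - A.card)) ≤ Nat.card (Lin H) * En H i := by
  set n : ℝ := (Nat.card (Lin H) : ℝ) with hn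
  set a : ℝ := (A.card : ℝ) with ha
  have hn0 : 0 < n := by rw [hn]; exact_mod_cast Nat.card_pos
  have hsA : ∑ l : Lin H, (if l ∈ A then (1 : ℝ) else 0) = a := by
    rw [Finset.sum_boole, ha]; simp
  have hs1 : ∑ l : Lin H, (1 : ℝ) = n := by simp [hn]
  have ha0 : 0 ≤ a := Nat.cast_nonneg _
  have han : a ≤ n := by
    rw [← hsA, ← hs1]
    exact Finset.sum_le_sum fun l _ => by split_ifs <;> norm_num
  let c : Lin H → ℝ := fun l => (if l ∈ A then (1 : ℝ) else 0) - a / n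
  have hc0 : ∑ l, c l = 0 := by
    have : ∀ l, c l = (if l ∈ A then (1 : ℝ) else 0) - a / n * 1 := fun l => by rw [mul_one]
    simp only [this]
    rw [Finset.sum_sub_distrib, hsA, ← Finset.mul_sum, hs1]; field_simp; ring
  have hc2 : ∑ l, c l ^ 2 = a - a ^ 2 / n := by
    have : ∀ l, c l ^ 2 = (1 - 2 * (a / n)) * (if l ∈ A then (1 : ℝ) else 0) + (a / n) ^ 2 * 1 := by
      intro l; simp only [c]; split_ifs <;> ring
    simp only [this]
    rw [Finset.sum_add_distrib, ← Finset.mul_sum, ← Finset.mul_sum, hsA, hs1]; field_simp; ring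
  have hT : a - a ^ 2 / n ≤ ∑ l, c l * mult l i := by
    have hx : ∑ l, c l * ((mult l i : ℝ) - v) = ∑ l, c l * mult l i := by
      simp only [mul_sub, Finset.sum_sub_distrib, ← Finset.sum_mul, hc0]; ring
    rw [← hx]
    have hq : a / n ≤ 1 := by rw [div_le_one hn0]; exact han
    have hq0 : 0 ≤ a / n := by positivity
    have : ∀ l ∈ Finset.univ, (a / n) * (1 - (if l ∈ A then (1 : ℝ) else 0)) ≤ c l * ((mult l i : ℝ) - v) := by
      intro l _
      by_cases h : l ∈ A
      · simp only [c, if_pos h]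
        have : (v : ℝ) ≤ mult l i := by exact_mod_cast h1 l h
        nlinarith
      · simp only [c, if_neg h]
        have : (mult l i : ℝ) + 1 ≤ v := by exact_mod_cast h2 l h
        nlinarith
    have h := Finset.sum_le_sum this
    rw [← Finset.mul_sum, Finset.sum_sub_distrib, hsA, hs1] at h
    have e : a / n * (n - a) = a - a ^ 2 / n := by field_simp
    linarith
  have hb := bessel0 i c hc0
  rw [hc2] at hb
  have hg : (0 : ℝ) ≤ Nat.card H := Nat.cast_nonneg _
  have h3 : (Nat.card H : ℝ) * (a - a ^ 2 / n) ≤ En H i := by nlinarith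
  have e : a * (n - a) = n * (a - a ^ 2 / n) := by field_simp
  rw [e]
  nlinarith

theorem bessel_one {H : Subgroup K} (i : Irr K) (m : Lin H) (h : co m i ≠ 0) :
    (Nat.card H : ℝ) * (Nat.card (Lin H) - 1) ≤ Nat.card (Lin H) * En H i := by
  have key : ∀ a b : Lin H, mult a i < mult b i →
      (Nat.card H : ℝ) * (Nat.card (Lin H) - 1) ≤ Nat.card (Lin H) * En H i := by
    intro a b hab
    have hA := bessel i (Finset.univ.filter (fun l : Lin H => mult b i ≤ mult l i)) (mult b i)
      (by simp) (by intro l hl; simp at hl; omega)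
    refine le_trans ?_ hA
    set A := Finset.univ.filter (fun l : Lin H => mult b i ≤ mult l i)
    have h1 : 1 ≤ A.card := Finset.card_pos.2 ⟨b, by simp [A]⟩
    have h2 : A.card + 1 ≤ Nat.card (Lin H) := by
      rw [Nat.card_eq_fintype_card, ← Finset.card_univ]
      apply Finset.card_lt_card
      rw [Finset.ssubset_univ_iff]
      intro h
      have : a ∈ A := by rw [h]; simp
      simp [A] at this; omega
    have h1' : (1 : ℝ) ≤ A.card := by exact_mod_cast h1
    have h2' : (A.card : ℝ) + 1 ≤ Nat.card (Lin H) := by exact_mod_cast h2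
    apply mul_le_mul_of_nonneg_left _ (Nat.cast_nonneg _)
    nlinarith
  rw [co] at h
  rcases lt_or_gt_of_ne (sub_ne_zero.1 h) with h1 | h1
  · exact key _ _ h1
  · exact key _ _ h1

theorem bessel_own (hodd : Odd (Nat.card K)) {H : Subgroup K} (hH : TI H) {L : ℕ}
    (hL : Nat.card (Nm H) = L * Nat.card H) (l : Lin H) (hl : l ≠ 1) :
    (Nat.card H : ℝ) * (L * (Nat.card (Lin H) - L)) ≤ Nat.card (Lin H) * En H (X l) := by
  have hD := (X_iff hodd hH hL l hl _).2 rfl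
  rw [D, co, co] at hD
  set i := X l
  have hA := bessel i (Finset.univ.filter (fun m : Lin H => mult l⁻¹ i ≤ mult m i)) (mult l⁻¹ i)
      (by simp) (by intro l hl; simp at hl; omega)
  refine le_trans ?_ hA
  set A := Finset.univ.filter (fun m : Lin H => mult l⁻¹ i ≤ mult m i)
  have h1 : L ≤ A.card := by
    rw [← card_orb hH hL _ (inv_ne_one' hl)]
    apply Finset.card_le_card
    intro m hm
    simp only [Finset.mem_filter, Finset.mem_univ, true_and] at hm
    obtain ⟨g, rfl⟩ := hm
    simp only [A, Finset.mem_filter, Finset.mem_univ, true_and]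
    change _ ≤ mult (g • l⁻¹) i
    rw [mult_tw]
  have h2 : A.card + L ≤ Nat.card (Lin H) := by
    rw [Nat.card_eq_fintype_card, ← Finset.card_univ, ← card_orb hH hL _ hl,
      ← Finset.card_union_of_disjoint]
    · exact Finset.card_le_card (Finset.subset_univ _)
    · rw [Finset.disjoint_left]
      intro m hm hm2
      simp only [Finset.mem_filter, Finset.mem_univ, true_and] at hm2
      obtain ⟨g, rfl⟩ := hm2
      simp only [A, Finset.mem_filter, Finset.mem_univ, true_and] at hm
      change _ ≤ mult (g • l) i at hm
      rw [mult_tw] at hm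
      omega
  have h1' : (L : ℝ) ≤ A.card := by exact_mod_cast h1
  have h2' : (A.card : ℝ) + L ≤ Nat.card (Lin H) := by exact_mod_cast h2
  apply mul_le_mul_of_nonneg_left _ (Nat.cast_nonneg _)
  nlinarith [mul_nonneg (sub_nonneg.2 h1') (by linarith : (0:ℝ) ≤ Nat.card (Lin H) - A.card - L)]

/-- The configuration. -/
structure Cfg {K : Type u} [Group K] {ι : Type*} (H : ι → Subgroup K) (L : ι → ℕ) : Prop where
  ti : ∀ j, TI (H j)
  hL : ∀ j, Nat.card (Nm (H j)) = L j * Nat.card (H j)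
  cover : ∀ x : K, x ≠ 1 → ∃ j g, g⁻¹ * x * g ∈ H j
  disj : ∀ j k, j ≠ k → ∀ x ∈ H j, x ≠ 1 → ∀ g, g⁻¹ * x * g ∉ H k

theorem card_into {H : Subgroup K} (hH : TI H) (x : K) (hx : x ≠ 1) :
    (Finset.univ.filter (fun g : K => g⁻¹ * x * g ∈ H)).card =
      if ∃ g, g⁻¹ * x * g ∈ H then Nat.card (Nm H) else 0 := by
  split_ifs with h
  · obtain ⟨g0, hg0⟩ := h
    rw [Nat.card_eq_fintype_card, ← Finset.card_univ]
    symm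
    refine Finset.card_bij (fun y _ => g0 * y.1) ?_ ?_ ?_
    · intro y _
      simp only [Finset.mem_filter, Finset.mem_univ, true_and]
      have := nm_conj_mem y ⟨_, hg0⟩
      convert this using 1
      simp only; group
    · intro a _ b _ hab
      exact Subtype.ext (mul_left_cancel hab)
    · intro g hg
      simp only [Finset.mem_filter, Finset.mem_univ, true_and] at hg
      refine ⟨⟨g0⁻¹ * g, ?_⟩, Finset.mem_univ _, by simp⟩
      refine hH.2 _ (g0⁻¹ * x * g0) hg0 ?_ ?_
      · intro h; apply hx
        calc x = g0 * (g0⁻¹ * x * g0) * g0⁻¹ := by group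
          _ = 1 := by rw [h]; group
      · convert hg using 1; group
  · rw [Finset.card_eq_zero, Finset.filter_eq_empty_iff]
    intro g _ hg
    exact h ⟨g, hg⟩

theorem sum_conj_H (H : Subgroup K) (F : K → ℝ) (hF : ∀ x g, F (g * x * g⁻¹) = F x) :
    (Nat.card K : ℝ) * ∑ x ∈ (Finset.univ : Finset H).erase 1, F x =
      ∑ x ∈ (Finset.univ : Finset K).erase 1,
        ((Finset.univ.filter (fun g : K => g⁻¹ * x * g ∈ H)).card : ℝ) * F x := by
  have h1 : ∀ g : K, ∑ x ∈ (Finset.univ : Finset H).erase 1, F x =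
      ∑ x ∈ (Finset.univ : Finset K).erase 1, (if g⁻¹ * x * g ∈ H then 1 else 0) * F x := by
    intro g
    simp only [ite_mul, one_mul, zero_mul]
    rw [← Finset.sum_filter]
    refine Finset.sum_bij (fun x _ => g * x.1 * g⁻¹) ?_ ?_ ?_ ?_
    · intro x hx
      have hx := (Finset.mem_erase.1 hx).1
      simp only [Finset.mem_filter, Finset.mem_erase, Finset.mem_univ, and_true]
      refine ⟨?_, ?_⟩
      · intro h; apply hx
        apply Subtype.ext
        simpa using h
      · have : g⁻¹ * (g * x.1 * g⁻¹) * g = x.1 := by group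
        rw [this]; exact x.2
    · intro a _ b _ hab
      simpa using hab
    · intro y hy
      simp only [Finset.mem_filter, Finset.mem_erase, Finset.mem_univ, and_true] at hy
      refine ⟨⟨_, hy.2⟩, ?_, ?_⟩
      · simp only [Finset.mem_erase, Finset.mem_univ, and_true]
        intro h; apply hy.1
        have h := congrArg Subtype.val h
        simp only [Subgroup.coe_one] at h
        calc y = g * (g⁻¹ * y * g) * g⁻¹ := by group
          _ = 1 := by rw [h]; group
      · simp only; group
    · intro x _; rw [hF]
  have h2 : ∑ _g : K, ∑ x ∈ (Finset.univ : Finset H).erase 1, F x =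
      (Nat.card K : ℝ) * ∑ x ∈ (Finset.univ : Finset H).erase 1, F x := by
    rw [Finset.sum_const, Finset.card_univ, nsmul_eq_mul, Nat.card_eq_fintype_card]
  rw [← h2, Finset.sum_congr rfl fun g _ => h1 g, Finset.sum_comm]
  refine Finset.sum_congr rfl fun x _ => ?_
  rw [← Finset.sum_mul, Finset.sum_boole]

theorem partition_sum {ι : Type*} [Fintype ι] {H : ι → Subgroup K} {L : ι → ℕ} (hC : Cfg H L)
    (F : K → ℝ) (hF : ∀ x g, F (g * x * g⁻¹) = F x) :
    ∑ x ∈ (Finset.univ : Finset K).erase 1, F x =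
      ∑ j, (Nat.card K : ℝ) / (L j * Nat.card (H j)) *
        ∑ x ∈ (Finset.univ : Finset (H j)).erase 1, F x := by
  have h1 : ∀ j, (Nat.card K : ℝ) / (L j * Nat.card (H j)) *
        ∑ x ∈ (Finset.univ : Finset (H j)).erase 1, F x =
      ∑ x ∈ (Finset.univ : Finset K).erase 1, (if ∃ g, g⁻¹ * x * g ∈ H j then F x else 0) := by
    intro j
    have hp : (0 : ℝ) < L j * Nat.card (H j) := by
      have : 0 < L j * Nat.card (H j) := by rw [← hC.hL j]; exact Nat.card_pos
      exact_mod_cast this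
    rw [div_mul_eq_mul_div, sum_conj_H _ _ hF, div_eq_iff hp.ne', Finset.sum_mul]
    refine Finset.sum_congr rfl fun x hx => ?_
    rw [card_into (hC.ti j) x (Finset.mem_erase.1 hx).1]
    split_ifs
    · rw [hC.hL j]; push_cast; ring
    · simp
  simp only [h1]
  rw [Finset.sum_comm]
  refine Finset.sum_congr rfl fun x hx => ?_
  have hx1 := (Finset.mem_erase.1 hx).1
  obtain ⟨j, g, hg⟩ := hC.cover x hx1
  rw [Finset.sum_eq_single j]
  · rw [if_pos ⟨g, hg⟩]
  · rintro k - hk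
    rw [if_neg]
    rintro ⟨g', hg'⟩
    refine hC.disj j k hk.symm _ hg ?_ (g⁻¹ * g') ?_
    · intro h; apply hx1
      calc x = g * (g⁻¹ * x * g) * g⁻¹ := by group
        _ = 1 := by rw [h]; group
    · convert hg' using 1; group
  · intro h; exact absurd (Finset.mem_univ _) h

end EPPOaux
end

section
set_option linter.unusedSectionVars false
set_option linter.unusedSimpArgs false
set_option linter.style.haveILetI false
open scoped BigOperators ComplexConjugate ComplexOrder Classical

namespace EPPOaux
universe u
variable {K : Type u} [Group K] [Fintype K]

theorem Cfg.Lpos {ι : Type*} {H : ι → Subgroup K} {L : ι → ℕ} (hC : Cfg H L) (j : ι) : 0 < L j := by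
  have : 0 < L j * Nat.card (H j) := by rw [← hC.hL j]; exact Nat.card_pos
  exact Nat.pos_of_mul_pos_right this

theorem count {ι : Type*} [Fintype ι] {H : ι → Subgroup K} {L : ι → ℕ} (hC : Cfg H L) :
    ∑ j, (1 / (L j : ℝ)) * (1 - 1 / Nat.card (H j)) = 1 - 1 / Nat.card K := by
  have h := partition_sum hC (fun _ => 1) (fun _ _ => rfl)
  have hk : (0 : ℝ) < Nat.card K := by exact_mod_cast Nat.card_pos
  have e : ∀ {M : Type u} [Group M] [Fintype M] [DecidableEq M], ∑ x ∈ (Finset.univ : Finset M).erase 1, (1 : ℝ) =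
      Nat.card M - 1 := by
    intro M _ _ _
    rw [Finset.sum_const, Finset.card_erase_of_mem (Finset.mem_univ _), Finset.card_univ,
      nsmul_eq_mul, mul_one, Nat.cast_sub Fintype.card_pos, Nat.card_eq_fintype_card]; simp
  simp only [e] at h
  have h2 : (Nat.card K : ℝ) - 1 = Nat.card K * ∑ j, (1 / (L j : ℝ)) * (1 - 1 / Nat.card (H j)) := by
    rw [h, Finset.mul_sum]
    refine Finset.sum_congr rfl fun j _ => ?_
    have h1 : (0 : ℝ) < L j := by exact_mod_cast hC.Lpos j
    have h2 : (0 : ℝ) < Nat.card (H j) := by exact_mod_cast Nat.card_pos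
    field_simp
  have h3 : (1 : ℝ) - 1 / Nat.card K = (Nat.card K - 1) / Nat.card K := by field_simp
  rw [h3, h2]; field_simp

theorem total (i : Irr K) : ∑ x ∈ (Finset.univ : Finset K).erase 1, Complex.normSq (i.1 x) ≤
    Nat.card K - 1 := by
  have h1 := i.2.orth i.2
  rw [if_pos rfl, ip] at h1
  have hne : (Nat.card K : ℂ) ≠ 0 := by exact_mod_cast Nat.card_pos.ne'
  have h2 : ∑ x, i.1 x * conj (i.1 x) = Nat.card K := by
    field_simp at h1; exact h1
  have h3 : ∑ x, Complex.normSq (i.1 x) = Nat.card K := by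
    have : ((∑ x, Complex.normSq (i.1 x) : ℝ) : ℂ) = Nat.card K := by
      rw [← h2]; push_cast
      exact Finset.sum_congr rfl fun x _ => (Complex.mul_conj _).symm
    exact_mod_cast this
  obtain ⟨n, hn, hd⟩ := i.2.deg
  rw [← Finset.sum_erase_add _ _ (Finset.mem_univ (1 : K)), hd] at h3
  have : (1 : ℝ) ≤ Complex.normSq (n : ℂ) := by
    rw [Complex.normSq_natCast]
    have : (1 : ℝ) ≤ n := by exact_mod_cast hn
    nlinarith
  linarith

theorem mainC {ι : Type*} [Fintype ι] {H : ι → Subgroup K} {L : ι → ℕ} (hC : Cfg H L)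
    (hodd : Odd (Nat.card K)) (i : ι) (hi : Nontrivial (Lin (H i))) :
    ∃ C : Finset ι, i ∉ C ∧ ∑ j ∈ C, (FX (H j)).card + 1 ≤ L i ∧
      ∑ j ∈ (Finset.univ \ C).erase i, (1 / (L j : ℝ)) * (1 - 1 / Nat.card (Lin (H j))) ≤
        L i / Nat.card (Lin (H i)) - 1 / Nat.card K := by
  obtain ⟨l, hl⟩ := exists_ne (1 : Lin (H i))
  set χ := X l with hχ
  let C : Finset ι := Finset.univ.filter (fun j => j ≠ i ∧ ∀ m : Lin (H j), m ≠ 1 → Even (co m χ))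
  have hCmem : ∀ j, j ∈ C ↔ j ≠ i ∧ ∀ m : Lin (H j), m ≠ 1 → Even (co m χ) := by simp [C]
  have hodd2 : ∀ j ∈ C, ∀ y ∈ FX (H j), co l y ≠ 0 := by
    intro j hj y hy
    obtain ⟨m, hm, rfl⟩ := mem_FX.1 hy
    obtain ⟨h1, h2⟩ := (hCmem j).1 hj
    have h3 := parity hodd (hC.ti i) (hC.hL i) (hC.ti j) (hC.hL j) (hC.disj i j h1.symm) l m hl hm
    have h4 := h2 m hm
    rintro h5
    rw [h5, add_zero] at h3
    exact (Int.not_even_iff_odd.2 h3) h4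
  refine ⟨C, by simp [C], ?_, ?_⟩
  · have hn := sum_co_same (hC.ti i) (hC.hL i) l l hl hl
    rw [if_pos (MulAction.mem_orbit_self _)] at hn
    have hD := (X_iff hodd (hC.ti i) (hC.hL i) l hl _).2 rfl
    rw [D, ← co_bar', ← hχ] at hD
    have hz : ∃ z, z ∈ FX (H i) ∧ co l z ≠ 0 := by
      by_cases h : co l χ = 0
      · refine ⟨bar χ, mem_FX.2 ⟨l⁻¹, inv_ne_one' hl, X_inv hodd (hC.ti i) (hC.hL i) l hl⟩, by omega⟩
      · exact ⟨χ, mem_FX.2 ⟨l, hl, rfl⟩, h⟩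
    obtain ⟨z, hz1, hz2⟩ := hz
    have hdis : ∀ j k, j ≠ k → Disjoint (FX (H j)) (FX (H k)) := by
      intro j k hjk
      rw [Finset.disjoint_left]
      intro y hy hy2
      obtain ⟨m, hm, rfl⟩ := mem_FX.1 hy
      obtain ⟨m', hm', h⟩ := mem_FX.1 hy2
      exact X_ne_diff hodd (hC.ti j) (hC.hL j) (hC.ti k) (hC.hL k) (hC.disj j k hjk) m m' hm hm' h.symm
    have hone : ∀ j, one K ∉ FX (H j) := by
      intro j h
      obtain ⟨m, hm, h⟩ := mem_FX.1 h
      exact X_ne_one hodd (hC.ti j) (hC.hL j) m hm h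
    let S : Finset (Irr K) := C.biUnion (fun j => FX (H j))
    have hS : S.card = ∑ j ∈ C, (FX (H j)).card :=
      Finset.card_biUnion (fun j _ k _ h => hdis j k h)
    have hzS : z ∉ S := by
      intro h
      obtain ⟨j, hj, h2⟩ := Finset.mem_biUnion.1 h
      exact Finset.disjoint_left.1 (hdis j i ((hCmem j).1 hj).1) h2 hz1
    have h1S : one K ∉ insert z S := by
      intro h
      rcases Finset.mem_insert.1 h with h | h
      · rw [← h] at hz1; exact hone i hz1
      · obtain ⟨j, hj, h2⟩ := Finset.mem_biUnion.1 h
        exact hone j h2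
    have hle : ∑ y ∈ insert (one K) (insert z S), (1 : ℤ) ≤ L i + 1 := by
      rw [← hn]
      refine le_trans (Finset.sum_le_sum ?_) (Finset.sum_le_sum_of_subset_of_nonneg
        (Finset.subset_univ _) (fun k _ _ => mul_self_nonneg _))
      intro y hy
      have hy0 : co l y ≠ 0 := by
        rcases Finset.mem_insert.1 hy with h | h
        · rw [h, co_one l hl]; exact one_ne_zero
        · rcases Finset.mem_insert.1 h with h | h
          · rw [h]; exact hz2
          · obtain ⟨j, hj, h2⟩ := Finset.mem_biUnion.1 h
            exact hodd2 j hj y h2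
      have := mul_self_pos.2 hy0
      omega
    rw [Finset.sum_const, Finset.card_insert_of_notMem h1S, Finset.card_insert_of_notMem hzS, hS,
      nsmul_eq_mul, mul_one] at hle
    push_cast at hle
    have : ((∑ j ∈ C, (FX (H j)).card : ℕ) : ℤ) + 1 ≤ L i := by push_cast; linarith
    exact_mod_cast this
  · have hk : (0 : ℝ) < Nat.card K := by exact_mod_cast Nat.card_pos
    have hp := partition_sum hC (fun x => Complex.normSq (χ.1 x))
      (fun x g => by rw [χ.2.isChr.classFn x g])
    have ht := total χ
    rw [hp] at ht
    have hj : ∀ j, (0 : ℝ) < L j ∧ (0 : ℝ) < Nat.card (H j) ∧ (0 : ℝ) < Nat.card (Lin (H j)) := by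
      intro j
      exact ⟨by exact_mod_cast hC.Lpos j, by exact_mod_cast Nat.card_pos, by exact_mod_cast Nat.card_pos⟩
    have hiS : i ∈ Finset.univ \ C := by simp [C]
    have hsub := Finset.sum_le_sum_of_subset_of_nonneg (f := fun j => (Nat.card K : ℝ) / (L j * Nat.card (H j)) *
        ∑ x ∈ (Finset.univ : Finset (H j)).erase 1, Complex.normSq (χ.1 x))
        (Finset.subset_univ (Finset.univ \ C)) (fun j _ _ => mul_nonneg (by positivity) (En_nonneg _ _))
    rw [← Finset.sum_erase_add _ _ hiS] at hsub
    have hrow : ∑ j ∈ (Finset.univ \ C).erase i, (Nat.card K : ℝ) * ((1 / (L j : ℝ)) * (1 - 1 / Nat.card (Lin (H j))))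
        ≤ ∑ j ∈ (Finset.univ \ C).erase i, (Nat.card K : ℝ) / (L j * Nat.card (H j)) *
        ∑ x ∈ (Finset.univ : Finset (H j)).erase 1, Complex.normSq (χ.1 x) := by
      refine Finset.sum_le_sum fun j hjm => ?_
      have h1 : j ≠ i := (Finset.mem_erase.1 hjm).1
      have h2 : j ∉ C := (Finset.mem_sdiff.1 (Finset.mem_erase.1 hjm).2).2
      rw [hCmem] at h2
      push Not at h2
      obtain ⟨m, hm, hmo⟩ := h2 h1
      have h3 := bessel_one χ m (by rintro h; rw [h] at hmo; simp at hmo)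
      rw [En] at h3
      obtain ⟨a1, a2, a3⟩ := hj j
      set E := ∑ x ∈ (Finset.univ : Finset (H j)).erase 1, Complex.normSq (χ.1 x)
      rw [div_mul_eq_mul_div (Nat.card K : ℝ), le_div_iff₀ (by positivity)]
      have h4 : (Nat.card (H j) : ℝ) * (1 - 1 / Nat.card (Lin (H j))) ≤ E := by
        have : (Nat.card (H j) : ℝ) * (1 - 1 / Nat.card (Lin (H j))) =
          (Nat.card (H j) : ℝ) * (Nat.card (Lin (H j)) - 1) / Nat.card (Lin (H j)) := by field_simp
        rw [this, div_le_iff₀ a3]; linarith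
      have h5 : (Nat.card K : ℝ) * ((1 / (L j : ℝ)) * (1 - 1 / Nat.card (Lin (H j)))) * (L j * Nat.card (H j))
        = Nat.card K * (Nat.card (H j) * (1 - 1 / Nat.card (Lin (H j)))) := by field_simp
      rw [h5]
      exact mul_le_mul_of_nonneg_left h4 hk.le
    have hown := bessel_own hodd (hC.ti i) (hC.hL i) l hl
    rw [En] at hown
    obtain ⟨a1, a2, a3⟩ := hj i
    have hown2 : (Nat.card K : ℝ) * (1 - L i / Nat.card (Lin (H i))) ≤ (Nat.card K : ℝ) / (L i * Nat.card (H i)) *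
        ∑ x ∈ (Finset.univ : Finset (H i)).erase 1, Complex.normSq (χ.1 x) := by
      rw [← hχ] at hown
      set E := ∑ x ∈ (Finset.univ : Finset (H i)).erase 1, Complex.normSq (χ.1 x)
      rw [div_mul_eq_mul_div (Nat.card K : ℝ), le_div_iff₀ (by positivity)]
      have h5 : (Nat.card K : ℝ) * (1 - L i / Nat.card (Lin (H i))) * (L i * Nat.card (H i)) =
         Nat.card K * ((Nat.card (H i) * (L i * (Nat.card (Lin (H i)) - L i))) / Nat.card (Lin (H i))) := by
        field_simp
      rw [h5]
      apply mul_le_mul_of_nonneg_left _ hk.le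
      rw [div_le_iff₀ a3]; linarith
    rw [← Finset.mul_sum] at hrow
    set Sg := ∑ j ∈ (Finset.univ \ C).erase i, (1 / (L j : ℝ)) * (1 - 1 / Nat.card (Lin (H j)))
    have hf : (Nat.card K : ℝ) * (Sg + (1 - L i / Nat.card (Lin (H i)))) ≤ Nat.card K - 1 := by
      rw [mul_add]
      linarith
    have h6 : Sg + (1 - L i / Nat.card (Lin (H i))) ≤ 1 - 1 / Nat.card K := by
      have e : (1 : ℝ) - 1 / Nat.card K = (Nat.card K - 1) / Nat.card K := by field_simp
      rw [e, le_div_iff₀ hk]; linarith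
    linarith

end EPPOaux
end

section
set_option linter.unusedSectionVars false
set_option linter.unusedSimpArgs false
set_option linter.style.haveILetI false
open scoped BigOperators Classical

namespace EPPOaux

theorem numeric {ι : Type*} [Fintype ι] (L n h w : ι → ℕ) (g : ℕ) (i0 i1 : ι) (h01 : i1 ≠ i0)
    (hg : 0 < g) (hh0 : 0 < h i0)
    (hcount : ∑ j, (1 / (L j : ℝ)) * (1 - 1 / (h j : ℝ)) = 1 - 1 / (g : ℝ))
    (hmain : ∀ i, ∃ C : Finset ι, i ∉ C ∧ ∑ j ∈ C, w j + 1 ≤ L i ∧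
      ∑ j ∈ (Finset.univ \ C).erase i, (1 / (L j : ℝ)) * (1 - 1 / (n j : ℝ)) ≤
        L i / (n i : ℝ) - 1 / (g : ℝ))
    (hw : ∀ j, w j * L j + 1 = n j) (hw2 : ∀ j, 2 ≤ w j) (hL3 : ∀ j, j ≠ i0 → 3 ≤ L j)
    (hh : ∀ j, j ≠ i0 → h j = n j)
    (hnd : ∀ j k, j ≠ i0 → k ≠ i0 → j ≠ k → n j ≠ n k) (hno : ∀ j, j ≠ i0 → Odd (n j))
    (hc : L i0 = n i1 ∨ (2 * L i1 + 1) * L i0 ≤ n i1) (hc7 : 7 ≤ L i0)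
    (hw0 : L i1 ≤ w i0 + 1) : False := by
  have hLpos : ∀ j, (1 : ℝ) ≤ L j := by
    intro j
    by_cases hj : j = i0
    · rw [hj]; exact_mod_cast (by omega : 1 ≤ L i0)
    · have := hL3 j hj
      exact_mod_cast (by omega : 1 ≤ L j)
  have hwR : ∀ j, (w j : ℝ) * L j + 1 = n j := fun j => by exact_mod_cast hw j
  have hw2R : ∀ j, (2 : ℝ) ≤ w j := fun j => by exact_mod_cast hw2 j
  have hnR : ∀ j, 2 * (L j : ℝ) + 1 ≤ n j := fun j => by
    have := hwR j; have := hw2R j; have := hLpos j; nlinarith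
  have hgR : (0 : ℝ) < 1 / (g : ℝ) := by
    have : (0 : ℝ) < g := by exact_mod_cast hg
    positivity
  have hz : ∀ j, 0 ≤ (1 / (L j : ℝ)) * (1 - 1 / (n j : ℝ)) := by
    intro j
    have h1 := hLpos j
    have h2 := hnR j
    have : 1 / (n j : ℝ) ≤ 1 := by rw [div_le_one (by linarith)]; linarith
    apply mul_nonneg (by positivity); linarith
  have hy0 : (1 / (L i0 : ℝ)) * (1 - 1 / (h i0 : ℝ)) ≤ 1 / (L i0 : ℝ) := by
    have h1 := hLpos i0
    have : (0 : ℝ) ≤ 1 / (h i0 : ℝ) := by positivity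
    have h2 : 0 ≤ 1 / (L i0 : ℝ) := by positivity
    nlinarith
  have hc7R : (7 : ℝ) ≤ L i0 := by exact_mod_cast hc7
  have hi1 := hL3 i1 h01
  have hi1R : (3 : ℝ) ≤ L i1 := by exact_mod_cast hi1
  -- first step
  have hc1 : L i0 = n i1 := by
    rcases hc with hc | hc
    · exact hc
    exfalso
    obtain ⟨C, hiC, hCw, hCs⟩ := hmain i1
    by_cases h0C : i0 ∈ C
    · have hC : C = {i0} := by
        apply Finset.eq_singleton_iff_unique_mem.2 ⟨h0C, ?_⟩
        intro j hj
        by_contra hne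
        have h1 : ∑ k ∈ ({i0, j} : Finset ι), w k ≤ ∑ k ∈ C, w k := by
          apply Finset.sum_le_sum_of_subset
          intro k hk
          simp only [Finset.mem_insert, Finset.mem_singleton] at hk
          rcases hk with rfl | rfl <;> assumption
        rw [Finset.sum_insert (by simp [Ne.symm hne]), Finset.sum_singleton] at h1
        have := hw2 j
        omega
      have e1 : ∑ j ∈ (Finset.univ \ C).erase i1, (1 / (L j : ℝ)) * (1 - 1 / (n j : ℝ)) =
          ∑ j ∈ (Finset.univ \ C).erase i1, (1 / (L j : ℝ)) * (1 - 1 / (h j : ℝ)) := by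
        refine Finset.sum_congr rfl fun j hj => ?_
        rw [hh j]
        rintro rfl
        simp [hC] at hj
      rw [e1] at hCs
      have e2 := Finset.sum_sdiff (f := fun j => (1 / (L j : ℝ)) * (1 - 1 / (h j : ℝ)))
        (Finset.subset_univ C)
      have hi1m : i1 ∈ Finset.univ \ C := by simp [hiC]
      rw [← Finset.sum_erase_add _ _ hi1m, hcount, hC, Finset.sum_singleton] at e2
      rw [hC] at hCs
      rw [hh i1 h01] at e2
      have a1 : 1 / (L i0 : ℝ) ≤ 1 / 7 := one_div_le_one_div_of_le (by norm_num) hc7R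
      have a2 : 1 / (L i1 : ℝ) ≤ 1 / 3 := one_div_le_one_div_of_le (by norm_num) hi1R
      have a3 : (L i1 : ℝ) / n i1 ≤ 1 / 2 := by
        rw [div_le_div_iff₀ (by have := hnR i1; linarith) (by norm_num)]
        have := hnR i1; linarith
      have a4 : (1 / (L i1 : ℝ)) * (1 - 1 / (n i1 : ℝ)) ≤ 1 / (L i1 : ℝ) := by
        have : (0 : ℝ) ≤ 1 / (n i1 : ℝ) := by positivity
        have h2 : 0 ≤ 1 / (L i1 : ℝ) := by positivity
        nlinarith
      linarith
    · have h1 := Finset.single_le_sum (f := fun j => (1 / (L j : ℝ)) * (1 - 1 / (n j : ℝ)))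
        (s := (Finset.univ \ C).erase i1) (fun j _ => hz j) (a := i0) (by simp [h0C, h01.symm])
      have hcR : (2 * (L i1 : ℝ) + 1) * L i0 ≤ n i1 := by exact_mod_cast hc
      have h2 : (L i1 : ℝ) / n i1 ≤ 1 / (L i0 : ℝ) * (1 / 2) := by
        rw [one_div_mul_one_div, div_le_div_iff₀ (by have := hnR i1; linarith) (by linarith)]
        nlinarith
      have h3 : (1 / (L i0 : ℝ)) * (1 / 2) ≤ (1 / (L i0 : ℝ)) * (1 - 1 / (n i0 : ℝ)) := by
        apply mul_le_mul_of_nonneg_left _ (by positivity)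
        have : 1 / (n i0 : ℝ) ≤ 1 / 2 := by
          apply one_div_le_one_div_of_le (by norm_num)
          have := hnR i0; linarith
        linarith
      linarith
  -- minimal index
  obtain ⟨i, hi, hmin⟩ := Finset.exists_min_image (Finset.univ.erase i0) n ⟨i1, by simp [h01]⟩
  have hi : i ≠ i0 := (Finset.mem_erase.1 hi).1
  have hPc : (n i : ℝ) ≤ L i0 := by
    rw [hc1]; exact_mod_cast hmin i1 (by simp [h01])
  obtain ⟨C, hiC, hCw, hCs⟩ := hmain i
  have hCwR : ∑ j ∈ C, (w j : ℝ) + 1 ≤ L i := by exact_mod_cast hCw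
  have hl3 : (3 : ℝ) ≤ L i := by exact_mod_cast hL3 i hi
  set P : ℝ := (n i : ℝ) with hP
  set l : ℝ := (L i : ℝ)
  have hPw := hwR i
  have hw2i := hw2R i
  have hP7 : 7 ≤ P := by nlinarith
  set e : ℝ := 1 / (P * (2 * P + 1)) with he
  have hbound : ∀ j, j ≠ i → (1 / (L j : ℝ)) * (1 - 1 / (h j : ℝ)) ≤
      (if j ∈ C then (w j : ℝ) / (P + 2) else (1 / (L j : ℝ)) * (1 - 1 / (n j : ℝ))) +
        (if j = i0 then e else 0) := by
    intro j hj
    have hwj := hwR j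
    have hLj := hLpos j
    have hnj := hnR j
    by_cases hj0 : j = i0
    · rw [if_pos hj0]
      subst hj0
      have hn0 : 2 * P + 1 ≤ n j := by linarith
      split_ifs with hjC
      · have : (1 / (L j : ℝ)) ≤ w j / (P + 2) := by
          rw [div_le_div_iff₀ (by linarith) (by linarith)]
          linarith
        have : 0 ≤ e := by positivity
        linarith
      · have h1 : 1 / (L j : ℝ) * (1 / n j) ≤ e := by
          rw [one_div_mul_one_div, he]
          apply one_div_le_one_div_of_le (by positivity)
          apply mul_le_mul hPc hn0 (by linarith) (by linarith)
        linarith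
    · rw [if_neg hj0, add_zero, hh j hj0]
      split_ifs with hjC
      · have h1 : n i ≤ n j := hmin j (by simp [hj0])
        have h2 := hnd j i hj0 hi hj
        obtain ⟨a, ha⟩ := hno j hj0
        obtain ⟨b, hb⟩ := hno i hi
        have h3 : n i + 2 ≤ n j := by omega
        have h3R : P + 2 ≤ n j := by rw [hP]; exact_mod_cast h3
        have h4 : 1 / (L j : ℝ) * (1 - 1 / n j) = w j / n j := by
          have : (w j : ℝ) = (n j - 1) / L j := by field_simp; linarith
          rw [this]
          have : (n j : ℝ) ≠ 0 := by linarith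
          field_simp
        rw [h4]
        apply div_le_div_of_nonneg_left (by positivity) (by linarith) h3R
      · exact le_rfl
  have hsum : ∑ j ∈ Finset.univ.erase i, (1 / (L j : ℝ)) * (1 - 1 / (h j : ℝ)) ≤
      (l - 1) / (P + 2) + (l / P - 1 / (g : ℝ)) + e := by
    refine le_trans (Finset.sum_le_sum fun j hj => hbound j (Finset.mem_erase.1 hj).1) ?_
    rw [Finset.sum_add_distrib, Finset.sum_ite, Finset.sum_ite_eq',
      if_pos (Finset.mem_erase.2 ⟨hi.symm, Finset.mem_univ _⟩)]
    have e1 : Finset.filter (fun j => j ∈ C) (Finset.univ.erase i) = C := by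
      ext j; simp; rintro h rfl; exact hiC h
    have e2 : Finset.filter (fun j => j ∉ C) (Finset.univ.erase i) = (Finset.univ \ C).erase i := by
      ext j; simp [and_comm]
    rw [e1, e2, ← Finset.sum_div]
    have : (∑ j ∈ C, (w j : ℝ)) / (P + 2) ≤ (l - 1) / (P + 2) :=
      div_le_div_of_nonneg_right (by linarith) (by linarith)
    linarith
  have hyi : 1 / (L i : ℝ) * (1 - 1 / (h i : ℝ)) = w i / P := by
    rw [hh i hi]
    have h1 := hLpos i
    have : (w i : ℝ) = (P - 1) / L i := by field_simp; linarith
    rw [this, ← hP]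
    have : P ≠ 0 := by linarith
    field_simp
  rw [← Finset.sum_erase_add _ _ (Finset.mem_univ i), hyi] at hcount
  have hfin : 1 ≤ (l - 1) / (P + 2) + l / P + e + w i / P := by linarith
  have hl1 : (l - 1) / (P + 2) = (l - 1) / P - 2 * (l - 1) / (P * (P + 2)) := by
    have : P ≠ 0 := by linarith
    have : P + 2 ≠ 0 := by linarith
    field_simp; ring
  have he2 : e < 2 * (l - 1) / (P * (P + 2)) := by
    rw [he, div_lt_div_iff₀ (by positivity) (by positivity)]
    have : P * (P + 2) ≤ P * (2 * P + 1) := by nlinarith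
    have : 0 < P * (2 * P + 1) := by positivity
    nlinarith
  have hlast : (l - 1) / P + l / P + w i / P ≤ 1 := by
    rw [← add_div, ← add_div, div_le_one (by linarith)]
    nlinarith
  linarith

end EPPOaux
end

section
set_option linter.unusedSectionVars false
set_option linter.unusedSimpArgs false
set_option linter.style.haveILetI false

open scoped BigOperators Classical
namespace EPPOaux

theorem eppo_cent {G : Type*} [Group G] [Finite G] (hG : IsEPPOGroup G) {p : ℕ} (hp : p.Prime) {x y : G}
    {k : ℕ} (hx : orderOf x = p ^ k) (hx1 : x ≠ 1) (hc : Commute x y) : ∃ m, orderOf y = p ^ m := by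
  obtain ⟨r, m, hr, hm⟩ := hG y
  by_cases hrp : r = p
  · exact ⟨m, by rw [hm, hrp]⟩
  have hcop : (orderOf x).Coprime (orderOf y) := by
    rw [hx, hm]; exact Nat.Coprime.pow _ _ ((Nat.coprime_primes hp hr).2 (Ne.symm hrp))
  have h1 := hc.orderOf_mul_eq_mul_orderOf_of_coprime hcop
  obtain ⟨t, n, ht, hn⟩ := hG (x * y)
  rw [hn] at h1
  have hk : k ≠ 0 := by
    rintro rfl
    rw [pow_zero, orderOf_eq_one_iff] at hx; exact hx1 hx
  have hpt : p = t := by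
    have : p ∣ t ^ n := by rw [h1, hx]; exact (dvd_pow_self p hk).mul_right _
    exact (Nat.prime_dvd_prime_iff_eq hp ht).1 (hp.dvd_of_dvd_pow this)
  refine ⟨0, ?_⟩
  rw [pow_zero, hm]
  by_contra hne
  have hm0 : m ≠ 0 := by rintro rfl; simp at hne
  have : r ∣ t ^ n := by rw [h1, hm]; exact (dvd_pow_self r hm0).mul_left _
  have := (Nat.prime_dvd_prime_iff_eq hr ht).1 (hr.dvd_of_dvd_pow this)
  exact hrp (by rw [this, hpt])

theorem eppo_sub {G : Type*} [Group G] (hG : IsEPPOGroup G) (H : Subgroup G) : IsEPPOGroup H := by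
  intro g
  obtain ⟨p, n, hp, h⟩ := hG g
  exact ⟨p, n, hp, by rw [← h, Subgroup.orderOf_coe]⟩

theorem eppo_surj {G F : Type*} [Group G] [Group F] (hG : IsEPPOGroup G) (f : G →* F)
    (hf : Function.Surjective f) : IsEPPOGroup F := by
  intro y
  obtain ⟨g, rfl⟩ := hf y
  obtain ⟨p, n, hp, h⟩ := hG g
  have := orderOf_map_dvd f g
  rw [h, Nat.dvd_prime_pow hp] at this
  obtain ⟨m, -, hm⟩ := this
  exact ⟨p, m, hp, hm⟩

/-- Properties of the quotient. -/
structure Good (q : ℕ) (F : Type*) [Group F] : Prop where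
  eppo : IsEPPOGroup F
  i : ∀ p : ℕ, p.Prime → p ≠ q → ∀ x y : F, orderOf x = p → orderOf y = p → Commute x y →
    y ∈ Subgroup.zpowers x
  ii : ∀ p r : ℕ, p.Prime → r.Prime → p ≠ q → r ≠ q → p ≠ r → ∀ z y : F, orderOf z = p →
    orderOf y = r → y * z * y⁻¹ ∉ Subgroup.zpowers z

theorem Good.sub {q : ℕ} {F : Type*} [Group F] (h : Good q F) (H : Subgroup F) : Good q H := by
  refine ⟨eppo_sub h.eppo H, ?_, ?_⟩
  · intro p hp hpq x y hx hy hc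
    have := h.i p hp hpq x y (by rw [Subgroup.orderOf_coe, hx]) (by rw [Subgroup.orderOf_coe, hy])
      (by simpa [Commute, SemiconjBy, Subtype.ext_iff] using hc)
    obtain ⟨k, hk⟩ := this
    exact ⟨k, by ext; simpa using hk⟩
  · intro p r hp hr h1 h2 h3 z y hz hy hm
    refine h.ii p r hp hr h1 h2 h3 z y (by rw [Subgroup.orderOf_coe, hz]) (by rw [Subgroup.orderOf_coe, hy]) ?_
    obtain ⟨k, hk⟩ := hm
    exact ⟨k, by simpa using congrArg Subtype.val hk⟩

theorem sum_pow_mul {R : Type*} [Ring R] {p : ℕ} (hp : p.Prime) {a : R} (ha : a ^ p = 1)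
    (hN : ∑ i ∈ Finset.range p, a ^ i = 0) (t : ℕ) (ht : ¬ p ∣ t) :
    ∑ i ∈ Finset.range p, a ^ (i * t) = 0 := by
  haveI : Fact p.Prime := ⟨hp⟩
  haveI : NeZero p := ⟨hp.ne_zero⟩
  have hmod : ∀ n, a ^ n = a ^ (n % p) := by
    intro n
    conv_lhs => rw [← Nat.div_add_mod n p, pow_add, pow_mul, ha, one_pow, one_mul]
  have h1 : ∀ f : ℕ → R, ∑ i ∈ Finset.range p, f i = ∑ c : ZMod p, f c.val := by
    intro f
    refine Finset.sum_bij' (fun i _ => (i : ZMod p)) (fun c _ => c.val) ?_ ?_ ?_ ?_ ?_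
    · simp
    · intro c _; exact Finset.mem_range.2 (ZMod.val_lt c)
    · intro i hi; exact ZMod.val_cast_of_lt (Finset.mem_range.1 hi)
    · intro c _; simp
    · intro i hi; rw [ZMod.val_cast_of_lt (Finset.mem_range.1 hi)]
  rw [h1] at hN ⊢
  have ht0 : (t : ZMod p) ≠ 0 := by rwa [Ne, ZMod.natCast_eq_zero_iff]
  rw [← hN]
  refine Fintype.sum_equiv (Equiv.mulRight₀ (t : ZMod p) ht0) _ _ fun c => ?_
  simp only [Equiv.mulRight₀_apply]
  rw [hmod, ZMod.val_mul, ZMod.val_natCast, Nat.mul_mod_mod]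

theorem ring_i {R : Type*} [Ring R] {p : ℕ} (hp : p.Prime) {a b : R} (hab : Commute a b) (ha : a ^ p = 1)
    (hN : ∑ i ∈ Finset.range p, a ^ i = 0)
    (hM : ∀ j, ∑ k ∈ Finset.range p, (b * a ^ j) ^ k = 0) : (p : R) = 0 := by
  have h1 : ∑ j ∈ Finset.range p, ∑ k ∈ Finset.range p, (b * a ^ j) ^ k = 0 :=
    Finset.sum_eq_zero fun j _ => hM j
  rw [Finset.sum_comm, Finset.sum_eq_single 0] at h1
  · simpa using h1
  · intro k hk hk0
    have : ∀ j, (b * a ^ j) ^ k = b ^ k * a ^ (j * k) := by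
      intro j
      rw [((hab.symm).pow_right j).mul_pow, ← pow_mul]
    simp only [this]
    rw [← Finset.mul_sum, sum_pow_mul hp ha hN k, mul_zero]
    exact Nat.not_dvd_of_pos_of_lt (Nat.pos_of_ne_zero hk0) (Finset.mem_range.1 hk)
  · intro h; exact absurd (Finset.mem_range.2 hp.pos) h

theorem ring_ii {R : Type*} [Ring R] {p r s : ℕ} (hp : p.Prime) (hr : r.Prime) {a b : R} (hab : b * a = a ^ s * b)
    (ha : a ^ p = 1) (hN : ∑ i ∈ Finset.range p, a ^ i = 0)
    (hM : ∑ k ∈ Finset.range r, b ^ k = 0)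
    (hs : ∀ k, 0 < k → k < r → ¬ p ∣ 1 + (p - 1) * s ^ k) : (p : R) = 0 := by
  have hp1 := hp.one_lt
  have hbk : ∀ k m, b ^ k * a ^ m = a ^ (m * s ^ k) * b ^ k := by
    intro k
    induction k with
    | zero => intro m; simp
    | succ k ih =>
      have h1 : ∀ m, b * a ^ m = a ^ (m * s) * b := by
        intro m
        induction m with
        | zero => simp
        | succ m ihm =>
          rw [pow_succ, ← mul_assoc, ihm, mul_assoc, hab, ← mul_assoc, ← pow_add]
          congr 2; ring
      intro m
      rw [pow_succ, mul_assoc, h1, ← mul_assoc, ih, mul_assoc]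
      congr 2; ring
  have h1 : ∑ i ∈ Finset.range p, ∑ k ∈ Finset.range r, a ^ i * b ^ k * a ^ ((p - 1) * i) = 0 := by
    refine Finset.sum_eq_zero fun i _ => ?_
    rw [← Finset.sum_mul, ← Finset.mul_sum, hM]; simp
  rw [Finset.sum_comm, Finset.sum_eq_single 0] at h1
  · have : ∀ i, a ^ i * b ^ 0 * a ^ ((p - 1) * i) = 1 := by
      intro i
      rw [pow_zero, mul_one, ← pow_add]
      have : i + (p - 1) * i = p * i := by
        obtain ⟨k, hk⟩ : ∃ k, p = k + 1 := ⟨p - 1, by omega⟩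
        rw [hk]; simp; ring
      rw [this, pow_mul, ha, one_pow]
    simp only [this] at h1
    simpa using h1
  · intro k hk hk0
    have : ∀ i, a ^ i * b ^ k * a ^ ((p - 1) * i) = a ^ (i * (1 + (p - 1) * s ^ k)) * b ^ k := by
      intro i
      rw [mul_assoc, hbk, ← mul_assoc, ← pow_add]
      congr 2; ring
    simp only [this]
    rw [← Finset.sum_mul, sum_pow_mul hp ha hN _ (hs k (Nat.pos_of_ne_zero hk0) (Finset.mem_range.1 hk)),
      zero_mul]
  · intro h; exact absurd (Finset.mem_range.2 hr.pos) h

theorem good_of_action {q : ℕ} {F : Type*} [Group F] [Finite F] (hF : IsEPPOGroup F) {V : Type*} [AddCommGroup V]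
    [Nontrivial V] (φ : F →* AddMonoid.End V)
    (htor : ∀ p : ℕ, p.Prime → p ≠ q → ∀ v : V, p • v = 0 → v = 0)
    (hfix : ∀ (p : ℕ) (f : F) (v : V), p.Prime → p ≠ q → orderOf f = p → φ f v = v → v = 0) : Good q F := by
  have hN : ∀ (p : ℕ) (f : F), p.Prime → p ≠ q → orderOf f = p → ∑ i ∈ Finset.range p, (φ f) ^ i = 0 := by
    intro p f hp hpq hf
    ext v
    change _ = (0 : V)
    apply hfix p f _ hp hpq hf
    have h1 : φ f * ∑ i ∈ Finset.range p, (φ f) ^ i = ∑ i ∈ Finset.range p, (φ f) ^ i := by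
      have h2 := geom_sum_succ (x := φ f) (n := p)
      rw [Finset.sum_range_succ, ← map_pow, ← hf, pow_orderOf_eq_one, map_one, hf] at h2
      exact (add_right_cancel h2).symm
    exact DFunLike.congr_fun h1 v
  have hcon : ∀ p : ℕ, p.Prime → p ≠ q → (p : AddMonoid.End V) = 0 → False := by
    intro p hp hpq h
    obtain ⟨v, hv⟩ := exists_ne (0 : V)
    apply hv
    apply htor p hp hpq
    have := DFunLike.congr_fun h v
    have h2 : (p : AddMonoid.End V) v = 0 := this
    rwa [AddMonoid.End.natCast_apply] at h2
  refine ⟨hF, ?_, ?_⟩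
  · intro p hp hpq x y hx hy hc
    by_contra hny
    refine hcon p hp hpq (ring_i hp (a := φ x) (b := φ y) (hc.map φ) ?_ (hN p x hp hpq hx) ?_)
    · rw [← map_pow, ← hx, pow_orderOf_eq_one, map_one]
    · intro j
      rw [← map_pow, ← map_mul]
      apply hN p _ hp hpq
      haveI : Fact p.Prime := ⟨hp⟩
      refine orderOf_eq_prime_iff.2 ⟨?_, ?_⟩
      · rw [((hc.symm).pow_right j).mul_pow, ← hy, pow_orderOf_eq_one, one_mul, pow_right_comm, hy, ← hx,
          pow_orderOf_eq_one, one_pow]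
      · intro h
        apply hny
        rw [mul_eq_one_iff_eq_inv.1 h]
        exact Subgroup.inv_mem _ (Subgroup.pow_mem _ (Subgroup.mem_zpowers x) j)
  · intro p r hp hr hpq hrq hpr z y hz hy hm
    rw [← mem_powers_iff_mem_zpowers] at hm
    obtain ⟨s, hs⟩ := hm
    have hs : z ^ s = y * z * y⁻¹ := hs
    have hpow : ∀ k, y ^ k * z * (y ^ k)⁻¹ = z ^ (s ^ k) := by
      intro k
      induction k with
      | zero => simp
      | succ k ih =>
        have : y ^ (k + 1) * z * (y ^ (k + 1))⁻¹ = y * (y ^ k * z * (y ^ k)⁻¹) * y⁻¹ := by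
          rw [pow_succ']; group
        rw [this, ih, ← conj_pow, ← hs, ← pow_mul, pow_succ']
    refine hcon p hp hpq (ring_ii hp hr (a := φ z) (b := φ y) (s := s) ?_ ?_ (hN p z hp hpq hz) (hN r y hr hrq hy) ?_)
    · rw [← map_mul, ← map_pow, ← map_mul, hs]; congr 1; group
    · rw [← map_pow, ← hz, pow_orderOf_eq_one, map_one]
    · intro k hk hkr hdvd
      have h1 : z ^ (1 + (p - 1) * s ^ k) = 1 := by
        exact orderOf_dvd_iff_pow_eq_one.1 (by rw [hz]; exact hdvd)
      have h2 : z ^ (p * s ^ k) = 1 := by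
        rw [pow_mul, ← hz, pow_orderOf_eq_one, one_pow]
      have h3 : z ^ (s ^ k) = z := by
        have e : 1 + (p - 1) * s ^ k + s ^ k = 1 + p * s ^ k := by
          obtain ⟨m, hm⟩ : ∃ m, p = m + 1 := ⟨p - 1, by have := hp.one_lt; omega⟩
          rw [hm]; simp; ring
        have h4 : z ^ (1 + (p - 1) * s ^ k + s ^ k) = z ^ (1 + p * s ^ k) := by rw [e]
        rw [pow_add, h1, one_mul, pow_add, h2, mul_one, pow_one] at h4
        exact h4
      have hcomm : Commute z (y ^ k) := by
        have h5 := hpow k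
        rw [h3] at h5
        exact (mul_inv_eq_iff_eq_mul.1 h5).symm
      have hz1 : z ≠ 1 := by
        rintro rfl
        rw [orderOf_one] at hz; exact hp.one_lt.ne hz
      obtain ⟨m, hm⟩ := eppo_cent hF hp (k := 1) (by rw [hz, pow_one]) hz1 hcomm
      have h6 : orderOf (y ^ k) = r := by
        have : (orderOf y).Coprime k := by
          rw [hy]; exact (Nat.Prime.coprime_iff_not_dvd hr).2 (Nat.not_dvd_of_pos_of_lt hk hkr)
        rw [Nat.Coprime.orderOf_pow this, hy]
      rw [h6] at hm
      have : r ∣ p ^ m := by rw [← hm]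
      exact hpr ((Nat.prime_dvd_prime_iff_eq hr hp).1 (hr.dvd_of_dvd_pow this)).symm

end EPPOaux
end

section
set_option linter.unusedSectionVars false
set_option linter.unusedSimpArgs false
set_option linter.style.haveILetI false
open scoped BigOperators Classical
namespace EPPOaux

theorem pow_order_of_pgroup {G : Type*} [Group G] {q : ℕ} (hq : q.Prime) {Q : Subgroup G} (hQ : IsPGroup q Q)
    {x : G} (hx : x ∈ Q) : ∃ k, orderOf x = q ^ k := by
  haveI : Fact q.Prime := ⟨hq⟩
  obtain ⟨k, hk⟩ := IsPGroup.iff_orderOf.1 hQ ⟨x, hx⟩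
  exact ⟨k, by rw [← hk, ← Subgroup.orderOf_coe]⟩

/-- centre of a subgroup, as a subgroup of the ambient group -/
def zc {G : Type*} [Group G] (Q : Subgroup G) : Subgroup G := Q ⊓ Subgroup.centralizer (Q : Set G)

theorem mem_zc {G : Type*} [Group G] {Q : Subgroup G} {x : G} : x ∈ zc Q ↔ x ∈ Q ∧ ∀ y ∈ Q, y * x = x * y := by
  simp [zc, Subgroup.mem_inf, Subgroup.mem_centralizer_iff]

instance zc_normal {G : Type*} [Group G] (Q : Subgroup G) [hQ : Q.Normal] : (zc Q).Normal := by
  unfold zc; infer_instance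

theorem zc_ne_bot {G : Type*} [Group G] [Finite G] {q : ℕ} (hq : q.Prime) {Q : Subgroup G} (hQ : IsPGroup q Q)
    (h : Q ≠ ⊥) : zc Q ≠ ⊥ := by
  haveI : Fact q.Prime := ⟨hq⟩
  haveI : Nontrivial Q := (Subgroup.nontrivial_iff_ne_bot Q).2 h
  have := hQ.center_nontrivial
  obtain ⟨⟨⟨z, hz⟩, hzc⟩, hne⟩ := exists_ne (1 : Subgroup.center Q)
  intro hb
  have hm : z ∈ zc Q := by
    rw [mem_zc]
    refine ⟨hz, fun y hy => ?_⟩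
    have := Subgroup.mem_center_iff.1 hzc ⟨y, hy⟩
    exact congrArg Subtype.val this
  rw [hb, Subgroup.mem_bot] at hm
  apply hne
  ext; exact hm

theorem good_quot {G : Type*} [Group G] [Finite G] (hG : IsEPPOGroup G) {q : ℕ} (hq : q.Prime)
    (Q : Subgroup G) [Q.Normal] (hQ : Q ≠ ⊥) (hQq : IsPGroup q Q) : Good q (G ⧸ Q) := by
  have hU := zc_ne_bot hq hQq hQ
  have hcomm : ∀ a b : zc Q, a * b = b * a := by
    intro a b
    ext
    exact (mem_zc.1 b.2).2 _ (mem_zc.1 a.2).1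
  letI : CommGroup (zc Q) := { (inferInstance : Group (zc Q)) with mul_comm := hcomm }
  haveI : Nontrivial (Additive (zc Q)) := (Subgroup.nontrivial_iff_ne_bot _).2 hU
  let f0 : G →* AddMonoid.End (Additive (zc Q)) :=
    { toFun := fun g => MonoidHom.toAdditive ((MulAut.conjNormal g : MulAut (zc Q)) : zc Q →* zc Q)
      map_one' := by rw [map_one]; rfl
      map_mul' := by intro a b; rw [map_mul]; rfl }
  have hf0 : ∀ g (x : Additive (zc Q)), ((f0 g x).toMul : G) = g * (x.toMul : G) * g⁻¹ := by
    intro g x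
    exact MulAut.conjNormal_apply g x.toMul
  let φ : G ⧸ Q →* AddMonoid.End (Additive (zc Q)) := QuotientGroup.lift Q f0 (by
    intro g hg
    ext x
    change ((f0 g x).toMul : G) = x.toMul
    rw [hf0, (mem_zc.1 x.toMul.2).2 g hg]; simp)
  refine good_of_action (V := Additive (zc Q)) (eppo_surj hG (QuotientGroup.mk' Q) (QuotientGroup.mk'_surjective Q)) φ ?_ ?_
  · intro p hp hpq v hv
    have h1 : (v.toMul : G) ^ p = 1 := by
      have : v.toMul ^ p = 1 := hv
      exact_mod_cast congrArg Subtype.val this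
    obtain ⟨k, hk⟩ := pow_order_of_pgroup hq hQq (mem_zc.1 v.toMul.2).1
    have h2 := orderOf_dvd_of_pow_eq_one h1
    have h3 : orderOf (v.toMul : G) = 1 := by
      rcases (Nat.dvd_prime hp).1 h2 with h | h
      · exact h
      · rw [hk] at h
        have : p ∣ q ^ k := by rw [h]
        exact absurd ((Nat.prime_dvd_prime_iff_eq hp hq).1 (hp.dvd_of_dvd_pow this)) hpq
    have h4 := orderOf_eq_one_iff.1 h3
    have h5 : v.toMul = 1 := by ext; exact h4
    exact h5
  · intro p f v hp hpq hf hv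
    obtain ⟨g, rfl⟩ := QuotientGroup.mk_surjective f
    by_contra hv0
    have h1 : g * (v.toMul : G) * g⁻¹ = v.toMul := by
      rw [← hf0]; exact congrArg (fun w : Additive (zc Q) => (w.toMul : G)) hv
    have hc : Commute (v.toMul : G) g := (mul_inv_eq_iff_eq_mul.1 h1).symm
    obtain ⟨k, hk⟩ := pow_order_of_pgroup hq hQq (mem_zc.1 v.toMul.2).1
    have hv1 : (v.toMul : G) ≠ 1 := by
      intro h; apply hv0
      have h5 : v.toMul = 1 := by ext; exact h
      exact h5
    obtain ⟨m, hm⟩ := eppo_cent hG hq hk hv1 hc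
    have h2 := orderOf_map_dvd (QuotientGroup.mk' Q) g
    rw [hm] at h2
    have h3 : orderOf (QuotientGroup.mk' Q g) = p := hf
    rw [h3] at h2
    exact hpq ((Nat.prime_dvd_prime_iff_eq hp hq).1 (hp.dvd_of_dvd_pow h2))

/-- the largest normal `q`-subgroup -/
def Oq (q : ℕ) (G : Type*) [Group G] : Subgroup G := sSup {N : Subgroup G | N.Normal ∧ IsPGroup q N}

instance Oq_normal (q : ℕ) (G : Type*) [Group G] : (Oq q G).Normal := by
  unfold Oq
  refine Subgroup.sSup_normal _ ?_
  intro N hN; exact hN.1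

theorem le_Oq {q : ℕ} {G : Type*} [Group G] {N : Subgroup G} (h : N.Normal) (hN : IsPGroup q N) : N ≤ Oq q G :=
  le_sSup ⟨h, hN⟩

theorem Oq_pgroup {q : ℕ} (hq : q.Prime) {G : Type*} [Group G] [Finite G] : IsPGroup q (Oq q G) := by
  haveI : Fact q.Prime := ⟨hq⟩
  let S : Sylow q G := default
  refine S.2.to_le (sSup_le ?_)
  intro N ⟨h1, h2⟩
  exact h2.le_sylow_of_normal S

theorem Oq_le_sylow {q : ℕ} (hq : q.Prime) {G : Type*} [Group G] [Finite G] (S : Sylow q G) : Oq q G ≤ S := by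
  haveI : Fact q.Prime := ⟨hq⟩
  exact (Oq_pgroup hq).le_sylow_of_normal S

theorem Oq_quot {q : ℕ} (hq : q.Prime) {G : Type*} [Group G] [Finite G] : Oq q (G ⧸ Oq q G) = ⊥ := by
  haveI : Fact q.Prime := ⟨hq⟩
  have h1 : IsPGroup q ((Oq q (G ⧸ Oq q G)).comap (QuotientGroup.mk' (Oq q G))) := by
    refine IsPGroup.comap_of_ker_isPGroup (Oq_pgroup hq) _ ?_
    rw [QuotientGroup.ker_mk']; exact Oq_pgroup hq
  have h2 := le_Oq inferInstance h1
  rw [eq_bot_iff]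
  intro x hx
  obtain ⟨g, rfl⟩ := QuotientGroup.mk_surjective x
  rw [Subgroup.mem_bot, QuotientGroup.eq_one_iff]
  exact h2 hx

end EPPOaux
end

section
set_option linter.unusedSectionVars false
set_option linter.unusedSimpArgs false
set_option linter.style.haveILetI false
open scoped BigOperators Classical commutatorElement
namespace EPPOaux

theorem cent_pgroup {G : Type*} [Group G] [Finite G] (hG : IsEPPOGroup G) {p : ℕ} (hp : p.Prime) {x : G}
    {k : ℕ} (hx : orderOf x = p ^ k) (hx1 : x ≠ 1) {H : Subgroup G} (hH : ∀ y ∈ H, Commute x y) : IsPGroup p H := by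
  haveI : Fact p.Prime := ⟨hp⟩
  rw [IsPGroup.iff_orderOf]
  intro y
  rw [← Subgroup.orderOf_coe]
  exact eppo_cent hG hp hx hx1 (hH y y.2)

theorem order_ne_one {G : Type*} [Group G] {p : ℕ} (hp : p.Prime) {z : G} (hz : orderOf z = p) : z ≠ 1 := by
  rintro rfl
  rw [orderOf_one] at hz; exact hp.one_lt.ne hz

theorem lemST {X : Type*} [Group X] [Finite X] [Group.IsSolvable X] [Nontrivial X] {q : ℕ} (hX : Good q X)
    (hO : Oq q X = ⊥) : ∃ (p : ℕ) (z : X), p.Prime ∧ p ≠ q ∧ orderOf z = p ∧ (Subgroup.zpowers z).Normal := by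
  have hs : ∃ n, derivedSeries X n = ⊥ := Group.IsSolvable.solvable
  obtain ⟨A, hAn, hA, hAc⟩ : ∃ A : Subgroup X, A.Normal ∧ A ≠ ⊥ ∧ ⁅A, A⁆ = ⊥ := by
    have h0 : Nat.find hs ≠ 0 := by
      intro h
      have := Nat.find_spec hs
      rw [h, derivedSeries_zero] at this
      exact top_ne_bot this
    obtain ⟨n, hn⟩ := Nat.exists_eq_succ_of_ne_zero h0
    refine ⟨derivedSeries X n, derivedSeries_normal X n, ?_, ?_⟩
    · exact Nat.find_min hs (m := n) (by omega)
    · rw [← derivedSeries_succ]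
      have := Nat.find_spec hs
      rwa [hn] at this
  have hcomm : ∀ a ∈ A, ∀ b ∈ A, Commute a b := by
    intro a ha b hb
    have := Subgroup.commutator_mem_commutator ha hb
    rw [hAc, Subgroup.mem_bot, commutatorElement_eq_one_iff_commute] at this
    exact this
  obtain ⟨p, hp, hpq, hpd⟩ : ∃ p : ℕ, p.Prime ∧ p ≠ q ∧ p ∣ Nat.card A := by
    by_contra hcon
    push Not at hcon
    have h1 : Nat.card A = q ^ (Nat.card A).primeFactorsList.length := by
      apply Nat.eq_prime_pow_of_unique_prime_dvd Nat.card_pos.ne'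
      intro d hd hdd
      by_contra hne
      exact hcon d hd hne hdd
    have h2 := le_Oq hAn (IsPGroup.of_card h1)
    rw [hO] at h2
    exact hA (le_bot_iff.1 h2)
  haveI : Fact p.Prime := ⟨hp⟩
  obtain ⟨⟨z, hzA⟩, hz⟩ := exists_prime_orderOf_dvd_card' p hpd
  rw [← Subgroup.orderOf_coe] at hz
  refine ⟨p, z, hp, hpq, hz, ⟨?_⟩⟩
  intro w hw g
  have h1 : g * z * g⁻¹ ∈ Subgroup.zpowers z := by
    refine hX.i p hp hpq z _ hz ?_ (hcomm _ hzA _ (hAn.conj_mem _ hzA g))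
    rw [← hz]
    exact orderOf_injective (MulAut.conj g).toMonoidHom (MulAut.conj g).injective z
  obtain ⟨k, rfl⟩ := hw
  change g * z ^ k * g⁻¹ ∈ _
  rw [← conj_zpow]
  exact Subgroup.zpow_mem _ h1 k

theorem aut_hom {G : Type*} [Group G] [Finite G] {p : ℕ} (hp : p.Prime) {z : G} (hz : orderOf z = p) (B : Subgroup G)
    (hB : ∀ b ∈ B, b * z * b⁻¹ ∈ Subgroup.zpowers z) :
    ∃ f : B →* (ZMod p)ˣ, ∀ b : B, f b = 1 ↔ Commute (b : G) z := by
  haveI : Fact p.Prime := ⟨hp⟩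
  have hex : ∀ b : B, ∃ k : ℤ, z ^ k = b * z * (b : G)⁻¹ := fun b => hB b b.2
  choose k hk using hex
  have hkey : ∀ m n : ℤ, z ^ m = z ^ n ↔ (m : ZMod p) = n := by
    intro m n
    rw [zpow_eq_zpow_iff_modEq, hz, ZMod.intCast_eq_intCast_iff]
  have hmul : ∀ a b : B, (k (a * b) : ZMod p) = k a * k b := by
    intro a b
    rw [← Int.cast_mul, ← hkey, hk, zpow_mul, hk, conj_zpow, hk]
    push_cast; group
  have hone : (k 1 : ZMod p) = 1 := by
    rw [← Int.cast_one, ← hkey, hk]; simp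
  let f0 : B →* ZMod p := { toFun := fun b => (k b : ZMod p), map_one' := hone, map_mul' := hmul }
  refine ⟨f0.toHomUnits, fun b => ?_⟩
  rw [Units.ext_iff]
  change (k b : ZMod p) = 1 ↔ _
  rw [← Int.cast_one, ← hkey, hk, zpow_one, mul_inv_eq_iff_eq_mul]
  rfl

theorem conj_zpowers_of_normal {G : Type*} [Group G] {z : G} (h : (Subgroup.zpowers z).Normal) (g : G) :
    g * z * g⁻¹ ∈ Subgroup.zpowers z := h.conj_mem _ (Subgroup.mem_zpowers z) g

theorem class2_pow {G : Type*} [Group G] {a b c : G} (h : b * a = a * b * c) (ha : Commute c a) (hb : Commute c b)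
    (n : ℕ) : b ^ n * a = a * b ^ n * c ^ n ∧ (a * b) ^ n = a ^ n * b ^ n * c ^ (n * (n - 1) / 2) := by
  have h1 : ∀ n : ℕ, b ^ n * a = a * b ^ n * c ^ n := by
    intro n
    induction n with
    | zero => simp
    | succ n ih =>
      calc b ^ (n + 1) * a = b ^ n * (b * a) := by rw [pow_succ, mul_assoc]
        _ = b ^ n * a * b * c := by rw [h]; simp only [mul_assoc]
        _ = a * b ^ n * (c ^ n * b) * c := by rw [ih]; simp only [mul_assoc]
        _ = a * b ^ n * (b * c ^ n) * c := by rw [(hb.pow_left n).eq]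
        _ = a * b ^ (n + 1) * c ^ (n + 1) := by rw [pow_succ, pow_succ]; simp only [mul_assoc]
  refine ⟨h1 n, ?_⟩
  induction n with
  | zero => simp
  | succ n ih =>
    have e : (n + 1) * (n + 1 - 1) / 2 = n + n * (n - 1) / 2 := by
      have e1 : (n + 1) * (n + 1 - 1) = n * (n - 1) + 2 * n := by
        cases n <;> simp; ring
      rw [e1, Nat.add_mul_div_left _ _ (by norm_num)]; ring
    have hab : Commute (c ^ (n * (n - 1) / 2)) (a * b) := (ha.mul_right hb).pow_left _
    calc (a * b) ^ (n + 1) = a ^ n * b ^ n * (c ^ (n * (n - 1) / 2) * (a * b)) := by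
          rw [pow_succ, ih]; simp only [mul_assoc]
      _ = a ^ n * (b ^ n * a) * b * c ^ (n * (n - 1) / 2) := by rw [hab.eq]; simp only [mul_assoc]
      _ = a ^ n * a * b ^ n * (c ^ n * b) * c ^ (n * (n - 1) / 2) := by rw [h1]; simp only [mul_assoc]
      _ = a ^ n * a * b ^ n * (b * c ^ n) * c ^ (n * (n - 1) / 2) := by rw [(hb.pow_left n).eq]
      _ = _ := by rw [e, pow_succ, pow_succ, pow_add]; simp only [mul_assoc]

theorem max_sub {P : Type*} [Group P] [Finite P] {p n : ℕ} (hp : p.Prime) (hn : Nat.card P = p ^ (n + 1))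
    {M : Subgroup P} (hM : Nat.card M = p ^ n) :
    M.Normal ∧ (∀ x : P, x ^ p ∈ M) ∧ (∀ x y : P, ⁅x, y⁆ ∈ M) ∧ ∀ N : Subgroup P, M < N → N = ⊤ := by
  haveI : Fact p.Prime := ⟨hp⟩
  have hidx : M.index = p := by
    have := M.card_mul_index
    rw [hM, hn, pow_succ] at this
    exact Nat.eq_of_mul_eq_mul_left (pow_pos hp.pos n) this
  have hN : M.Normal := by
    refine Subgroup.normal_of_index_eq_minFac_card ?_
    rw [hidx, hn, Nat.Prime.pow_minFac hp (by omega)]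
  refine ⟨hN, ?_, ?_, ?_⟩
  · intro x; have := M.pow_index_mem x; rwa [hidx] at this
  · intro x y
    have hc : IsCyclic (P ⧸ M) := isCyclic_of_prime_card (p := p) (by rw [← hidx]; rfl)
    have := hc.isMulCommutative.is_comm.comm (x : P ⧸ M) (y : P ⧸ M)
    rw [← QuotientGroup.eq_one_iff]
    have e : ((⁅x, y⁆ : P) : P ⧸ M) = ⁅(x : P ⧸ M), (y : P ⧸ M)⁆ := map_commutatorElement (QuotientGroup.mk' M) x y
    rw [e, commutatorElement_eq_one_iff_mul_comm, this]
  · intro N hMN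
    have h1 := N.card_subgroup_dvd_card
    rw [hn, Nat.dvd_prime_pow hp] at h1
    obtain ⟨m, hm, hN⟩ := h1
    have h2 : Nat.card M < Nat.card N := Set.ncard_lt_ncard hMN
    rw [hM, hN] at h2
    have := (Nat.pow_lt_pow_iff_right hp.one_lt).1 h2
    apply Subgroup.eq_top_of_card_eq
    rw [hN, hn]; congr 1; omega

theorem lemCYC {p : ℕ} (hp : p.Prime) (hodd : Odd p) : ∀ (n : ℕ) {P : Type*} [Group P] [Finite P], Nat.card P = p ^ n →
    (∀ x y : P, orderOf x = p → orderOf y = p → y ∈ Subgroup.zpowers x) → IsCyclic P := by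
  haveI : Fact p.Prime := ⟨hp⟩
  intro n
  induction n with
  | zero => intro P _ _ h _; haveI : Subsingleton P := Finite.card_le_one_iff_subsingleton.1 (by simp [h]); exact isCyclic_of_subsingleton
  | succ n ih =>
    intro P _ _ hn hu
    by_contra hnc
    have hcyc : ∀ M : Subgroup P, Nat.card M = p ^ n → IsCyclic M := by
      intro M hM
      refine ih hM ?_
      intro x y hx hy
      obtain ⟨k, hk⟩ := hu x y (by rw [Subgroup.orderOf_coe, hx]) (by rw [Subgroup.orderOf_coe, hy])
      exact ⟨k, by ext; simpa using hk⟩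
    have hn0 : n ≠ 0 := by
      rintro rfl
      exact hnc (isCyclic_of_prime_card (p := p) (by simpa using hn))
    have hdvd : p ^ n ∣ Nat.card P := by rw [hn]; exact pow_dvd_pow p (by omega)
    obtain ⟨M1, hM1⟩ := Sylow.exists_subgroup_card_pow_prime p hdvd
    obtain ⟨x, hx⟩ := (Subgroup.isCyclic_iff_exists_zpowers_eq_top M1).1 (hcyc M1 hM1)
    have hlt : p ^ n < p ^ (n + 1) := Nat.pow_lt_pow_right hp.one_lt (by omega)
    obtain ⟨y, hy⟩ : ∃ y, y ∉ M1 := by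
      by_contra hcon
      push Not at hcon
      have : M1 = ⊤ := eq_top_iff.2 fun y _ => hcon y
      rw [this, Subgroup.card_top, hn] at hM1
      omega
    obtain ⟨M2, hM2, hyM⟩ : ∃ M2 : Subgroup P, Nat.card M2 = p ^ n ∧ Subgroup.zpowers y ≤ M2 := by
      have h1 := (Subgroup.zpowers y).card_subgroup_dvd_card
      rw [hn, Nat.dvd_prime_pow hp] at h1
      obtain ⟨m, hm, hN⟩ := h1
      refine Sylow.exists_subgroup_card_pow_prime_le p hdvd _ hN ?_
      by_contra hmn
      have : m = n + 1 := by omega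
      rw [this, ← hn] at hN
      apply hnc
      have := Subgroup.eq_top_of_card_eq _ hN
      exact ⟨y, fun w => by
        have hw : w ∈ Subgroup.zpowers y := by rw [this]; trivial
        exact hw⟩
    rw [Subgroup.zpowers_le] at hyM
    obtain ⟨-, p1, c1, m1⟩ := max_sub hp hn hM1
    obtain ⟨-, p2, c2, -⟩ := max_sub hp hn hM2
    have hsup : M1 ⊔ M2 = ⊤ := m1 _ (lt_of_le_of_ne le_sup_left fun h => hy (by rw [h]; exact le_sup_right (a := M1) hyM))
    have hcen : ∀ w, w ∈ M1 → w ∈ M2 → ∀ v, Commute w v := by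
      intro w h1 h2 v
      have : M1 ⊔ M2 ≤ Subgroup.centralizer {w} := by
        refine sup_le ?_ ?_
        · intro u hu
          rw [Subgroup.mem_centralizer_singleton_iff]
          exact congrArg Subtype.val ((hcyc M1 hM1).isMulCommutative.is_comm.comm ⟨u, hu⟩ ⟨w, h1⟩)
        · intro u hu
          rw [Subgroup.mem_centralizer_singleton_iff]
          exact congrArg Subtype.val ((hcyc M2 hM2).isMulCommutative.is_comm.comm ⟨u, hu⟩ ⟨w, h2⟩)
      have hv : v ∈ Subgroup.centralizer {w} := this (by rw [hsup]; trivial)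
      rw [Subgroup.mem_centralizer_singleton_iff] at hv
      exact hv.symm
    have hyp := p1 y
    rw [← hx] at hyp
    obtain ⟨m, hm⟩ := hyp
    have hm : x ^ m = y ^ p := hm
    have hxM1 : x ∈ M1 := by rw [← hx]; exact Subgroup.mem_zpowers x
    have hpm : (p : ℤ) ∣ m := by
      by_contra hnd
      have hcop : IsCoprime m (orderOf x : ℤ) := by
        have h3 : orderOf x = p ^ n := by rw [← hM1, ← hx, Nat.card_zpowers]
        rw [h3]; push_cast
        exact (((Nat.prime_iff_prime_int.1 hp).coprime_iff_not_dvd).2 hnd).symm.pow_right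
      obtain ⟨u, v, huv⟩ := hcop
      have hxx : x = (y ^ p) ^ u := by
        rw [← hm, ← zpow_mul]
        have : m * u = 1 - orderOf x * v := by linarith
        rw [this, zpow_sub, zpow_mul, zpow_natCast, pow_orderOf_eq_one]; simp
      have : M1 ≤ M2 := by
        rw [← hx, Subgroup.zpowers_le, hxx]
        exact Subgroup.zpow_mem _ (Subgroup.pow_mem _ hyM p) u
      have := Subgroup.eq_of_le_of_card_ge this (by rw [hM1, hM2])
      rw [this] at hy; exact hy hyM
    obtain ⟨k, rfl⟩ := hpm
    set a := x ^ (-k) with ha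
    set c := ⁅y⁻¹, a⁻¹⁆ with hc
    have hcC := hcen c (c1 _ _) (c2 _ _)
    have hrel : y * a = a * y * c := by
      rw [hc, commutatorElement_def]; group
    have hcp : c ^ p = 1 := by
      have h1 := (class2_pow hrel (hcC a) (hcC y) p).1
      rw [(hcen _ (p1 y) (p2 y) a).eq] at h1
      exact (mul_eq_left.1 h1.symm)
    have hv : (a * y) ^ p = 1 := by
      rw [(class2_pow hrel (hcC a) (hcC y) p).2]
      obtain ⟨t, ht⟩ := hodd
      have e : p * (p - 1) / 2 = p * t := by
        rw [ht]; simp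
        rw [show (2 * t + 1) * (2 * t) = 2 * ((2 * t + 1) * t) by ring]
        exact Nat.mul_div_cancel_left _ (by norm_num)
      rw [e, pow_mul, hcp, one_pow, mul_one, ← hm, ha, ← zpow_natCast, ← zpow_mul, ← zpow_add]
      have : -k * (p : ℤ) + p * k = 0 := by ring
      rw [this, zpow_zero]
    have haM : a ∈ M1 := Subgroup.zpow_mem _ hxM1 _
    have hnot : a * y ∉ M1 := by
      rwa [Subgroup.mul_mem_cancel_left _ haM]
    obtain ⟨⟨u, huM⟩, huo⟩ := exists_prime_orderOf_dvd_card' (G := M1) p (by rw [hM1]; exact dvd_pow_self p hn0)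
    rw [← Subgroup.orderOf_coe] at huo
    have h9 := hu u (a * y) huo (orderOf_eq_prime_iff.2 ⟨hv, fun h => hnot (h ▸ M1.one_mem)⟩)
    exact hnot ((Subgroup.zpowers_le.2 huM) h9)

end EPPOaux
end

section
set_option linter.unusedSectionVars false
set_option linter.unusedSimpArgs false
set_option linter.style.haveILetI false
open scoped BigOperators Classical commutatorElement
namespace EPPOaux

/-- The minimal counterexample. -/
structure MC (q : ℕ) (K : Type*) [Group K] [Finite K] : Prop where
  hq : q.Prime
  hq2 : Odd q
  odd : Odd (Nat.card K)
  good : Good q K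
  O : Oq q K = ⊥
  sub : ∀ H : Subgroup K, H ≠ ⊤ → Group.IsSolvable H
  perf : commutator K = ⊤
  nt : Nontrivial K

theorem perf_hom {K A : Type*} [Group K] [Group A] (hK : commutator K = ⊤) (f : K →* A)
    (hA : ∀ a b : A, a * b = b * a) (x : K) : f x = 1 := by
  have h : commutator K ≤ f.ker := by
    rw [commutator_def, Subgroup.commutator_le]
    intro a _ b _
    rw [MonoidHom.mem_ker, map_commutatorElement, commutatorElement_eq_one_iff_mul_comm, hA]
  rw [hK] at h
  exact h (Subgroup.mem_top x)

theorem mem_Nm {K : Type*} [Group K] {H : Subgroup K} {g : K} : g ∈ Nm H ↔ ∀ h, h ∈ H ↔ g * h * g⁻¹ ∈ H :=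
  Subgroup.mem_normalizer_iff

theorem mem_Nm_of_conj_le {K : Type*} [Group K] [Finite K] {H : Subgroup K} {g : K} (h : ∀ x ∈ H, g * x * g⁻¹ ∈ H) :
    g ∈ Nm H := by
  have h1 : H.map (MulAut.conj g).toMonoidHom ≤ H := by
    rintro _ ⟨x, hx, rfl⟩; exact h x hx
  have h2 : H.map (MulAut.conj g).toMonoidHom = H := by
    refine Subgroup.eq_of_le_of_card_ge h1 ?_
    rw [Subgroup.card_map_of_injective (MulAut.conj g).injective]
  rw [mem_Nm]
  intro x
  refine ⟨h x, fun hx => ?_⟩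
  rw [← h2] at hx
  obtain ⟨y, hy, hyx⟩ := hx
  have hyx : g * y * g⁻¹ = g * x * g⁻¹ := hyx
  have : y = x := by simpa using hyx
  rwa [← this]

theorem le_Nm {K : Type*} [Group K] (H : Subgroup K) : H ≤ Nm H := Subgroup.le_normalizer

theorem orderOf_conj' {K : Type*} [Group K] (g z : K) : orderOf (g * z * g⁻¹) = orderOf z :=
  orderOf_injective (MulAut.conj g).toMonoidHom (MulAut.conj g).injective z

theorem burnside_perf {K : Type*} [Group K] [Finite K] (hK : commutator K = ⊤) {p : ℕ} (hp : p.Prime)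
    (P : Sylow p K) (hP : Nm (P : Subgroup K) ≤ Subgroup.centralizer (P : Set K)) : (P : Subgroup K) = ⊥ := by
  haveI : Fact p.Prime := ⟨hp⟩
  have h1 := MonoidHom.ker_transferSylow_isComplement' P hP
  have h2 : (MonoidHom.transferSylow P hP).ker = ⊤ := by
    rw [eq_top_iff]
    intro x _
    rw [MonoidHom.mem_ker]
    refine perf_hom hK _ ?_ x
    intro a b
    have := hP (le_Nm _ a.2)
    rw [Subgroup.mem_centralizer_iff] at this
    ext
    exact (this b b.2).symm
  rw [h2] at h1
  exact Subgroup.isComplement'_top_left.1 h1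

theorem sylow_p {q : ℕ} {K : Type*} [Group K] [Finite K] (h : MC q K) {p : ℕ} (hp : p.Prime) (hpq : p ≠ q)
    (hpd : p ∣ Nat.card K) (P : Sylow p K) : IsCyclic P ∧ TI (P : Subgroup K) ∧
    ∃ l a : ℕ, Nat.card (Nm (P : Subgroup K)) = l * Nat.card P ∧ l = q ^ a ∧ 0 < a ∧ 3 ≤ l ∧ l ∣ p - 1 ∧ 2 * l + 1 ≤ p := by
  haveI : Fact p.Prime := ⟨hp⟩
  have hpo : Odd p := h.odd.of_dvd_nat hpd
  have hbot : (P : Subgroup K) ≠ ⊥ := P.ne_bot_of_dvd_card hpd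
  have hcyc : IsCyclic P := by
    have h1 := zc_ne_bot hp P.2 hbot
    obtain ⟨w, hw, hw1⟩ := (Subgroup.bot_or_exists_ne_one (zc (P : Subgroup K))).resolve_left h1
    have hzp : IsPGroup p (zc (P : Subgroup K)) := P.2.to_le inf_le_left
    obtain ⟨n, hn⟩ := IsPGroup.iff_card.1 hzp
    have hn0 : n ≠ 0 := by
      rintro rfl
      exact h1 ((Subgroup.eq_bot_iff_card _).2 (by simpa using hn))
    obtain ⟨⟨u, hu⟩, huo⟩ := exists_prime_orderOf_dvd_card' (G := zc (P : Subgroup K)) p (by rw [hn]; exact dvd_pow_self p hn0)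
    rw [← Subgroup.orderOf_coe] at huo
    obtain ⟨m, hm⟩ := IsPGroup.iff_card.1 P.2
    refine lemCYC hp hpo m hm ?_
    have key : ∀ x : P, orderOf x = p → (x : K) ∈ Subgroup.zpowers u := by
      intro x hx
      refine h.good.i p hp hpq u x huo (by rw [Subgroup.orderOf_coe, hx]) ?_
      exact ((mem_zc.1 hu).2 x x.2).symm
    intro x y hx hy
    have hc : Commute (x : K) y := by
      obtain ⟨i, hi⟩ := key x hx
      obtain ⟨j, hj⟩ := key y hy
      rw [← hi, ← hj]
      exact (Commute.refl u).zpow_zpow i j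
    obtain ⟨k, hk⟩ := h.good.i p hp hpq x y (by rw [Subgroup.orderOf_coe, hx]) (by rw [Subgroup.orderOf_coe, hy]) hc
    exact ⟨k, by ext; simpa using hk⟩
  have hab : ∀ x ∈ (P : Subgroup K), ∀ y ∈ (P : Subgroup K), x * y = y * x := by
    intro x hx y hy
    exact congrArg Subtype.val (hcyc.isMulCommutative.is_comm.comm ⟨x, hx⟩ ⟨y, hy⟩)
  have hcent : ∀ x ∈ (P : Subgroup K), x ≠ 1 → ∀ y, x * y = y * x → y ∈ (P : Subgroup K) := by
    intro x hx hx1 y hy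
    obtain ⟨k, hk⟩ := pow_order_of_pgroup hp P.2 hx
    have h1 : IsPGroup p (Subgroup.centralizer {x}) := cent_pgroup h.good.eppo hp hk hx1 (by
      intro y hy; rw [Subgroup.mem_centralizer_singleton_iff] at hy; exact hy.symm)
    have h2 : (P : Subgroup K) ≤ Subgroup.centralizer {x} := by
      intro w hw; rw [Subgroup.mem_centralizer_singleton_iff]; exact hab w hw x hx
    rw [← P.3 h1 h2, Subgroup.mem_centralizer_singleton_iff]; exact hy.symm
  have hTI : TI (P : Subgroup K) := by
    refine ⟨hcent, fun g x hx hx1 hg => ?_⟩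
    apply mem_Nm_of_conj_le
    intro y hy
    apply hcent x hx hx1
    have := hab _ hg _ hy
    calc x * (g * y * g⁻¹) = g * ((g⁻¹ * x * g) * y) * g⁻¹ := by group
      _ = g * (y * (g⁻¹ * x * g)) * g⁻¹ := by rw [this]
      _ = _ := by group
  refine ⟨hcyc, hTI, ?_⟩
  obtain ⟨m, hm⟩ := IsPGroup.iff_card.1 P.2
  have hm0 : m ≠ 0 := by
    rintro rfl
    exact hbot ((Subgroup.eq_bot_iff_card _).2 (by simpa using hm))
  obtain ⟨⟨z, hzP⟩, hz⟩ := exists_prime_orderOf_dvd_card' (G := P) p (by rw [hm]; exact dvd_pow_self p hm0)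
  rw [← Subgroup.orderOf_coe] at hz
  have hz1 := order_ne_one hp hz
  have hconj : ∀ b ∈ Nm (P : Subgroup K), b * z * b⁻¹ ∈ Subgroup.zpowers z := by
    intro b hb
    have h1 := (mem_Nm.1 hb z).1 hzP
    exact h.good.i p hp hpq z _ hz (by rw [orderOf_conj', hz]) (hab z hzP _ h1)
  obtain ⟨f, hf⟩ := aut_hom hp hz (Nm (P : Subgroup K)) hconj
  have hker : f.ker = (P : Subgroup K).subgroupOf (Nm (P : Subgroup K)) := by
    ext b
    rw [MonoidHom.mem_ker, hf, Subgroup.mem_subgroupOf]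
    exact ⟨fun hb => hcent z hzP hz1 b hb.eq.symm, fun hb => hab b hb z hzP⟩
  have hcard : Nat.card (Nm (P : Subgroup K)) = Nat.card f.range * Nat.card P := by
    have h1 := f.ker.card_mul_index
    rw [Subgroup.index_ker, hker] at h1
    rw [← h1, mul_comm]
    congr 1
    exact Nat.card_congr (Subgroup.subgroupOfEquivOfLe (le_Nm _)).toEquiv
  have hdvd : Nat.card f.range ∣ p - 1 := by
    have := f.range.card_subgroup_dvd_card
    rwa [Nat.card_eq_fintype_card (α := (ZMod p)ˣ), ZMod.card_units] at this
  have hpow : ∃ a, Nat.card f.range = q ^ a := by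
    refine ⟨_, Nat.eq_prime_pow_of_unique_prime_dvd Nat.card_pos.ne' ?_⟩
    intro r hr hrd
    by_contra hrq
    haveI : Fact r.Prime := ⟨hr⟩
    have hrp : p ≠ r := by
      rintro rfl
      have := Nat.le_of_dvd (by have := hp.one_lt; omega) (hrd.trans hdvd)
      have := hp.one_lt
      omega
    obtain ⟨⟨y, hyN⟩, hy⟩ := exists_prime_orderOf_dvd_card' (G := Nm (P : Subgroup K)) r (by rw [hcard]; exact hrd.mul_right _)
    rw [← Subgroup.orderOf_coe] at hy
    exact h.good.ii p r hp hr hpq hrq hrp z y hz hy (hconj y hyN)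
  obtain ⟨a, ha⟩ := hpow
  have ha0 : 0 < a := by
    rw [Nat.pos_iff_ne_zero]
    rintro rfl
    rw [pow_zero] at ha
    rw [ha, one_mul] at hcard
    have h1 : (P : Subgroup K) = Nm (P : Subgroup K) := Subgroup.eq_of_le_of_card_ge (le_Nm _) hcard.le
    apply hbot
    apply burnside_perf h.perf hp P
    rw [← h1]
    intro x hx
    rw [Subgroup.mem_centralizer_iff]
    intro y hy
    exact hab y hy x hx
  have hlo : Odd (Nat.card f.range) := by rw [ha]; exact h.hq2.pow
  have hl3 : 3 ≤ Nat.card f.range := by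
    rw [ha]
    have h1 : 3 ≤ q := by
      have := h.hq.two_le
      obtain ⟨t, ht⟩ := h.hq2
      omega
    exact h1.trans (Nat.le_self_pow ha0.ne' q)
  refine ⟨_, a, hcard, ha, ha0, hl3, hdvd, ?_⟩
  obtain ⟨k, hk⟩ := hdvd
  have hp2 := hp.two_le
  have hev : Even (Nat.card f.range * k) := by
    rw [← hk]; obtain ⟨t, ht⟩ := hpo; exact ⟨t, by omega⟩
  rw [Nat.even_mul] at hev
  have hk2 : Even k := hev.resolve_left (Nat.not_even_iff_odd.2 hlo)
  have hk0 : k ≠ 0 := by rintro rfl; omega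
  obtain ⟨t, ht⟩ := hk2
  have : 2 ≤ k := by omega
  have h8 := Nat.mul_le_mul_left (Nat.card f.range) this
  rw [← hk] at h8
  omega

end EPPOaux
end

section
set_option linter.unusedSectionVars false
set_option linter.unusedSimpArgs false
set_option linter.style.haveILetI false
open scoped BigOperators Classical commutatorElement
namespace EPPOaux

/-- abelian subgroup of maximal order -/
def AbMax {X : Type*} [Group X] (T A : Subgroup X) : Prop :=
  A ≤ T ∧ (∀ a ∈ A, ∀ b ∈ A, a * b = b * a) ∧
    ∀ B : Subgroup X, B ≤ T → (∀ a ∈ B, ∀ b ∈ B, a * b = b * a) → Nat.card B ≤ Nat.card A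

/-- Thompson subgroup -/
def JT {X : Type*} [Group X] (T : Subgroup X) : Subgroup X := sSup {A | AbMax T A}

theorem JT_le {X : Type*} [Group X] (T : Subgroup X) : JT T ≤ T := sSup_le fun _ h => h.1

theorem le_JT {X : Type*} [Group X] {T A : Subgroup X} (h : AbMax T A) : A ≤ JT T := le_sSup (Set.mem_ofPred_eq ▸ h)

theorem exists_AbMax {X : Type*} [Group X] [Finite X] (T : Subgroup X) : ∃ A, AbMax T A := by
  have : ({A : Subgroup X | A ≤ T ∧ (∀ a ∈ A, ∀ b ∈ A, a * b = b * a)}).Nonempty :=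
    ⟨⊥, bot_le, by intro a ha b hb; rw [Subgroup.mem_bot] at ha hb; rw [ha, hb]⟩
  obtain ⟨A, hA, hmax⟩ := Set.exists_max_image _ (fun A : Subgroup X => Nat.card A) (Set.toFinite _) this
  exact ⟨A, hA.1, hA.2, fun B h1 h2 => hmax B ⟨h1, h2⟩⟩

theorem JT_ne_bot {X : Type*} [Group X] [Finite X] {T : Subgroup X} (hT : T ≠ ⊥) : JT T ≠ ⊥ := by
  obtain ⟨x, hx, hx1⟩ := (Subgroup.bot_or_exists_ne_one T).resolve_left hT
  obtain ⟨A, hA⟩ := exists_AbMax T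
  intro hb
  have h1 : A ≤ JT T := le_sSup hA
  rw [hb, le_bot_iff] at h1
  have h2 := hA.2.2 (Subgroup.zpowers x) (Subgroup.zpowers_le.2 hx) (by
    rintro _ ⟨i, rfl⟩ _ ⟨j, rfl⟩
    exact ((Commute.refl x).zpow_zpow i j).eq)
  rw [h1, Subgroup.card_bot] at h2
  have h3 := Finite.card_le_one_iff_subsingleton.1 h2
  apply hx1
  have := h3.elim ⟨x, Subgroup.mem_zpowers x⟩ 1
  exact congrArg Subtype.val this

theorem JT_eq_of_le {X : Type*} [Group X] [Finite X] {T R : Subgroup X} (hR : R ≤ T) (h : JT T ≤ R) : JT R = JT T := by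
  have : ∀ A, AbMax R A ↔ AbMax T A := by
    intro A
    constructor
    · intro hA
      refine ⟨hA.1.trans hR, hA.2.1, fun B h1 h2 => ?_⟩
      obtain ⟨A0, h0⟩ := exists_AbMax T
      exact (h0.2.2 B h1 h2).trans (hA.2.2 A0 ((le_JT h0).trans h) h0.2.1)
    · intro hA
      exact ⟨(le_JT hA).trans h, hA.2.1, fun B h1 h2 => hA.2.2 B (h1.trans hR) h2⟩
  simp only [JT, this]

theorem JT_map {X Y : Type*} [Group X] [Group Y] (f : X →* Y) (hf : Function.Injective f) (T : Subgroup X) :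
    JT (T.map f) = (JT T).map f := by
  have key : ∀ A, AbMax (T.map f) (A.map f) ↔ AbMax T A := by
    intro A
    unfold AbMax
    rw [Subgroup.map_le_map_iff_of_injective hf, Subgroup.card_map_of_injective hf]
    refine and_congr Iff.rfl (and_congr ?_ ?_)
    · constructor
      · intro h a ha b hb
        apply hf
        rw [map_mul, map_mul]
        exact h _ (Subgroup.mem_map_of_mem f ha) _ (Subgroup.mem_map_of_mem f hb)
      · rintro h _ ⟨a, ha, rfl⟩ _ ⟨b, hb, rfl⟩
        rw [← map_mul, ← map_mul, h a ha b hb]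
    · constructor
      · intro h B hB hab
        rw [← Subgroup.card_map_of_injective hf]
        refine h _ (Subgroup.map_mono hB) ?_
        rintro _ ⟨a, ha, rfl⟩ _ ⟨b, hb, rfl⟩
        rw [← map_mul, ← map_mul, hab a ha b hb]
      · intro h B hB hab
        obtain ⟨B', hB', rfl⟩ : ∃ B', B' ≤ T ∧ B'.map f = B := by
          refine ⟨B.comap f, ?_, ?_⟩
          · rw [← Subgroup.map_le_map_iff_of_injective hf]
            exact (Subgroup.map_comap_le f B).trans hB
          · exact Subgroup.map_comap_eq_self (hB.trans (Subgroup.map_le_range f T))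
        rw [Subgroup.card_map_of_injective hf]
        refine h B' hB' ?_
        intro a ha b hb
        apply hf
        rw [map_mul, map_mul]
        exact hab _ (Subgroup.mem_map_of_mem f ha) _ (Subgroup.mem_map_of_mem f hb)
  apply le_antisymm
  · refine sSup_le ?_
    intro B hB
    have hB2 : (B.comap f).map f = B := Subgroup.map_comap_eq_self (hB.1.trans (Subgroup.map_le_range f T))
    rw [← hB2]
    apply Subgroup.map_mono
    apply le_sSup
    have hB3 : AbMax (T.map f) ((B.comap f).map f) := by rw [hB2]; exact hB
    exact (key _).1 hB3
  · rw [Subgroup.map_le_iff_le_comap]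
    refine sSup_le ?_
    intro A hA
    rw [← Subgroup.map_le_iff_le_comap]
    exact le_sSup ((key A).2 hA)

theorem JT_conj {X : Type*} [Group X] (g : X) (T : Subgroup X) :
    JT (T.map (MulAut.conj g).toMonoidHom) = (JT T).map (MulAut.conj g).toMonoidHom :=
  JT_map _ (MulAut.conj g).injective T

theorem mem_Nm_iff_map {X : Type*} [Group X] {H : Subgroup X} {g : X} :
    g ∈ Nm H ↔ H.map (MulAut.conj g).toMonoidHom = H := Subgroup.mem_normalizer_iff_map_conj_eq

theorem Nm_le_Nm_JT {X : Type*} [Group X] (T : Subgroup X) : Nm T ≤ Nm (JT T) := by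
  intro g hg
  rw [mem_Nm_iff_map] at hg ⊢
  rw [← JT_conj, hg]

theorem card_sup_ineq {X : Type*} [Group X] [Finite X] (A U : Subgroup X) [U.Normal] :
    Nat.card A * Nat.card U = Nat.card (A ⊔ U : Subgroup X) * Nat.card (A ⊓ U : Subgroup X) := by
  have h1 := Subgroup.relIndex_mul_relIndex ⊥ U (A ⊔ U) bot_le le_sup_right
  have h2 := Subgroup.relIndex_mul_relIndex ⊥ (A ⊓ U) A bot_le inf_le_left
  rw [Subgroup.inf_relIndex_left] at h2
  rw [Subgroup.relIndex_sup_right] at h1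
  simp only [Subgroup.relIndex_bot_left] at h1 h2
  rw [← h1, ← h2]; ring

theorem p_dvd_card {X : Type*} [Group X] [Finite X] (hX : IsEPPOGroup X) {p q : ℕ} (hp : p.Prime) (hq : q.Prime)
    (hpq : p ≠ q) (U : Subgroup X) [U.Normal] (hU : IsPGroup q U) (hpd : p ∣ Nat.card X) : p ∣ Nat.card U - 1 := by
  haveI : Fact p.Prime := ⟨hp⟩
  obtain ⟨y, hy⟩ := exists_prime_orderOf_dvd_card' (G := X) p hpd
  letI : MulAction (Subgroup.zpowers y) U :=
    MulAction.compHom U ((MulAut.conjNormal (H := U)).comp (Subgroup.zpowers y).subtype)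
  have hs : ∀ (g : Subgroup.zpowers y) (u : U), ((g • u : U) : X) = g * u * (g : X)⁻¹ := fun g u => MulAut.conjNormal_apply (g : X) u
  have hP : IsPGroup p (Subgroup.zpowers y) := IsPGroup.of_card (n := 1) (by rw [Nat.card_zpowers, hy, pow_one])
  have h1 := hP.card_modEq_card_fixedPoints U
  have h2 : MulAction.fixedPoints (Subgroup.zpowers y) U = {1} := by
    ext u
    rw [MulAction.mem_fixedPoints, Set.mem_singleton_iff]
    constructor
    · intro h
      have h3 := hs ⟨y, Subgroup.mem_zpowers y⟩ u
      rw [h] at h3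
      have hc : Commute y (u : X) := (mul_inv_eq_iff_eq_mul.1 h3.symm)
      obtain ⟨m, hm⟩ := eppo_cent hX hp (k := 1) (by rw [hy, pow_one]) (order_ne_one hp hy) hc
      obtain ⟨k, hk⟩ := pow_order_of_pgroup hq hU u.2
      by_contra hu
      have hk0 : k ≠ 0 := by
        rintro rfl
        rw [pow_zero, orderOf_eq_one_iff] at hk
        exact hu (by ext; exact hk)
      have : q ∣ p ^ m := by rw [← hm, hk]; exact dvd_pow_self q hk0
      exact hpq ((Nat.prime_dvd_prime_iff_eq hq hp).1 (hq.dvd_of_dvd_pow this)).symm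
    · rintro rfl g
      ext; rw [hs]; simp
  rw [h2] at h1
  have h3 : Nat.card ({1} : Set U) = 1 := Nat.card_unique
  rw [h3] at h1
  exact (Nat.modEq_iff_dvd' Nat.card_pos).1 h1.symm

theorem lemJ {X : Type*} [Group X] [Finite X] [Group.IsSolvable X] (hX : IsEPPOGroup X) (hodd : Odd (Nat.card X))
    {q : ℕ} (hq : q.Prime) (hO : Oq q X ≠ ⊥) (T : Sylow q X) : JT (T : Subgroup X) ≤ Oq q X := by
  haveI : Fact q.Prime := ⟨hq⟩
  set R := Oq q X with hR
  have hRq : IsPGroup q R := Oq_pgroup hq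
  set U := zc R with hU
  have hUb : U ≠ ⊥ := zc_ne_bot hq hRq hO
  have hUq : IsPGroup q U := hRq.to_le inf_le_left
  refine sSup_le ?_
  intro B hB
  by_contra hBR
  obtain ⟨b, hbB, hbR⟩ := Set.not_subset.1 hBR
  have hbT : IsPGroup q B := T.2.to_le hB.1
  haveI : Nontrivial (X ⧸ R) := by
    refine ⟨(b : X ⧸ R), 1, ?_⟩
    rw [Ne, QuotientGroup.eq_one_iff]; exact hbR
  have hgood : Good q (X ⧸ R) := good_quot hX hq R hO hRq
  obtain ⟨p, zb, hp, hpq, hz, hzn⟩ := lemST hgood (Oq_quot hq)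
  obtain ⟨z, rfl⟩ := QuotientGroup.mk_surjective zb
  set π := QuotientGroup.mk' R with hπ
  have hzb1 := order_ne_one hp hz
  obtain ⟨f, hf⟩ := aut_hom hp hz (B.map π) (fun b _ => conj_zpowers_of_normal hzn b)
  have hqp : ∀ w : X ⧸ R, (∃ m, orderOf w = p ^ m) → (∃ m, orderOf w = q ^ m) → w = 1 := by
    rintro w ⟨m, hm⟩ ⟨n, hn⟩
    rw [← orderOf_eq_one_iff]
    rw [hm] at hn ⊢
    by_contra hne
    have hm0 : m ≠ 0 := by rintro rfl; simp at hne
    have : p ∣ q ^ n := by rw [← hn]; exact dvd_pow_self p hm0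
    exact hpq ((Nat.prime_dvd_prime_iff_eq hp hq).1 (hp.dvd_of_dvd_pow this))
  have hqord : ∀ x : X, (∃ m, orderOf x = q ^ m) → ∃ m, orderOf (π x) = q ^ m := by
    rintro x ⟨m, hm⟩
    have := orderOf_map_dvd π x
    rw [hm, Nat.dvd_prime_pow hq] at this
    obtain ⟨k, -, hk⟩ := this
    exact ⟨k, hk⟩
  have hncomm : ∀ x ∈ B, Commute (π x) (z : X ⧸ R) → π x = 1 := by
    intro x hx hc
    apply hqp
    · exact eppo_cent hgood.eppo hp (k := 1) (by rw [hz, pow_one]) hzb1 hc.symm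
    · exact hqord x (pow_order_of_pgroup hq hbT hx)
  have hfinj : Function.Injective f := by
    rw [injective_iff_map_eq_one]
    rintro ⟨_, x, hx, rfl⟩ h
    rw [hf] at h
    ext
    exact hncomm x hx h
  haveI : Fact p.Prime := ⟨hp⟩
  have hdvd : Nat.card (B.map π) ∣ p - 1 := by
    have := Subgroup.card_dvd_of_injective f hfinj
    rwa [Nat.card_eq_fintype_card (α := (ZMod p)ˣ), ZMod.card_units] at this
  -- card of B
  have hcB : Nat.card B = Nat.card (B.map π) * Nat.card (B ⊓ R : Subgroup X) := by
    have h1 := Subgroup.relIndex_mul_relIndex ⊥ (B ⊓ R) B bot_le inf_le_left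
    rw [Subgroup.inf_relIndex_left] at h1
    simp only [Subgroup.relIndex_bot_left] at h1
    rw [← h1, mul_comm]
    congr 1
    rw [← Subgroup.relIndex_ker, hπ, QuotientGroup.ker_mk']
  obtain ⟨j, hj⟩ := IsPGroup.iff_card.1 (hbT.map π)
  have hj0 : j ≠ 0 := by
    rintro rfl
    have h1 : B.map π = ⊥ := (Subgroup.eq_bot_iff_card _).2 (by simpa using hj)
    have h2 : π b ∈ B.map π := Subgroup.mem_map_of_mem π hbB
    rw [h1, Subgroup.mem_bot] at h2
    exact hbR ((QuotientGroup.eq_one_iff b).1 h2)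
  -- the subgroup D
  set D := U ⊓ Subgroup.centralizer (B : Set X) with hD
  have hUle : Nat.card U ≤ q ^ j * Nat.card D := by
    have hab : ∀ a ∈ (B ⊓ R) ⊔ U, ∀ c ∈ (B ⊓ R) ⊔ U, a * c = c * a := by
      intro a ha c hc
      rw [Subgroup.mem_sup_of_normal_right] at ha hc
      obtain ⟨a1, ha1, a2, ha2, rfl⟩ := ha
      obtain ⟨c1, hc1, c2, hc2, rfl⟩ := hc
      have e1 : Commute a1 c1 := hB.2.1 a1 ha1.1 c1 hc1.1
      have e2 : Commute a1 c2 := (mem_zc.1 hc2).2 a1 ha1.2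
      have e3 : Commute a2 c1 := ((mem_zc.1 ha2).2 c1 hc1.2).symm
      have e4 : Commute a2 c2 := (mem_zc.1 hc2).2 a2 (mem_zc.1 ha2).1
      exact ((e1.mul_right e2).mul_left (e3.mul_right e4)).eq
    have hle : (B ⊓ R) ⊔ U ≤ T := sup_le (inf_le_left.trans hB.1) (inf_le_left.trans (Oq_le_sylow hq T))
    have h1 := hB.2.2 _ hle hab
    have h2 := card_sup_ineq (B ⊓ R) U
    have h3 : Nat.card (B ⊓ R ⊓ U : Subgroup X) ≤ Nat.card D := by
      refine Subgroup.card_le_of_le ?_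
      intro x hx
      refine Subgroup.mem_inf.2 ⟨hx.2, ?_⟩
      rw [Subgroup.mem_centralizer_iff]
      intro y hy
      exact hB.2.1 y hy x hx.1.1
    rw [hcB, hj] at h1
    have h4 : 0 < Nat.card (B ⊓ R : Subgroup X) := Nat.card_pos
    have h5 : Nat.card (B ⊓ R : Subgroup X) * Nat.card U ≤ Nat.card (B ⊓ R : Subgroup X) * (q ^ j * Nat.card D) := by
      rw [h2]
      calc _ ≤ (q ^ j * Nat.card (B ⊓ R : Subgroup X)) * Nat.card D := Nat.mul_le_mul h1 h3
        _ = _ := by ring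
    exact Nat.le_of_mul_le_mul_left h5 h4
  have hDD : Nat.card D * Nat.card D ≤ Nat.card U := by
    have hUn : U.Normal := inferInstance
    let φ : D × D → U := fun d => ⟨d.1 * (z * d.2 * z⁻¹), U.mul_mem d.1.2.1 (hUn.conj_mem _ d.2.2.1 z)⟩
    have hφ : Function.Injective φ := by
      rintro ⟨a, c⟩ ⟨a', c'⟩ h
      have h : (a : X) * (z * c * z⁻¹) = a' * (z * c' * z⁻¹) := congrArg Subtype.val h
      have h1 : (a' : X)⁻¹ * a = z * (c' * (c : X)⁻¹) * z⁻¹ := by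
        have := congrArg (fun t => (a' : X)⁻¹ * t * (z * c * z⁻¹)⁻¹) h
        calc (a' : X)⁻¹ * a = (a' : X)⁻¹ * (a * (z * c * z⁻¹)) * (z * c * z⁻¹)⁻¹ := by group
          _ = _ := this
          _ = _ := by group
      have hu1 : (a' : X)⁻¹ * a ∈ D := D.mul_mem (D.inv_mem a'.2) a.2
      have hu2 : (c' : X) * (c : X)⁻¹ ∈ D := D.mul_mem c'.2 (D.inv_mem c.2)
      have hone : (a' : X)⁻¹ * a = 1 := by
        by_contra hne
        set u := (a' : X)⁻¹ * a with hu
        have hc1 : Commute u b := (Subgroup.mem_centralizer_iff.1 hu1.2 b hbB).symm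
        have hc2 : Commute u (z * b * z⁻¹) := by
          have : Commute ((c' : X) * (c : X)⁻¹) b := (Subgroup.mem_centralizer_iff.1 hu2.2 b hbB).symm
          rw [h1]
          exact (Commute.conj_iff z).2 this
        have hc3 : Commute u (b⁻¹ * (z * b * z⁻¹)) := hc1.inv_right.mul_right hc2
        obtain ⟨k, hk⟩ := pow_order_of_pgroup hq hUq hu1.1
        have hw := hqord _ (eppo_cent hX hq hk hne hc3)
        have hw1 : π (b⁻¹ * (z * b * z⁻¹)) = 1 := by
          apply hqp _ _ hw
          have h5 : π (b⁻¹ * (z * b * z⁻¹)) ∈ Subgroup.zpowers (z : X ⧸ R) := by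
            have e : π (b⁻¹ * (z * b * z⁻¹)) = ((π b)⁻¹ * (z : X ⧸ R) * ((π b)⁻¹)⁻¹) * (z : X ⧸ R)⁻¹ := by
              rw [map_mul, map_mul, map_mul, map_inv, map_inv, inv_inv]; simp only [mul_assoc]; rfl
            rw [e]
            exact Subgroup.mul_mem _ (conj_zpowers_of_normal hzn _) (Subgroup.inv_mem _ (Subgroup.mem_zpowers _))
          have h6 : orderOf (π (b⁻¹ * (z * b * z⁻¹))) ∣ p := by
            rw [← hz]; exact orderOf_dvd_of_mem_zpowers h5
          rcases (Nat.dvd_prime hp).1 h6 with h | h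
          · exact ⟨0, by rw [h, pow_zero]⟩
          · exact ⟨1, by rw [h, pow_one]⟩
        have h7 : π b = 1 := by
          apply hncomm b hbB
          have e : π (b⁻¹ * (z * b * z⁻¹)) = (π b)⁻¹ * ((z : X ⧸ R) * π b * (z : X ⧸ R)⁻¹) := by
            simp only [map_mul, map_inv]; rfl
          rw [e, inv_mul_eq_one] at hw1
          exact mul_inv_eq_iff_eq_mul.1 hw1.symm |>.symm
        exact hbR ((QuotientGroup.eq_one_iff b).1 h7)
      have ha : a = a' := by ext; exact (inv_mul_eq_one.1 hone).symm
      rw [hone] at h1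
      have hcc : (c' : X) * (c : X)⁻¹ = 1 := by
        have := congrArg (fun t => z⁻¹ * t * z) h1
        simp only [mul_assoc] at this
        simpa using this.symm
      have hc : c = c' := by ext; exact (mul_inv_eq_one.1 hcc).symm
      rw [ha, hc]
    have := Nat.card_le_card_of_injective φ hφ
    rwa [Nat.card_prod] at this
  have hpX : p ∣ Nat.card X := by
    have h1 : p ∣ Nat.card (X ⧸ R) := by rw [← hz]; exact orderOf_dvd_natCard _
    exact h1.trans (Subgroup.card_quotient_dvd_card R)
  have hpU := p_dvd_card hX hp hq hpq U hUq hpX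
  obtain ⟨E, hE⟩ := IsPGroup.iff_card.1 hUq
  have hE0 : E ≠ 0 := by
    rintro rfl
    exact hUb ((Subgroup.eq_bot_iff_card _).2 (by simpa using hE))
  have hU1 : 1 < Nat.card U := by rw [hE]; exact Nat.one_lt_pow hE0 hq.one_lt
  obtain ⟨u', hu'⟩ := hpU
  have hQ1 : 1 < q ^ j := Nat.one_lt_pow hj0 hq.one_lt
  rw [hj] at hdvd
  have hp2 := hp.two_le
  have hqR : q ∣ Nat.card X := by
    have : q ∣ Nat.card U := by rw [hE]; exact dvd_pow_self q hE0
    exact this.trans U.card_subgroup_dvd_card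
  have hpbig : 2 * q ^ j + 1 ≤ p := by
    have hlo : Odd (q ^ j) := (hodd.of_dvd_nat hqR).pow
    have hpo : Odd p := hodd.of_dvd_nat hpX
    obtain ⟨k, hk⟩ := hdvd
    have hev : Even (q ^ j * k) := by
      rw [← hk]; obtain ⟨t, ht⟩ := hpo; exact ⟨t, by omega⟩
    rw [Nat.even_mul] at hev
    have hk2 : Even k := hev.resolve_left (Nat.not_even_iff_odd.2 hlo)
    have hk0 : k ≠ 0 := by rintro rfl; omega
    obtain ⟨t, ht⟩ := hk2
    have h9 : 2 ≤ k := by omega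
    have h8 := Nat.mul_le_mul_left (q ^ j) h9
    rw [← hk] at h8
    omega
  have hu0 : u' ≠ 0 := by rintro rfl; omega
  have hjE : j ≤ E := by
    by_contra hcon
    have h1 : q ^ E ≤ q ^ j := Nat.pow_le_pow_right hq.pos (by omega)
    rw [← hE] at h1
    have : p * 1 ≤ p * u' := Nat.mul_le_mul_left p (by omega)
    omega
  have hdv : q ^ j ∣ u' + 1 := by
    have h1 : q ^ j ∣ Nat.card U := by rw [hE]; exact pow_dvd_pow q hjE
    have h2 : Nat.card U = (p - 1) * u' + (u' + 1) := by
      have : Nat.card U = p * u' + 1 := by omega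
      rw [this]
      obtain ⟨t, rfl⟩ : ∃ t, p = t + 1 := ⟨p - 1, by omega⟩
      simp; ring
    rw [h2] at h1
    exact (Nat.dvd_add_right (hdvd.mul_right u')).1 h1
  have hu'' : q ^ j ≤ u' + 1 := Nat.le_of_dvd (by omega) hdv
  have hD0 : 0 < Nat.card D := Nat.card_pos
  have hDj : Nat.card D ≤ q ^ j := Nat.le_of_mul_le_mul_right (hDD.trans hUle) hD0
  have hfin : Nat.card U ≤ q ^ j * q ^ j := hUle.trans (Nat.mul_le_mul_left _ hDj)
  have hfin2 : (2 * q ^ j + 1) * u' ≤ p * u' := Nat.mul_le_mul_right _ hpbig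
  have hfin3 : p * u' + 1 = Nat.card U := by omega
  nlinarith

end EPPOaux
end

section
set_option linter.unusedSectionVars false
set_option linter.unusedSimpArgs false
set_option linter.style.haveILetI false
open scoped BigOperators Classical commutatorElement
namespace EPPOaux

/-- `T` is a Sylow `q`-subgroup of `L`. -/
def IsSyl {K : Type*} [Group K] (q : ℕ) (L T : Subgroup K) : Prop :=
  T ≤ L ∧ IsPGroup q T ∧ ∀ Q : Subgroup K, Q ≤ L → IsPGroup q Q → T ≤ Q → Q = T

section
variable {K : Type*} [Group K] [Finite K] {q : ℕ}

theorem exists_IsSyl {L Q : Subgroup K} (hQ : Q ≤ L) (hQq : IsPGroup q Q) : ∃ T, IsSyl q L T ∧ Q ≤ T := by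
  obtain ⟨T, hT, hmax⟩ := Set.exists_max_image {T : Subgroup K | T ≤ L ∧ IsPGroup q T ∧ Q ≤ T}
    (fun A : Subgroup K => Nat.card A) (Set.toFinite _) ⟨Q, hQ, hQq, le_rfl⟩
  refine ⟨T, ⟨hT.1, hT.2.1, fun R h1 h2 h3 => ?_⟩, hT.2.2⟩
  exact (Subgroup.eq_of_le_of_card_ge h3 (hmax R ⟨h1, h2, hT.2.2.trans h3⟩)).symm

theorem IsSyl.toSylow {L T : Subgroup K} (h : IsSyl q L T) : ∃ S : Sylow q L, (S : Subgroup L) = T.subgroupOf L := by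
  refine ⟨⟨T.subgroupOf L, ?_, ?_⟩, rfl⟩
  · exact h.2.1.comap_of_injective L.subtype L.subtype_injective
  · intro Q hQ hle
    have h1 := h.2.2 (Q.map L.subtype) (Subgroup.map_subtype_le Q) (hQ.map _) (by
      rw [← Subgroup.map_subgroupOf_eq_of_le h.1]; exact Subgroup.map_mono hle)
    rw [← h1]
    exact (Subgroup.comap_map_eq_self_of_injective L.subtype_injective Q).symm

theorem IsSyl.conj (hq : q.Prime) {L T Q : Subgroup K} (h : IsSyl q L T) (hQ : Q ≤ L) (hQq : IsPGroup q Q) :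
    ∃ g ∈ L, ∀ x ∈ Q, g * x * g⁻¹ ∈ T := by
  haveI : Fact q.Prime := ⟨hq⟩
  obtain ⟨S, hS⟩ := h.toSylow
  obtain ⟨S', hS'⟩ := (hQq.comap_of_injective L.subtype L.subtype_injective).exists_le_sylow
  obtain ⟨g, hg⟩ := MulAction.exists_smul_eq L S' S
  refine ⟨g, g.2, fun x hx => ?_⟩
  have h1 : (⟨x, hQ hx⟩ : L) ∈ S' := hS' hx
  have h2 : g * ⟨x, hQ hx⟩ * g⁻¹ ∈ (S : Subgroup L) := by
    rw [← hg, Sylow.coe_subgroup_smul]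
    exact Subgroup.smul_mem_pointwise_smul _ (MulAut.conj g) _ h1
  rw [hS] at h2
  exact h2

/-- conjugate subgroup -/
abbrev cj (g : K) (S : Subgroup K) : Subgroup K := S.map (MulAut.conj g).toMonoidHom

theorem mem_cj {g x : K} {S : Subgroup K} : x ∈ cj g S ↔ g⁻¹ * x * g ∈ S := by
  constructor
  · rintro ⟨y, hy, rfl⟩
    have : g⁻¹ * (g * y * g⁻¹) * g = y := by group
    change g⁻¹ * (g * y * g⁻¹) * g ∈ S
    rwa [this]
  · intro h
    refine ⟨_, h, ?_⟩
    change g * (g⁻¹ * x * g) * g⁻¹ = x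
    group

theorem IsSyl.cj (g : K) {S : Subgroup K} (h : IsSyl q ⊤ S) : IsSyl q ⊤ (cj g S) := by
  refine ⟨le_top, h.2.1.map _, fun Q _ h2 h3 => ?_⟩
  have := h.2.2 (EPPOaux.cj g⁻¹ Q) le_top (h2.map _) (by
    intro x hx
    rw [mem_cj, inv_inv]
    exact h3 (by rw [mem_cj]; simpa [mul_assoc] using hx))
  ext x
  rw [mem_cj, ← this, mem_cj, inv_inv]
  simp [mul_assoc]

theorem Nm_cj (g : K) (J : Subgroup K) {x : K} : x ∈ Nm (cj g J) ↔ g⁻¹ * x * g ∈ Nm J := by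
  rw [mem_Nm, mem_Nm]
  simp only [mem_cj]
  constructor
  · intro h y
    have := h (g * y * g⁻¹)
    simpa [mul_assoc] using this
  · intro h y
    have := h (g⁻¹ * y * g)
    simpa [mul_assoc] using this

theorem Nm_proper (hK : MC q K) {E : Subgroup K} (hE : E ≠ ⊥) (hEq : IsPGroup q E) : Nm E ≠ ⊤ := by
  intro h
  have := le_Oq (Subgroup.normalizer_eq_top_iff.1 h) hEq
  rw [hK.O] at this
  exact hE (le_bot_iff.1 this)

theorem Nm_le_JT (hK : MC q K) {E T : Subgroup K} (hE : E ≠ ⊥) (hEq : IsPGroup q E) (hT : IsSyl q (Nm E) T) :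
    Nm E ≤ Nm (JT T) := by
  haveI := hK.sub _ (Nm_proper hK hE hEq)
  obtain ⟨S, hS⟩ := hT.toSylow
  have hodd : Odd (Nat.card (Nm E)) := hK.odd.of_dvd_nat (Nm E).card_subgroup_dvd_card
  have hO : Oq q (Nm E) ≠ ⊥ := by
    have h1 : E.subgroupOf (Nm E) ≤ Oq q (Nm E) :=
      le_Oq inferInstance (hEq.comap_of_injective _ (Nm E).subtype_injective)
    intro hb
    rw [hb, le_bot_iff, Subgroup.subgroupOf_eq_bot] at h1
    exact hE (h1.eq_bot_of_le (le_Nm E))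
  have h1 := lemJ (eppo_sub hK.good.eppo (Nm E)) hodd hK.hq hO S
  have h2 := JT_eq_of_le (Oq_le_sylow hK.hq S) h1
  have h3 : (JT (S : Subgroup (Nm E))).Normal := by
    rw [← h2, ← Subgroup.normalizer_eq_top_iff, eq_top_iff]
    refine le_trans (le_of_eq ?_) (Nm_le_Nm_JT (Oq q (Nm E)))
    exact (Subgroup.normalizer_eq_top_iff.2 (Oq_normal q (Nm E))).symm
  have h4 : JT T = (JT (S : Subgroup (Nm E))).map (Nm E).subtype := by
    rw [← JT_map _ (Nm E).subtype_injective, hS, Subgroup.map_subgroupOf_eq_of_le hT.1]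
  intro g hg
  apply mem_Nm_of_conj_le
  rw [h4]
  rintro _ ⟨x, hx, rfl⟩
  exact ⟨⟨g, hg⟩ * x * ⟨g, hg⟩⁻¹, h3.conj_mem x hx _, rfl⟩

theorem norm_grow (hq : q.Prime) {D S : Subgroup K} (hS : IsPGroup q S) (h : D < S) : D < S ⊓ Nm D := by
  haveI : Fact q.Prime := ⟨hq⟩
  have := hS.isNilpotent
  have h1 := Group.normalizerCondition_of_isNilpotent (G := S) (D.subgroupOf S) (by
    rw [lt_top_iff_ne_top, Ne, Subgroup.subgroupOf_eq_top]; exact h.not_ge)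
  obtain ⟨x, hx, hxD⟩ := SetLike.exists_of_lt h1
  refine lt_of_le_of_ne (le_inf h.le (le_Nm D)) ?_
  intro heq
  apply hxD
  rw [Subgroup.mem_subgroupOf, heq]
  refine ⟨x.2, ?_⟩
  apply mem_Nm_of_conj_le
  intro y hy
  have := (Subgroup.mem_normalizer_iff.1 hx ⟨y, h.le hy⟩).1 hy
  exact this

theorem card_lt_of_lt {A B : Subgroup K} (h : A < B) : Nat.card A < Nat.card B := Set.ncard_lt_ncard h

theorem ne_bot_of_card {A : Subgroup K} (h : 1 < Nat.card A) : A ≠ ⊥ := by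
  rintro rfl; simp at h

theorem lemY (hK : MC q K) (d : ℕ) (hd : 1 ≤ d) (IH : ∀ S S' : Subgroup K, IsSyl q ⊤ S → IsSyl q ⊤ S' →
    d < Nat.card (S ⊓ S' : Subgroup K) → Nm (JT S) = Nm (JT S')) :
    ∀ (n : ℕ) (E T S : Subgroup K), E ≠ ⊥ → IsPGroup q E → IsSyl q (Nm E) T → IsSyl q ⊤ S → T ≤ S → d < Nat.card T →
      Nat.card K - Nat.card T ≤ n → Nm E ≤ Nm (JT S) := by
  intro n
  induction n with
  | zero =>
    intro E T S hE hEq hT hS hTS hdT hn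
    refine (Nm_le_JT hK hE hEq hT).trans (le_of_eq ?_)
    have : T = S := Subgroup.eq_of_le_of_card_ge hTS (by have := S.card_le_card_group; omega)
    rw [this]
  | succ n ih =>
    intro E T S hE hEq hT hS hTS hdT hn
    refine (Nm_le_JT hK hE hEq hT).trans ?_
    rcases eq_or_lt_of_le hTS with rfl | hlt
    · exact le_rfl
    have hgr := norm_grow hK.hq hS.2.1 hlt
    have hJq : IsPGroup q (JT T) := hT.2.1.to_le (JT_le T)
    obtain ⟨T2, hT2, hle⟩ := exists_IsSyl (L := Nm (JT T)) (Q := S ⊓ Nm T)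
      (inf_le_right.trans (Nm_le_Nm_JT T)) (hS.2.1.to_le inf_le_left)
    obtain ⟨S2, hS2, hle2⟩ := exists_IsSyl (L := ⊤) (Q := T2) le_top hT2.2.1
    have hc1 := card_lt_of_lt hgr
    have hc2 : Nat.card (S ⊓ Nm T : Subgroup K) ≤ Nat.card T2 := Subgroup.card_le_of_le hle
    have hc3 := T2.card_le_card_group
    have h1 := ih (JT T) T2 S2 (JT_ne_bot (ne_bot_of_card (by omega))) hJq hT2 hS2 hle2 (by omega) (by omega)
    rw [IH S2 S hS2 hS] at h1
    · exact h1
    · have : Nat.card (S ⊓ Nm T : Subgroup K) ≤ Nat.card (S2 ⊓ S : Subgroup K) :=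
        Subgroup.card_le_of_le (le_inf (hle.trans hle2) inf_le_left)
      omega

theorem claimM (hK : MC q K) : ∀ (n : ℕ) (S S' : Subgroup K), IsSyl q ⊤ S → IsSyl q ⊤ S' → S ⊓ S' ≠ ⊥ →
    Nat.card K - Nat.card (S ⊓ S' : Subgroup K) < n → Nm (JT S) = Nm (JT S') := by
  intro n
  induction n with
  | zero => intro S S' _ _ _ h; omega
  | succ n ih =>
    intro S S' hS hS' hne hn
    set D := S ⊓ S' with hD
    by_cases hSS : S = S'
    · rw [hSS]
    have hDq : IsPGroup q D := hS.2.1.to_le inf_le_left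
    have hlt1 : D < S := lt_of_le_of_ne inf_le_left fun h => hSS (hS.2.2 S' le_top hS'.2.1 (inf_eq_left.1 h)).symm
    have hlt2 : D < S' := lt_of_le_of_ne inf_le_right fun h => hSS (hS'.2.2 S le_top hS.2.1 (inf_eq_right.1 h))
    have hd1 : 1 ≤ Nat.card D := Nat.card_pos
    have IH : ∀ A B : Subgroup K, IsSyl q ⊤ A → IsSyl q ⊤ B →
        Nat.card D < Nat.card (A ⊓ B : Subgroup K) → Nm (JT A) = Nm (JT B) := by
      intro A B hA hB hAB
      refine ih A B hA hB (ne_bot_of_card (by omega)) ?_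
      have := (A ⊓ B).card_le_card_group
      omega
    have g1 := norm_grow hK.hq hS.2.1 hlt1
    have g2 := norm_grow hK.hq hS'.2.1 hlt2
    obtain ⟨T, hT, hTle⟩ := exists_IsSyl (L := Nm D) (Q := S ⊓ Nm D) inf_le_right (hS.2.1.to_le inf_le_left)
    obtain ⟨S1, hS1, hTS1⟩ := exists_IsSyl (L := ⊤) (Q := T) le_top hT.2.1
    have c1 := card_lt_of_lt g1
    have c2 := card_lt_of_lt g2
    have e1 : Nm (JT S) = Nm (JT S1) := by
      refine IH S S1 hS hS1 (c1.trans_le (Subgroup.card_le_of_le (le_inf inf_le_left (hTle.trans hTS1))))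
    obtain ⟨h, hhN, hh⟩ := hT.conj hK.hq (Q := S' ⊓ Nm D) inf_le_right (hS'.2.1.to_le inf_le_left)
    have e2 : Nm (JT S') = Nm (JT (cj h⁻¹ S1)) := by
      refine IH S' _ hS' (hS1.cj _) (c2.trans_le (Subgroup.card_le_of_le (le_inf inf_le_left ?_)))
      intro x hx
      rw [mem_cj, inv_inv]
      exact hTS1 (hh x hx)
    have hY := lemY hK (Nat.card D) hd1 IH (Nat.card K) D T S1 hne hDq hT hS1 hTS1
      (c1.trans_le (Subgroup.card_le_of_le hTle)) (Nat.sub_le _ _)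
    have hhM := hY hhN
    rw [e1, e2, JT_conj]
    ext x
    rw [Nm_cj, inv_inv, Subgroup.mul_mem_cancel_right _ (Subgroup.inv_mem _ hhM), Subgroup.mul_mem_cancel_left _ hhM]

end

end EPPOaux
end

section
set_option linter.unusedSectionVars false
set_option linter.unusedSimpArgs false
set_option linter.style.haveILetI false
open scoped BigOperators Classical commutatorElement
namespace EPPOaux

section
variable {K : Type*} [Group K] [Finite K] {q : ℕ}

theorem IsSyl.ofSylow (S : Sylow q K) : IsSyl q ⊤ (S : Subgroup K) :=
  ⟨le_top, S.2, fun _ _ h2 h3 => S.3 h2 h3⟩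

theorem q_dvd (hK : MC q K) : q ∣ Nat.card K := by
  haveI := hK.nt
  obtain ⟨p, hp, hpd⟩ := Nat.exists_prime_and_dvd (n := Nat.card K) Finite.one_lt_card.ne'
  by_cases hpq : p = q
  · rwa [← hpq]
  haveI : Fact p.Prime := ⟨hp⟩
  obtain ⟨_, _, l, a, h1, h2, h3, _⟩ := sylow_p hK hp hpq hpd (default : Sylow p K)
  refine dvd_trans ?_ (Nm ((default : Sylow p K) : Subgroup K)).card_subgroup_dvd_card
  rw [h1, h2]
  exact dvd_mul_of_dvd_left (dvd_pow_self q h3.ne') _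

theorem fusionM (hK : MC q K) (S : Sylow q K) {x g : K} (hx : x ∈ S) (hx1 : x ≠ 1) (hg : g * x * g⁻¹ ∈ S) :
    g ∈ Nm (JT (S : Subgroup K)) := by
  have hS := IsSyl.ofSylow S
  have hS' := hS.cj g
  have hne : (S : Subgroup K) ⊓ cj g S ≠ ⊥ := by
    intro hb
    have h1 : g * x * g⁻¹ ∈ (S : Subgroup K) ⊓ cj g S := ⟨hg, ⟨x, hx, rfl⟩⟩
    rw [hb, Subgroup.mem_bot] at h1
    apply hx1
    have h2 : x = g⁻¹ * (g * x * g⁻¹) * g := by group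
    rw [h2, h1]; group
  have hM := claimM hK _ _ _ hS hS' hne (Nat.lt_succ_self _)
  have hM' : ∀ y, y ∈ Nm (JT (S : Subgroup K)) ↔ g⁻¹ * y * g ∈ Nm (JT (S : Subgroup K)) := by
    intro y
    rw [← Nm_cj, cj, ← JT_conj, ← hM]
  have hSM : (S : Subgroup K) ≤ Nm (JT (S : Subgroup K)) := (le_Nm _).trans (Nm_le_Nm_JT _)
  have hSylM : IsSyl q (Nm (JT (S : Subgroup K))) (S : Subgroup K) :=
    ⟨hSM, hS.2.1, fun Q _ h2 h3 => hS.2.2 Q le_top h2 h3⟩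
  obtain ⟨m, hm, hms⟩ := hSylM.conj hK.hq (Q := cj g S) (by
    rintro y hy
    rw [hM']
    exact hSM (mem_cj.1 hy)) hS'.2.1
  have h3 : m * g ∈ Nm (S : Subgroup K) := by
    apply mem_Nm_of_conj_le
    intro y hy
    have := hms (g * y * g⁻¹) ⟨y, hy, rfl⟩
    convert this using 1
    group
  have h4 := Nm_le_Nm_JT _ h3
  have h5 := mul_mem (inv_mem hm) h4
  simpa using h5

theorem S_le_comm (hK : MC q K) (S : Sylow q K) :
    (S : Subgroup K) ≤ ⁅Nm (JT (S : Subgroup K)), Nm (JT (S : Subgroup K))⁆ := by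
  haveI : Fact q.Prime := ⟨hK.hq⟩
  have h1 := Subgroup.commutator_inf_eq_focalSubgroup S
  rw [hK.perf, top_inf_eq, Subgroup.focalSubgroup_def] at h1
  have hSM : (S : Subgroup K) ≤ Nm (JT (S : Subgroup K)) := (le_Nm _).trans (Nm_le_Nm_JT _)
  refine (le_of_eq h1).trans ((Subgroup.closure_le _).2 ?_)
  rintro _ ⟨hS, x, hx, u, rfl⟩
  by_cases hx1 : x = 1
  · subst hx1; simp
  refine Subgroup.commutator_mem_commutator (hSM hx) (fusionM hK S (inv_mem hx) (inv_ne_one.2 hx1) ?_)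
  have h2 := mul_mem (inv_mem hx) hS
  have e : u * x⁻¹ * u⁻¹ = x⁻¹ * ⁅x, u⁆ := by rw [commutatorElement_def]; group
  rw [e]; exact h2

theorem Mproper (hK : MC q K) (S : Sylow q K) : Nm (JT (S : Subgroup K)) ≠ ⊤ := by
  haveI : Fact q.Prime := ⟨hK.hq⟩
  exact Nm_proper hK (JT_ne_bot (S.ne_bot_of_dvd_card (q_dvd hK))) (S.2.to_le (JT_le _))

theorem M_eq (hK : MC q K) (S : Sylow q K) : Nm (JT (S : Subgroup K)) = Nm (S : Subgroup K) := by
  haveI : Fact q.Prime := ⟨hK.hq⟩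
  have hJ := JT_ne_bot (S.ne_bot_of_dvd_card (q_dvd hK))
  haveI hsol := hK.sub _ (Mproper hK S)
  have hcom := S_le_comm hK S
  have hSM : (S : Subgroup K) ≤ Nm (JT (S : Subgroup K)) := (le_Nm _).trans (Nm_le_Nm_JT _)
  have hge := Nm_le_Nm_JT (S : Subgroup K)
  have hJM : JT (S : Subgroup K) ≤ Nm (JT (S : Subgroup K)) := le_Nm _
  have hJn : ((JT (S : Subgroup K)).subgroupOf (Nm (JT (S : Subgroup K)))).Normal := inferInstance
  have hJp : IsPGroup q (JT (S : Subgroup K)) := S.2.to_le (JT_le _)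
  generalize Nm (JT (S : Subgroup K)) = M at *
  have hRle : Oq q M ≠ ⊥ := by
    have h1 := le_Oq hJn (hJp.comap_of_injective M.subtype M.subtype_injective)
    intro hb
    rw [hb] at h1
    apply hJ
    have h2 := le_bot_iff.1 h1
    exact (Subgroup.subgroupOf_eq_bot.1 h2).eq_bot_of_le hJM
  have hF : Good q (M ⧸ Oq q M) := good_quot (eppo_sub hK.good.eppo M) hK.hq _ hRle (Oq_pgroup hK.hq)
  have hFO : Oq q (M ⧸ Oq q M) = ⊥ := Oq_quot hK.hq
  have hSR : (S : Subgroup K).subgroupOf M ≤ Oq q M := by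
    rcases subsingleton_or_nontrivial (M ⧸ Oq q M) with hss | hnt
    · rw [QuotientGroup.subsingleton_iff.1 hss]; exact le_top
    obtain ⟨p, z, hp, hpq, hz, hzn⟩ := lemST hF hFO
    obtain ⟨f, hf⟩ := aut_hom hp hz ⊤ (fun b _ => hzn.conj_mem z (Subgroup.mem_zpowers z) b)
    intro y hy
    have hyc : y ∈ commutator M := by
      have h1 := hcom hy
      rw [← Subgroup.map_subtype_commutator] at h1
      obtain ⟨y', hy', he⟩ := h1
      rwa [← Subtype.ext he]
    let φ : M →* (ZMod p)ˣ := f.comp ((Subgroup.topEquiv.symm.toMonoidHom).comp (QuotientGroup.mk' (Oq q M)))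
    have hφ : φ y = 1 := Abelianization.commutator_subset_ker φ hyc
    have hc : Commute (QuotientGroup.mk' (Oq q M) y) z := (hf _).1 hφ
    obtain ⟨m, hm⟩ := eppo_cent hF.eppo hp (k := 1) (by rw [pow_one]; exact hz) (order_ne_one hp hz) hc.symm
    obtain ⟨k, hk⟩ := pow_order_of_pgroup hK.hq S.2 hy
    have hk' : orderOf y = q ^ k := by rw [← hk]; exact (Subgroup.orderOf_coe y).symm
    have hd : orderOf (QuotientGroup.mk' (Oq q M) y) ∣ q ^ k := hk' ▸ orderOf_map_dvd _ y
    have h1 : orderOf (QuotientGroup.mk' (Oq q M) y) = 1 := by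
      have hcop : Nat.Coprime (p ^ m) (q ^ k) := Nat.Coprime.pow _ _ ((Nat.coprime_primes hp hK.hq).2 hpq)
      exact Nat.eq_one_of_dvd_coprimes hcop (hm ▸ dvd_rfl) hd
    rw [orderOf_eq_one_iff] at h1
    exact (QuotientGroup.eq_one_iff y).1 h1
  have hS := IsSyl.ofSylow S
  have hRS : (Oq q M).map M.subtype = S :=
    hS.2.2 _ le_top ((Oq_pgroup hK.hq).map _) (fun x hx => ⟨⟨x, hSM hx⟩, hSR hx, rfl⟩)
  refine le_antisymm ?_ hge
  intro g hg
  apply mem_Nm_of_conj_le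
  rw [← hRS]
  rintro _ ⟨x, hx, rfl⟩
  exact ⟨⟨g, hg⟩ * x * ⟨g, hg⟩⁻¹, (Oq_normal q M).conj_mem x hx _, rfl⟩

theorem fusionS (hK : MC q K) (S : Sylow q K) {x g : K} (hx : x ∈ S) (hx1 : x ≠ 1) (hg : g * x * g⁻¹ ∈ S) :
    g ∈ Nm (S : Subgroup K) := by
  rw [← M_eq hK S]; exact fusionM hK S hx hx1 hg

theorem TI_S (hK : MC q K) (S : Sylow q K) : TI (S : Subgroup K) := by
  haveI : Fact q.Prime := ⟨hK.hq⟩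
  have hS := IsSyl.ofSylow S
  constructor
  · intro h hh h1 x hc
    have hxN : x ∈ Nm (S : Subgroup K) := by
      apply fusionS hK S hh h1
      rw [← hc, mul_inv_cancel_right]; exact hh
    obtain ⟨k, hk⟩ := pow_order_of_pgroup hK.hq S.2 hh
    obtain ⟨m, hm⟩ := eppo_cent hK.good.eppo hK.hq hk h1 (show Commute h x from hc)
    have hp : IsPGroup q (Subgroup.zpowers x) := IsPGroup.of_card (n := m) (by rw [Nat.card_zpowers, hm])
    have hSyl : IsSyl q (Nm (S : Subgroup K)) (S : Subgroup K) :=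
      ⟨le_Nm _, hS.2.1, fun Q _ h2 h3 => hS.2.2 Q le_top h2 h3⟩
    obtain ⟨g, hg, hgx⟩ := hSyl.conj hK.hq (by rwa [Subgroup.zpowers_le]) hp
    exact (mem_Nm.1 hg x).2 (hgx x (Subgroup.mem_zpowers x))
  · intro g h hh h1 hc
    have := fusionS hK S (g := g⁻¹) hh h1 (by rw [inv_inv]; exact hc)
    simpa using inv_mem this

theorem c_spec (hK : MC q K) (S : Sylow q K) : ∃ c p u : ℕ, Nat.card (Nm (S : Subgroup K)) = c * Nat.card S ∧
    p.Prime ∧ p ≠ q ∧ c = p ^ u ∧ 0 < u := by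
  haveI : Fact q.Prime := ⟨hK.hq⟩
  have hSb := S.ne_bot_of_dvd_card (q_dvd hK)
  haveI hsol := hK.sub _ (Mproper hK S)
  have hcom := S_le_comm hK S
  rw [M_eq hK S] at hsol hcom
  have hS := IsSyl.ofSylow S
  have hSyl : IsSyl q (Nm (S : Subgroup K)) (S : Subgroup K) :=
      ⟨le_Nm _, hS.2.1, fun Q _ h2 h3 => hS.2.2 Q le_top h2 h3⟩
  have hle := le_Nm (S : Subgroup K)
  haveI hn : ((S : Subgroup K).subgroupOf (Nm (S : Subgroup K))).Normal := inferInstance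
  generalize Nm (S : Subgroup K) = M at *
  obtain ⟨T, hT⟩ := hSyl.toSylow
  set R := (S : Subgroup K).subgroupOf M with hR
  have hcard : Nat.card R = Nat.card S := Nat.card_congr (Subgroup.subgroupOfEquivOfLe hle).toEquiv
  have hRb : R ≠ ⊥ := fun h => hSb ((Subgroup.subgroupOf_eq_bot.1 h).eq_bot_of_le hle)
  have hF : Good q (M ⧸ R) := good_quot (eppo_sub hK.good.eppo M) hK.hq _ hRb
    (S.2.comap_of_injective M.subtype M.subtype_injective)
  have hqF : ¬ q ∣ Nat.card (M ⧸ R) := by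
    have := T.not_dvd_index
    rw [hT] at this
    rwa [← Subgroup.index_eq_card]
  have hO : Oq q (M ⧸ R) = ⊥ := by
    obtain ⟨n, hn⟩ := IsPGroup.iff_card.1 (Oq_pgroup (G := M ⧸ R) hK.hq)
    by_contra hb
    apply hqF
    refine dvd_trans ?_ (Oq q (M ⧸ R)).card_subgroup_dvd_card
    rw [hn]
    apply dvd_pow_self
    rintro rfl
    exact hb (Subgroup.card_eq_one.1 (by simpa using hn))
  haveI hnt : Nontrivial (M ⧸ R) := by
    rw [← not_subsingleton_iff_nontrivial]
    intro hss
    have hRt := QuotientGroup.subsingleton_iff.1 hss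
    have hMS : M ≤ S := Subgroup.subgroupOf_eq_top.1 hRt
    obtain ⟨y, hy⟩ := Subgroup.ne_bot_iff_exists_ne_one.1 hRb
    haveI : Nontrivial M := ⟨y.1, 1, fun h => hy (Subtype.ext h)⟩
    have h1 := Group.IsSolvable.commutator_lt_top_of_nontrivial M
    apply h1.ne
    rw [eq_top_iff]
    intro x _
    have h2 := hcom (hMS x.2)
    rw [← Subgroup.map_subtype_commutator] at h2
    obtain ⟨y', hy', he⟩ := h2
    rwa [← Subtype.ext he]
  obtain ⟨p, z, hp, hpq, hz, hzn⟩ := lemST hF hO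
  have hall : ∀ {r : ℕ}, r.Prime → r ∣ Nat.card (M ⧸ R) → r = p := by
    intro r hr hrd
    by_contra hne
    haveI : Fact r.Prime := ⟨hr⟩
    obtain ⟨y, hy⟩ := exists_prime_orderOf_dvd_card' r hrd
    exact hF.ii p r hp hr hpq (by rintro rfl; exact hqF hrd) (Ne.symm hne) z y hz hy
      (hzn.conj_mem z (Subgroup.mem_zpowers z) y)
  refine ⟨Nat.card (M ⧸ R), p, _, ?_, hp, hpq, Nat.eq_prime_pow_of_unique_prime_dvd Nat.card_pos.ne' hall, ?_⟩
  · rw [Subgroup.card_eq_card_quotient_mul_card_subgroup R, hcard]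
  · have h1 : 1 < Nat.card (M ⧸ R) := Finite.one_lt_card
    rw [Nat.pos_iff_ne_zero]
    intro h0
    have := Nat.eq_prime_pow_of_unique_prime_dvd Nat.card_pos.ne' hall
    rw [h0, pow_zero] at this
    omega

end
end EPPOaux
end

section
set_option linter.unusedSectionVars false
set_option linter.unusedSimpArgs false
set_option linter.style.haveILetI false
open scoped BigOperators Classical commutatorElement
namespace EPPOaux

theorem lin_card_comm {K : Type*} [Group K] [Finite K] (H : Subgroup K) (hc : IsCyclic H) : Nat.card (Lin H) = Nat.card H := by
  letI : CommGroup H := { (inferInstance : Group H) with mul_comm := IsCyclic.isMulCommutative.is_comm.comm }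
  exact CommGroup.card_monoidHom_of_hasEnoughRootsOfUnity H ℂ

theorem lin_card_p {K : Type*} [Group K] [Finite K] {p : ℕ} (hp : p.Prime) (H : Subgroup K) (hH : IsPGroup p H)
    (hb : H ≠ ⊥) : ∃ b, 0 < b ∧ Nat.card (Lin H) = p ^ b := by
  haveI : Fact p.Prime := ⟨hp⟩
  haveI := hH.isNilpotent
  haveI : Nontrivial H := (Subgroup.nontrivial_iff_ne_bot H).2 hb
  have h1 : Nat.card (Lin H) = Nat.card (Abelianization H) := by
    rw [← CommGroup.card_monoidHom_of_hasEnoughRootsOfUnity (Abelianization H) ℂ]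
    exact Nat.card_congr Abelianization.lift
  obtain ⟨b, hb⟩ := IsPGroup.iff_card.1 (hH.of_surjective (Abelianization.of (G := H)) QuotientGroup.mk_surjective)
  refine ⟨b, ?_, by rw [h1, hb]⟩
  rw [Nat.pos_iff_ne_zero]
  rintro rfl
  have h2 := Group.IsSolvable.commutator_lt_top_of_nontrivial H
  apply h2.ne
  rw [pow_zero] at hb
  exact Subgroup.index_eq_one.1 hb

theorem lin_nontriv {K : Type*} [Group K] [Finite K] {H : Subgroup K} (h : 1 < Nat.card (Lin H)) : Nontrivial (Lin H) := by
  haveI : Finite (Lin H) := Nat.finite_of_card_ne_zero (by omega)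
  exact Finite.one_lt_card_iff_nontrivial.1 h

section
universe u
variable {K : Type u} [Group K] [Fintype K]

theorem two_le_FX (hodd : Odd (Nat.card K)) {H : Subgroup K} (hH : TI H) {L : ℕ}
    (hL : Nat.card (Nm H) = L * Nat.card H) (hn : Nontrivial (Lin H)) : 2 ≤ (FX H).card := by
  obtain ⟨l, hl⟩ := exists_ne (1 : Lin H)
  have h1 := (X_spec hodd hH hL l hl).1
  have h2 := X_inv hodd hH hL l hl
  rw [← h2] at h1
  exact Finset.one_lt_card.2 ⟨_, mem_FX.2 ⟨l⁻¹, inv_ne_one' hl, rfl⟩, _, mem_FX.2 ⟨l, hl, rfl⟩, h1⟩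

theorem MC_false {q : ℕ} (hK : MC q K) : False := by
  let ι := {p // p ∈ (Nat.card K).primeFactors}
  have hpr : ∀ j : ι, j.1.Prime := fun j => Nat.prime_of_mem_primeFactors j.2
  have hdv : ∀ j : ι, j.1 ∣ Nat.card K := fun j => Nat.dvd_of_mem_primeFactors j.2
  let P : ∀ j : ι, Sylow j.1 K := fun j => default
  let H : ι → Subgroup K := fun j => (P j : Subgroup K)
  have hcardH : ∀ j, Nat.card (H j) = j.1 ^ (Nat.card K).factorization j.1 := fun j => by
    haveI : Fact j.1.Prime := ⟨hpr j⟩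
    exact (P j).card_eq_multiplicity
  have hHb : ∀ j, H j ≠ ⊥ := fun j => by
    haveI : Fact j.1.Prime := ⟨hpr j⟩
    exact (P j).ne_bot_of_dvd_card (hdv j)
  let i0 : ι := ⟨q, Nat.mem_primeFactors.2 ⟨hK.hq, q_dvd hK, Nat.card_pos.ne'⟩⟩
  have hex : ∀ j : ι, ∃ L : ℕ, Nat.card (Nm (H j)) = L * Nat.card (H j) ∧ TI (H j) ∧
      (j.1 = q → ∃ p u : ℕ, p.Prime ∧ p ≠ q ∧ L = p ^ u ∧ 0 < u) ∧
      (j.1 ≠ q → IsCyclic (H j) ∧ ∃ a : ℕ, L = q ^ a ∧ 0 < a ∧ 3 ≤ L ∧ L ∣ j.1 - 1 ∧ 2 * L + 1 ≤ j.1) := by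
    intro j
    by_cases hj : j.1 = q
    · obtain ⟨j, hj'⟩ := j
      subst hj
      obtain ⟨c, p, u, h1, h2⟩ := c_spec hK (P ⟨j, hj'⟩)
      exact ⟨c, h1, TI_S hK _, fun _ => ⟨p, u, h2⟩, fun h => absurd rfl h⟩
    · obtain ⟨h1, h2, l, a, h3, h4⟩ := sylow_p hK (hpr j) hj (hdv j) (P j)
      exact ⟨l, h3, h2, fun h => absurd h hj, fun _ => ⟨h1, a, h4⟩⟩
  choose L hL hTI hLq hLp using hex
  have hC : Cfg H L := by
    refine ⟨hTI, hL, ?_, ?_⟩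
    · intro x hx
      obtain ⟨p, n, hp, hn⟩ := hK.good.eppo x
      haveI : Fact p.Prime := ⟨hp⟩
      have hn0 : n ≠ 0 := by
        rintro rfl
        exact hx (orderOf_eq_one_iff.1 (by simpa using hn))
      have hpd : p ∣ Nat.card K := (dvd_pow_self p hn0).trans (hn ▸ orderOf_dvd_natCard x)
      let j : ι := ⟨p, Nat.mem_primeFactors.2 ⟨hp, hpd, Nat.card_pos.ne'⟩⟩
      have hS : IsSyl p ⊤ (H j) := IsSyl.ofSylow (P j)
      obtain ⟨g, -, hg⟩ := hS.conj hp (Q := Subgroup.zpowers x) le_top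
        (IsPGroup.of_card (n := n) (by rw [Nat.card_zpowers, hn]))
      refine ⟨j, g⁻¹, ?_⟩
      rw [inv_inv]
      exact hg x (Subgroup.mem_zpowers x)
    · intro j k hjk x hx hx1 g hg
      obtain ⟨a, ha⟩ := pow_order_of_pgroup (hpr j) (P j).2 hx
      obtain ⟨b, hb⟩ := pow_order_of_pgroup (hpr k) (P k).2 hg
      have e : orderOf (g⁻¹ * x * g) = orderOf x := by
        have := orderOf_conj' g⁻¹ x
        rwa [inv_inv] at this
      rw [e] at hb
      have hcop : Nat.Coprime (j.1 ^ a) (k.1 ^ b) :=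
        Nat.Coprime.pow _ _ ((Nat.coprime_primes (hpr j) (hpr k)).2 fun h => hjk (Subtype.ext h))
      rw [← ha, ← hb, Nat.coprime_self] at hcop
      exact hx1 (orderOf_eq_one_iff.1 hcop)
  have hnp : ∀ j, ∃ b, 0 < b ∧ Nat.card (Lin (H j)) = j.1 ^ b := fun j => lin_card_p (hpr j) (H j) (P j).2 (hHb j)
  have hnt : ∀ j, Nontrivial (Lin (H j)) := by
    intro j
    obtain ⟨b, hb, hc⟩ := hnp j
    apply lin_nontriv
    rw [hc]
    exact Nat.one_lt_pow hb.ne' (hpr j).one_lt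
  have hi0 : ∀ j : ι, j ≠ i0 → j.1 ≠ q := fun j h h' => h (Subtype.ext h')
  have hjodd : ∀ j : ι, Odd j.1 := fun j => hK.odd.of_dvd_nat (hdv j)
  obtain ⟨p, u, hp, hpq, hc, hu⟩ := hLq i0 rfl
  have hcK : L i0 ∣ Nat.card K :=
    (Dvd.intro _ (hL i0).symm).trans (Nm (H i0)).card_subgroup_dvd_card
  have hpK : p ∣ Nat.card K := (dvd_pow_self p hu.ne').trans (hc ▸ hcK)
  let i1 : ι := ⟨p, Nat.mem_primeFactors.2 ⟨hp, hpK, Nat.card_pos.ne'⟩⟩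
  have h01 : i1 ≠ i0 := fun h => hpq (congrArg Subtype.val h)
  have hcyc : ∀ j, j ≠ i0 → Nat.card (Lin (H j)) = Nat.card (H j) := fun j hj =>
    lin_card_comm (H j) (hLp j (hi0 j hj)).1
  obtain ⟨-, a, hl, ha, hl3, hlp, hl2⟩ := hLp i1 (hi0 i1 h01)
  change L i1 ∣ p - 1 at hlp
  change 2 * L i1 + 1 ≤ p at hl2
  have hcp : p ≤ L i0 := by
    rw [hc]; exact Nat.le_self_pow hu.ne' p
  have hwn : ∀ j, (FX (H j)).card * L j + 1 = Nat.card (Lin (H j)) := fun j => card_FX hK.odd (hTI j) (hL j)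
  refine numeric L (fun j => Nat.card (Lin (H j))) (fun j => Nat.card (H j)) (fun j => (FX (H j)).card) (Nat.card K)
    i0 i1 h01 Nat.card_pos Nat.card_pos (count hC) (fun i => mainC hC hK.odd i (hnt i)) hwn
    (fun j => two_le_FX hK.odd (hTI j) (hL j) (hnt j)) (fun j hj => ?_) (fun j hj => (hcyc j hj).symm) ?_ ?_ ?_ ?_ ?_
  · obtain ⟨-, _, _, _, h3, _⟩ := hLp j (hi0 j hj)
    exact h3
  · intro j k _ _ hjk h
    obtain ⟨b, hb, hc⟩ := hnp j
    obtain ⟨b', hb', hc'⟩ := hnp k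
    have hcop : Nat.Coprime (j.1 ^ b) (k.1 ^ b') :=
      Nat.Coprime.pow _ _ ((Nat.coprime_primes (hpr j) (hpr k)).2 fun h => hjk (Subtype.ext h))
    change Nat.card (Lin (H j)) = Nat.card (Lin (H k)) at h
    rw [← hc, ← hc', ← h, Nat.coprime_self, hc] at hcop
    exact (Nat.one_lt_pow hb.ne' (hpr j).one_lt).ne' hcop
  · intro j _
    obtain ⟨b, hb, hc⟩ := hnp j
    change Odd (Nat.card (Lin (H j)))
    rw [hc]; exact (hjodd j).pow
  · change L i0 = Nat.card (Lin (H i1)) ∨ (2 * L i1 + 1) * L i0 ≤ Nat.card (Lin (H i1))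
    rw [hcyc i1 h01, hcardH i1]
    change L i0 = p ^ (Nat.card K).factorization p ∨ _ ≤ p ^ (Nat.card K).factorization p
    rw [hc] at hcK ⊢
    have hle : u ≤ (Nat.card K).factorization p := (hp.pow_dvd_iff_le_factorization Nat.card_pos.ne').1 hcK
    rcases hle.eq_or_lt with h | h
    · left; rw [h]
    · right
      calc (2 * L i1 + 1) * p ^ u ≤ p * p ^ u := Nat.mul_le_mul_right _ hl2
        _ = p ^ (u + 1) := by ring
        _ ≤ _ := Nat.pow_le_pow_right hp.pos h
  · omega
  · change L i1 ≤ (FX (H i0)).card + 1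
    obtain ⟨b, hb, hn0⟩ := hnp i0
    have hw := hwn i0
    have hw2 := two_le_FX hK.odd (hTI i0) (hL i0) (hnt i0)
    set w := (FX (H i0)).card
    have hn0' : Nat.card (Lin (H i0)) = q ^ b := hn0
    have hbig : q ^ a ≤ q ^ b := by
      rw [← hl, ← hn0', ← hw]
      have : 2 * L i0 ≤ w * L i0 := Nat.mul_le_mul_right _ hw2
      omega
    have hab : a ≤ b := (Nat.pow_le_pow_iff_right hK.hq.one_lt).1 hbig
    have hdvd : L i1 ∣ w * L i0 + 1 := by
      rw [hw, hn0', hl]; exact pow_dvd_pow q hab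
    have hc1 : L i0 ≡ 1 [MOD L i1] := by
      have h1 : p ≡ 1 [MOD L i1] := ((Nat.modEq_iff_dvd' hp.one_lt.le).2 hlp).symm
      rw [hc]
      simpa using h1.pow u
    have h2 : w * L i0 + 1 ≡ w * 1 + 1 [MOD L i1] := (hc1.mul_left w).add_right 1
    have h3 : L i1 ∣ w + 1 := by
      rw [← mul_one w]
      exact (h2.dvd_iff dvd_rfl).1 hdvd
    exact Nat.le_of_dvd (by omega) h3

end
end EPPOaux
end

section
set_option linter.unusedSectionVars false
set_option linter.unusedSimpArgs false
set_option linter.style.haveILetI false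
open scoped BigOperators Classical commutatorElement
namespace EPPOaux

theorem even_case {G : Type*} [Group G] [Finite G] (hG : IsEPPOGroup G) {q : ℕ} (hq : q.Prime) (hodd : Odd q)
    (Q : Subgroup G) [hn : Q.Normal] (hQ : Q ≠ ⊥) (hQq : IsPGroup q Q) (h2 : 2 ∣ Nat.card G) : Group.IsSolvable G := by
  haveI : Fact (Nat.Prime 2) := ⟨Nat.prime_two⟩
  haveI : Fact q.Prime := ⟨hq⟩
  have hq2 : q ≠ 2 := by rintro rfl; exact absurd hodd (by decide)
  have hinv : ∀ t : G, orderOf t = 2 → ∀ y ∈ Q, t * y * t⁻¹ = y⁻¹ := by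
    intro t ht y hy
    have hfp : MonoidHom.FixedPointFree (MulAut.conjNormal (H := Q) t) := by
      intro x hx
      have hx' : t * (x : G) * t⁻¹ = x := by
        rw [← MulAut.conjNormal_apply, hx]
      have hc : Commute t (x : G) := by
        rw [mul_inv_eq_iff_eq_mul] at hx'
        exact hx'
      obtain ⟨m, hm⟩ := eppo_cent hG Nat.prime_two (k := 1) (by rw [ht, pow_one]) (order_ne_one Nat.prime_two ht) hc
      obtain ⟨k, hk⟩ := pow_order_of_pgroup hq hQq x.2
      have hcop : Nat.Coprime (q ^ k) (2 ^ m) := Nat.Coprime.pow _ _ ((Nat.coprime_primes hq Nat.prime_two).2 hq2)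
      rw [← hm, ← hk, Nat.coprime_self] at hcop
      exact Subtype.ext (orderOf_eq_one_iff.1 hcop)
    have h := hfp.coe_eq_inv_of_involutive (by
      intro x
      rw [← MulAut.mul_apply, ← map_mul, ← pow_two, ← ht, pow_orderOf_eq_one, map_one, MulAut.one_apply])
    have h3 := congrArg Subtype.val (congrFun h ⟨y, hy⟩)
    rw [MulAut.conjNormal_apply] at h3
    exact h3
  obtain ⟨t, ht⟩ := exists_prime_orderOf_dvd_card' 2 h2
  obtain ⟨x, hx, hx1⟩ := (Subgroup.bot_or_exists_ne_one Q).resolve_left hQ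
  obtain ⟨k, hk⟩ := pow_order_of_pgroup hq hQq hx
  let C := Subgroup.centralizer (Q : Set G)
  haveI hCn : C.Normal := inferInstance
  have hmemC : ∀ g, g ∈ C ↔ ∀ y ∈ Q, y * g = g * y := fun g => Subgroup.mem_centralizer_iff
  have hCq : IsPGroup q C := cent_pgroup hG hq hk hx1 (fun y hy => (hmemC y).1 hy x hx)
  have htC : (QuotientGroup.mk' C t) ≠ 1 := by
    intro h
    have h1 : t ∈ C := (QuotientGroup.eq_one_iff t).1 h
    obtain ⟨m, hm⟩ := eppo_cent hG hq hk hx1 ((hmemC t).1 h1 x hx)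
    rw [ht] at hm
    have : q ∣ 2 := by
      rw [hm]; apply dvd_pow_self; rintro rfl; simp at hm
    exact hq2 ((Nat.prime_dvd_prime_iff_eq hq Nat.prime_two).1 this)
  have hto : orderOf (QuotientGroup.mk' C t) = 2 := by
    apply orderOf_eq_prime _ htC
    rw [← map_pow, ← ht, pow_orderOf_eq_one, map_one]
  have hF : IsEPPOGroup (G ⧸ C) := eppo_surj hG _ (QuotientGroup.mk'_surjective C)
  have hF2 : IsPGroup 2 (G ⧸ C) := by
    rw [IsPGroup.iff_orderOf]
    intro y
    obtain ⟨g, rfl⟩ := QuotientGroup.mk'_surjective C y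
    refine eppo_cent hF Nat.prime_two (k := 1) (by rw [hto, pow_one]) htC ?_
    change _ * _ = _ * _
    rw [← map_mul, ← map_mul]
    apply (QuotientGroup.eq (s := C)).2
    rw [hmemC]
    intro y hy
    have e1 : (t * g)⁻¹ * (g * t) = g⁻¹ * (t⁻¹ * (g * t * g⁻¹)) * g := by group
    have hn' := hn.conj_mem y hy g
    have h5 := hinv (g * t * g⁻¹) (by rw [orderOf_conj', ht]) (g * y * g⁻¹) hn'
    have h6 := hinv t⁻¹ (by rw [orderOf_inv, ht]) _ (inv_mem hn')
    have h7 : (t⁻¹ * (g * t * g⁻¹)) * (g * y * g⁻¹) * (t⁻¹ * (g * t * g⁻¹))⁻¹ = g * y * g⁻¹ := by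
      rw [inv_inv (g * y * g⁻¹), ← h5] at h6
      refine Eq.trans ?_ h6
      group
    rw [e1]
    have h8 : t⁻¹ * (g * t * g⁻¹) * (g * y * g⁻¹) = g * y * g⁻¹ * (t⁻¹ * (g * t * g⁻¹)) := mul_inv_eq_iff_eq_mul.1 h7
    calc y * (g⁻¹ * (t⁻¹ * (g * t * g⁻¹)) * g) = g⁻¹ * (g * y * g⁻¹ * (t⁻¹ * (g * t * g⁻¹))) * g := by group
      _ = _ := by rw [← h8]; group
  haveI := hF2.isNilpotent
  haveI := hCq.isNilpotent
  exact (Group.isSolvable_iff_subgroup_quotient C).2 ⟨inferInstance, inferInstance⟩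

theorem odd_case {q : ℕ} (hq : q.Prime) (hodd : Odd q) : ∀ (n : ℕ) (G : Type*) [Group G] [Finite G],
    Nat.card G ≤ n → IsEPPOGroup G → Odd (Nat.card G) → ∀ Q : Subgroup G, Q.Normal → Q ≠ ⊥ → IsPGroup q Q →
    Group.IsSolvable G := by
  haveI : Fact q.Prime := ⟨hq⟩
  intro n
  induction n with
  | zero => intro G _ _ h; exact absurd h (by have := Nat.card_pos (α := G); omega)
  | succ n ih =>
    intro G _ _ hn hG ho Q hQn hQ hQq
    have hR : Oq q G ≠ ⊥ := fun h => hQ (le_bot_iff.1 (h ▸ le_Oq hQn hQq))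
    have hRq : IsPGroup q (Oq q G) := Oq_pgroup hq
    haveI := hRq.isNilpotent
    suffices h : Group.IsSolvable (G ⧸ Oq q G) from
      (Group.isSolvable_iff_subgroup_quotient (Oq q G)).2 ⟨inferInstance, h⟩
    rcases subsingleton_or_nontrivial (G ⧸ Oq q G) with hss | hnt
    · infer_instance
    have hsub : ∀ H : Subgroup (G ⧸ Oq q G), H ≠ ⊤ → Group.IsSolvable H := by
      intro H hH
      let f := QuotientGroup.mk' (Oq q G)
      have hf : Function.Surjective f := QuotientGroup.mk'_surjective _
      have hle : Oq q G ≤ H.comap f := by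
        intro x hx
        have h1 : f x = 1 := (QuotientGroup.eq_one_iff x).2 hx
        rw [Subgroup.mem_comap, h1]
        exact H.one_mem
      have hlt : Nat.card (H.comap f) < Nat.card G := by
        rw [← Subgroup.card_top (G := G)]
        apply card_lt_of_lt
        rw [lt_top_iff_ne_top]
        intro h
        apply hH
        rw [eq_top_iff]
        intro y _
        obtain ⟨x, rfl⟩ := hf y
        have : x ∈ H.comap f := by rw [h]; trivial
        exact this
      haveI : Group.IsSolvable (H.comap f) := by
        refine ih (H.comap f) (by omega) (eppo_sub hG _) (ho.of_dvd_nat (Subgroup.card_subgroup_dvd_card _))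
          ((Oq q G).subgroupOf (H.comap f)) inferInstance ?_
          (hRq.comap_of_injective (H.comap f).subtype (H.comap f).subtype_injective)
        intro h
        exact hR ((Subgroup.subgroupOf_eq_bot.1 h).eq_bot_of_le hle)
      exact Group.isSolvable_of_surjective (f := f.subgroupComap H) (by
        rintro ⟨y, hy⟩
        obtain ⟨x, rfl⟩ := hf y
        exact ⟨⟨x, hy⟩, rfl⟩)
    by_cases hp : commutator (G ⧸ Oq q G) = ⊤
    · exfalso
      haveI := Fintype.ofFinite (G ⧸ Oq q G)
      exact MC_false (q := q) (K := G ⧸ Oq q G)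
        { hq := hq, hq2 := hodd, odd := ho.of_dvd_nat (Subgroup.card_quotient_dvd_card _)
          good := good_quot hG hq _ hR hRq, O := Oq_quot hq, sub := hsub, perf := hp, nt := hnt }
    · have h1 := hsub _ hp
      have h2 : Group.IsSolvable (Abelianization (G ⧸ Oq q G)) := inferInstance
      exact (Group.isSolvable_iff_subgroup_quotient (commutator (G ⧸ Oq q G))).2 ⟨h1, h2⟩

end EPPOaux
end

theorem EPPO_normal_odd_qSubgroup_solvable {G : Type*} [Group G] [Finite G]
    (hG : IsEPPOGroup G) {q : ℕ} (hq : q.Prime) (hodd : Odd q)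
    (Q : Subgroup G) [Q.Normal] (hQ : Q ≠ ⊥) (hQq : IsPGroup q Q) :
    IsSolvable G := by
  by_cases h2 : 2 ∣ Nat.card G
  · exact EPPOaux.even_case hG hq hodd Q hQ hQq h2
  · exact EPPOaux.odd_case hq hodd (Nat.card G) G le_rfl hG
      (Nat.not_even_iff_odd.1 fun h => h2 h.two_dvd) Q inferInstance hQ hQq
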